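/- There is an absolute constant K > 0 such that the following holds for every odd prime p and every θ ∈ (0,1]: if f : 𝔽_p → [0,1] satisfies 𝔼(f) ≥ θ and Λ(f) ≤ Λ(g) for every g : 𝔽_p → [0,1] with 𝔼(g) ≥ θ (i.e. f minimizes Λ subject to the density constraint), then Σ_{n ∈ 𝔽_p} |f(n) − C(n)| ≤ K·p·(log p)^{−2/3}, where C(n) := 1 if f(n) ≥ 1/2 and C(n) := 0 otherwise. In particular, f is approximately a {0,1}-valued indicator function. -/

import Mathlib

noncomputable def Lam (p : ℕ) [NeZero p] (f : ZMod p → ℝ) : ℝ :=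
  ((p : ℝ) ^ 2)⁻¹ * ∑ n : ZMod p, ∑ d : ZMod p, f n * f (n + d) * f (n + 2 * d)

noncomputable def Ex (p : ℕ) [NeZero p] (f : ZMod p → ℝ) : ℝ :=
  (p : ℝ)⁻¹ * ∑ n : ZMod p, f n


namespace RB

variable {G : Type} [AddCommGroup G] [Fintype G]

/-- Bohr sets. -/
noncomputable def bohr (Γ : Finset (AddChar G ℂ)) (ρ : ℝ) : Finset G :=
  Finset.univ.filter fun x => ∀ γ ∈ Γ, ‖γ x - 1‖ ≤ ρ

lemma mem_bohr {Γ : Finset (AddChar G ℂ)} {ρ : ℝ} {x : G} :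
    x ∈ bohr Γ ρ ↔ ∀ γ ∈ Γ, ‖γ x - 1‖ ≤ ρ := by simp [bohr]

lemma nrm (γ : AddChar G ℂ) (x : G) : ‖γ x‖ = 1 := AddChar.norm_apply γ x

lemma norm_add_sub_one (γ : AddChar G ℂ) (x y : G) :
    ‖γ (x + y) - 1‖ ≤ ‖γ x - 1‖ + ‖γ y - 1‖ := by
  have h : γ (x + y) - 1 = γ x * (γ y - 1) + (γ x - 1) := by
    rw [AddChar.map_add_eq_mul]; ring
  rw [h]
  refine (norm_add_le _ _).trans ?_
  rw [norm_mul, nrm, one_mul, add_comm]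

lemma norm_sub_sub_one (γ : AddChar G ℂ) (x y : G) :
    ‖γ (x - y) - 1‖ = ‖γ x - γ y‖ := by
  have h : γ x - γ y = (γ (x - y) - 1) * γ y := by
    have : γ x = γ (x - y) * γ y := by rw [← AddChar.map_add_eq_mul]; simp
    rw [this]; ring
  rw [h, norm_mul, nrm, mul_one]

lemma norm_neg_sub_one (γ : AddChar G ℂ) (x : G) :
    ‖γ (-x) - 1‖ = ‖γ x - 1‖ := by
  have := norm_sub_sub_one γ 0 x
  rw [zero_sub] at this
  rw [this, AddChar.map_zero_eq_one, norm_sub_rev]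

lemma bohr_mono {Γ : Finset (AddChar G ℂ)} {ρ ρ' : ℝ} (h : ρ ≤ ρ') : bohr Γ ρ ⊆ bohr Γ ρ' := by
  intro x hx
  rw [mem_bohr] at *
  exact fun γ hγ => (hx γ hγ).trans h

lemma bohr_anti {Γ Γ' : Finset (AddChar G ℂ)} {ρ : ℝ} (h : Γ ⊆ Γ') : bohr Γ' ρ ⊆ bohr Γ ρ := by
  intro x hx
  rw [mem_bohr] at *
  exact fun γ hγ => hx γ (h hγ)

lemma zero_mem_bohr {Γ : Finset (AddChar G ℂ)} {ρ : ℝ} (h : 0 ≤ ρ) : (0 : G) ∈ bohr Γ ρ := by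
  rw [mem_bohr]; intro γ _; simpa using h

lemma bohr_card_pos {Γ : Finset (AddChar G ℂ)} {ρ : ℝ} (h : 0 ≤ ρ) :
    0 < ((bohr Γ ρ).card : ℝ) := by
  exact_mod_cast Finset.card_pos.2 ⟨0, zero_mem_bohr h⟩

lemma add_mem_bohr {Γ : Finset (AddChar G ℂ)} {ρ ρ' : ℝ} {x y : G} (hx : x ∈ bohr Γ ρ)
    (hy : y ∈ bohr Γ ρ') : x + y ∈ bohr Γ (ρ + ρ') := by
  rw [mem_bohr] at *
  exact fun γ hγ => (norm_add_sub_one γ x y).trans (add_le_add (hx γ hγ) (hy γ hγ))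

lemma neg_mem_bohr {Γ : Finset (AddChar G ℂ)} {ρ : ℝ} {x : G} (hx : x ∈ bohr Γ ρ) :
    -x ∈ bohr Γ ρ := by
  rw [mem_bohr] at *
  exact fun γ hγ => by rw [norm_neg_sub_one]; exact hx γ hγ

lemma neg_mem_bohr_iff {Γ : Finset (AddChar G ℂ)} {ρ : ℝ} {x : G} :
    -x ∈ bohr Γ ρ ↔ x ∈ bohr Γ ρ :=
  ⟨fun h => by simpa using neg_mem_bohr h, neg_mem_bohr⟩

lemma sub_mem_bohr {Γ : Finset (AddChar G ℂ)} {ρ ρ' : ℝ} {x y : G} (hx : x ∈ bohr Γ ρ)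
    (hy : y ∈ bohr Γ ρ') : x - y ∈ bohr Γ (ρ + ρ') := by
  rw [sub_eq_add_neg]; exact add_mem_bohr hx (neg_mem_bohr hy)

/-- The grid cell. -/
noncomputable def cell (ρ : ℝ) (z : ℂ) : ℤ × ℤ := (⌊(z.re - 1) * (2 / ρ)⌋, ⌊z.im * (2 / ρ)⌋)

lemma floor_range {ρ u : ℝ} (hρ : 0 < ρ) (h : |u| ≤ 2 * ρ) :
    ⌊u * (2 / ρ)⌋ ∈ Finset.Icc (-4 : ℤ) 4 := by
  rw [abs_le] at h
  have e1 : 2 * ρ * (2 / ρ) = 4 := by field_simp; norm_num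
  have h0 : 0 < 2 / ρ := by positivity
  have h1 : u * (2 / ρ) ≤ 4 := by
    rw [← e1]; exact mul_le_mul_of_nonneg_right h.2 h0.le
  have h2 : -4 ≤ u * (2 / ρ) := by
    have := mul_le_mul_of_nonneg_right h.1 h0.le
    linarith
  rw [Finset.mem_Icc]
  constructor
  · apply Int.le_floor.2; push_cast; exact h2
  · have : (⌊u * (2 / ρ)⌋ : ℝ) ≤ 4 := (Int.floor_le _).trans h1
    exact_mod_cast this

lemma floor_close {ρ u v : ℝ} (hρ : 0 < ρ) (h : ⌊u * (2 / ρ)⌋ = ⌊v * (2 / ρ)⌋) :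
    |u - v| ≤ ρ / 2 := by
  have := Int.abs_sub_lt_one_of_floor_eq_floor h
  rw [← sub_mul, abs_mul, abs_of_pos (by positivity : 0 < 2 / ρ)] at this
  rw [mul_div_assoc', div_lt_one hρ] at this
  linarith

lemma cell_close {ρ : ℝ} {z w : ℂ} (hρ : 0 < ρ) (h : cell ρ z = cell ρ w) : ‖z - w‖ ≤ ρ := by
  simp only [cell, Prod.mk.injEq] at h
  have h1 := floor_close hρ h.1
  have h2 := floor_close hρ h.2
  have := Complex.norm_le_abs_re_add_abs_im (z - w)
  simp only [Complex.sub_re, Complex.sub_im] at this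
  have e : z.re - 1 - (w.re - 1) = z.re - w.re := by ring
  rw [e] at h1
  linarith

lemma cell_range {ρ : ℝ} {z : ℂ} (hρ : 0 < ρ) (h : ‖z - 1‖ ≤ 2 * ρ) :
    cell ρ z ∈ Finset.Icc (-4 : ℤ) 4 ×ˢ Finset.Icc (-4 : ℤ) 4 := by
  rw [Finset.mem_product]
  have h1 := (Complex.abs_re_le_norm (z - 1)).trans h
  have h2 := (Complex.abs_im_le_norm (z - 1)).trans h
  simp only [Complex.sub_re, Complex.sub_im, Complex.one_re, Complex.one_im, sub_zero] at h1 h2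
  exact ⟨floor_range hρ h1, floor_range hρ h2⟩

lemma bohr_double (Γ : Finset (AddChar G ℂ)) {ρ : ℝ} (hρ : 0 < ρ) :
    (bohr Γ (2 * ρ)).card ≤ 100 ^ Γ.card * (bohr Γ ρ).card := by
  classical
  let F : G → (Γ → ℤ × ℤ) := fun x γ => cell ρ (γ.1 x)
  let S : Finset (Γ → ℤ × ℤ) :=
    Fintype.piFinset fun _ => Finset.Icc (-4 : ℤ) 4 ×ˢ Finset.Icc (-4 : ℤ) 4
  have h1 : ∀ x ∈ bohr Γ (2 * ρ), F x ∈ S := by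
    intro x hx
    rw [Fintype.mem_piFinset]
    intro γ
    exact cell_range hρ (mem_bohr.1 hx γ.1 γ.2)
  have h2 := Finset.card_le_mul_card_image_of_maps_to h1 (bohr Γ ρ).card (by
    intro b _
    by_cases hne : ((bohr Γ (2 * ρ)).filter fun x => F x = b).Nonempty
    · obtain ⟨y, hy⟩ := hne
      rw [Finset.mem_filter] at hy
      apply Finset.card_le_card_of_injOn (fun x => x - y)
      · intro x hx
        have hx := (Finset.mem_filter.1 hx).2
        simp only [Finset.mem_coe]
        rw [mem_bohr]
        intro γ hγ
        rw [norm_sub_sub_one]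
        apply cell_close hρ
        have := congrFun (hx.trans hy.2.symm) ⟨γ, hγ⟩
        exact this
      · intro x _ x' _ h
        simpa using h
    · rw [Finset.not_nonempty_iff_eq_empty] at hne
      rw [hne]; simp)
  have h3 : S.card ≤ 100 ^ Γ.card := by
    simp only [S, Fintype.card_piFinset, Finset.card_product, Int.card_Icc, Finset.prod_const,
      Finset.card_univ, Fintype.card_coe]
    apply Nat.pow_le_pow_left
    decide
  calc _ ≤ _ := h2
    _ ≤ _ := by rw [mul_comm]; exact Nat.mul_le_mul_right _ h3

lemma bohr_two (Γ : Finset (AddChar G ℂ)) : bohr Γ 2 = Finset.univ := by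
  ext x
  simp only [mem_bohr, Finset.mem_univ, iff_true]
  intro γ _
  refine (norm_sub_le _ _).trans ?_
  rw [nrm]; norm_num

lemma bohr_lower (Γ : Finset (AddChar G ℂ)) (j : ℕ) :
    Fintype.card G ≤ 100 ^ (Γ.card * j) * (bohr Γ (2 / 2 ^ j)).card := by
  induction j with
  | zero => simp [bohr_two]
  | succ j ih =>
    have h := bohr_double Γ (ρ := 2 / 2 ^ (j + 1)) (by positivity)
    have e : (2 : ℝ) * (2 / 2 ^ (j + 1)) = 2 / 2 ^ j := by
      rw [pow_succ]; field_simp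
    rw [e] at h
    calc _ ≤ _ := ih
      _ ≤ 100 ^ (Γ.card * j) * (100 ^ Γ.card * (bohr Γ (2 / 2 ^ (j + 1))).card) := by gcongr
      _ = _ := by ring

/-- Regularity. -/
lemma bohr_reg (Γ : Finset (AddChar G ℂ)) {ρ ε : ℝ} (hρ : 0 < ρ) (hε : 0 < ε) (hε1 : ε ≤ 1)
    (l : ℕ) (hl0 : 0 < l) (hl : 10 * Γ.card ≤ ε * l) :
    ∃ r, ρ ≤ r ∧ r ≤ 2 * ρ ∧ ((bohr Γ (r + ρ / l)).card : ℝ) ≤ (1 + ε) * (bohr Γ r).card := by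
  by_contra! hcon
  have hl0' : (0 : ℝ) < l := by exact_mod_cast hl0
  have key : ∀ i : ℕ, i ≤ l → (1 + ε) ^ i * ((bohr Γ ρ).card : ℝ) ≤
      (bohr Γ (ρ + i * (ρ / l))).card := by
    intro i
    induction i with
    | zero => intro _; simp
    | succ i ih =>
      intro hi
      have h1 := ih (by omega)
      have hil : (i : ℝ) ≤ l := by exact_mod_cast (by omega : i ≤ l)
      have h2 := hcon (ρ + i * (ρ / l)) (by
        have : 0 ≤ i * (ρ / l) := by positivity
        linarith) (by
        have : i * (ρ / l) ≤ l * (ρ / l) := by gcongr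
        have e : l * (ρ / l) = ρ := by field_simp
        linarith)
      have e : ρ + i * (ρ / l) + ρ / l = ρ + (i + 1 : ℕ) * (ρ / l) := by push_cast; ring
      rw [e] at h2
      rw [pow_succ]
      nlinarith
  have h1 := key l le_rfl
  have e : ρ + l * (ρ / l) = 2 * ρ := by field_simp; norm_num
  rw [e] at h1
  have h2 : ((bohr Γ (2 * ρ)).card : ℝ) ≤ 100 ^ Γ.card * (bohr Γ ρ).card := by
    exact_mod_cast bohr_double Γ hρ
  have hpos := bohr_card_pos (Γ := Γ) hρ.le
  have h3 : (1 + ε) ^ l ≤ 100 ^ Γ.card := by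
    have := h1.trans h2
    exact le_of_mul_le_mul_right this hpos
  -- lower bound
  rcases Nat.eq_zero_or_pos Γ.card with h0 | h0
  · rw [h0, pow_zero] at h3
    have := one_lt_pow₀ (by linarith : 1 < 1 + ε) hl0.ne'
    linarith
  have h4 : Real.exp (ε / 2) ≤ 1 + ε := by
    have hb := Real.abs_exp_sub_one_sub_id_le (x := ε / 2) (by rw [abs_of_pos] <;> linarith)
    have := (abs_le.1 hb).2
    nlinarith
  have h5 : Real.exp (ε / 2 * l) ≤ (1 + ε) ^ l := by
    rw [mul_comm, Real.exp_nat_mul]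
    exact pow_le_pow_left₀ (Real.exp_pos _).le h4 l
  have h6 : Real.exp (5 * Γ.card) ≤ Real.exp (ε / 2 * l) := by
    apply Real.exp_le_exp.2; linarith
  have h7 : Real.exp (5 * Γ.card) = (Real.exp 5) ^ Γ.card := by
    rw [mul_comm, Real.exp_nat_mul]
  have h8 : (100 : ℝ) < Real.exp 5 := by
    have := Real.exp_one_gt_d9
    have e : Real.exp 5 = Real.exp 1 ^ 5 := by rw [← Real.exp_nat_mul]; norm_num
    rw [e]
    calc (100 : ℝ) < 2.7 ^ 5 := by norm_num
      _ ≤ _ := by gcongr; linarith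
  have h9 := pow_lt_pow_left₀ h8 (by norm_num) h0.ne'
  linarith

end RB


set_option linter.unusedSectionVars false
set_option linter.unusedVariables false
namespace RB

variable {G : Type} [AddCommGroup G] [Fintype G] [DecidableEq G]

/-- Averaging operator attached to a weight. -/
noncomputable def sm (w u : G → ℝ) (x : G) : ℝ := ∑ y, w y * u (x + y)

/-- Probability weights. -/
def Pr (w : G → ℝ) : Prop := (∀ y, 0 ≤ w y) ∧ ∑ y, w y = 1

/-- Uniform weight on a finite set. -/
noncomputable def un (S : Finset G) (x : G) : ℝ := if x ∈ S then (S.card : ℝ)⁻¹ else 0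

/-- Convolution of weights. -/
noncomputable def cv (w w' : G → ℝ) (z : G) : ℝ := ∑ y, w y * w' (z - y)

lemma sum_shift (u : G → ℝ) (y : G) : ∑ x, u (x + y) = ∑ x, u x :=
  Fintype.sum_equiv (Equiv.addRight y) _ _ (fun _ => rfl)

lemma un_pr {S : Finset G} (h : S.Nonempty) : Pr (un S) := by
  refine ⟨fun y => ?_, ?_⟩
  · unfold un; split_ifs <;> positivity
  · have : (S.card : ℝ) ≠ 0 := by exact_mod_cast h.card_pos.ne'
    simp [un, Finset.sum_ite_mem, this]

lemma un_supp {S : Finset G} {x : G} (h : un S x ≠ 0) : x ∈ S := by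
  by_contra h'; exact h (by simp [un, h'])

lemma sm_un (S : Finset G) (u : G → ℝ) (x : G) :
    sm (un S) u x = (S.card : ℝ)⁻¹ * ∑ y ∈ S, u (x + y) := by
  simp [sm, un, ite_mul, Finset.sum_ite_mem, Finset.mul_sum]

lemma sm_cv (w w' u : G → ℝ) : sm (cv w w') u = sm w (sm w' u) := by
  ext x
  simp only [sm, cv, Finset.sum_mul, Finset.mul_sum]
  rw [Finset.sum_comm]
  refine Finset.sum_congr rfl fun y _ => ?_
  rw [← sum_shift (fun z => w y * w' (z - y) * u (x + z)) y]
  refine Finset.sum_congr rfl fun z _ => ?_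
  simp only [add_sub_cancel_right]
  rw [show x + (z + y) = x + y + z by abel]; ring

lemma sm_comm (w w' u : G → ℝ) : sm w (sm w' u) = sm w' (sm w u) := by
  ext x
  simp only [sm, Finset.mul_sum]
  rw [Finset.sum_comm]
  refine Finset.sum_congr rfl fun y _ => Finset.sum_congr rfl fun z _ => ?_
  rw [show x + z + y = x + y + z by abel]; ring

lemma cv_pr {w w' : G → ℝ} (h : Pr w) (h' : Pr w') : Pr (cv w w') := by
  refine ⟨fun y => Finset.sum_nonneg fun z _ => mul_nonneg (h.1 _) (h'.1 _), ?_⟩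
  simp only [cv]
  rw [Finset.sum_comm]
  have : ∀ y, ∑ z, w y * w' (z - y) = w y := by
    intro y
    rw [← Finset.mul_sum]
    have := sum_shift w' (-y)
    simp only [← sub_eq_add_neg] at this
    rw [this, h'.2, mul_one]
  simp [this, h.2]

lemma cv_supp {w w' : G → ℝ} {z : G} (h : cv w w' z ≠ 0) :
    ∃ y, w y ≠ 0 ∧ w' (z - y) ≠ 0 := by
  obtain ⟨y, _, hy⟩ := Finset.exists_ne_zero_of_sum_ne_zero h
  exact ⟨y, left_ne_zero_of_mul hy, right_ne_zero_of_mul hy⟩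

lemma sum_sm {w : G → ℝ} (h : Pr w) (u : G → ℝ) : ∑ x, sm w u x = ∑ x, u x := by
  simp only [sm]
  rw [Finset.sum_comm]
  simp only [← Finset.mul_sum, sum_shift, ← Finset.sum_mul, h.2, one_mul]

lemma sm_adj {w : G → ℝ} (h : ∀ y, w (-y) = w y) (u v : G → ℝ) :
    ∑ x, sm w u x * v x = ∑ x, u x * sm w v x := by
  simp only [sm, Finset.sum_mul, Finset.mul_sum]
  rw [Finset.sum_comm]
  rw [Finset.sum_comm (f := fun x y => u x * (w y * v (x + y)))]
  rw [← Equiv.sum_comp (Equiv.neg G)]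
  refine Finset.sum_congr rfl fun y _ => ?_
  rw [← sum_shift _ y]
  refine Finset.sum_congr rfl fun x _ => ?_
  simp only [Equiv.neg_apply, h]
  rw [add_neg_cancel_right]; ring

lemma sm_sub (w u v : G → ℝ) : sm w (u - v) = sm w u - sm w v := by
  ext x; simp [sm, mul_sub]

lemma sm_nonneg {w : G → ℝ} (h : Pr w) {u : G → ℝ} (hu : ∀ x, 0 ≤ u x) (x : G) : 0 ≤ sm w u x :=
  Finset.sum_nonneg fun y _ => mul_nonneg (h.1 _) (hu _)

lemma sm_le {w : G → ℝ} (h : Pr w) {u : G → ℝ} {M : ℝ} (hu : ∀ x, u x ≤ M) (x : G) :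
    sm w u x ≤ M := by
  calc sm w u x ≤ ∑ y, w y * M := Finset.sum_le_sum fun y _ =>
        mul_le_mul_of_nonneg_left (hu _) (h.1 _)
    _ = M := by rw [← Finset.sum_mul, h.2, one_mul]

/-- eighth power norm -/
noncomputable def N8 (u : G → ℝ) : ℝ := ∑ x, u x ^ 8

lemma N8_nonneg (u : G → ℝ) : 0 ≤ N8 u := Finset.sum_nonneg fun x _ => by positivity

lemma N8_sm {w : G → ℝ} (h : Pr w) (u : G → ℝ) : N8 (sm w u) ≤ N8 u := by
  have key : ∀ x, sm w u x ^ 8 ≤ sm w (fun x => u x ^ 8) x := by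
    intro x
    exact Real.pow_arith_mean_le_arith_mean_pow_of_even Finset.univ w (fun y => u (x + y))
      (fun y _ => h.1 y) h.2 (by decide)
  calc N8 (sm w u) ≤ ∑ x, sm w (fun x => u x ^ 8) x := Finset.sum_le_sum fun x _ => key x
    _ = N8 u := sum_sm h _

lemma N8_add_le (u v : G → ℝ) : N8 (u + v) ≤ 2 ^ 7 * (N8 u + N8 v) := by
  unfold N8
  rw [← Finset.sum_add_distrib, Finset.mul_sum]
  refine Finset.sum_le_sum fun x _ => ?_
  have e : (u + v) x ^ 8 = |u x + v x| ^ 8 := by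
    rw [Even.pow_abs (by decide)]; rfl
  rw [e]
  calc |u x + v x| ^ 8 ≤ (|u x| + |v x|) ^ 8 := by gcongr; exact abs_add_le _ _
    _ ≤ 2 ^ (8 - 1) * (|u x| ^ 8 + |v x| ^ 8) := add_pow_le (abs_nonneg _) (abs_nonneg _) 8
    _ = _ := by rw [Even.pow_abs (by decide), Even.pow_abs (by decide)]

lemma N8_shift (u : G → ℝ) (y : G) : N8 (fun x => u (x + y)) = N8 u :=
  sum_shift (fun x => u x ^ 8) y

/-- Fourier transform. -/
noncomputable def hat (u : G → ℝ) (γ : AddChar G ℂ) : ℂ := ∑ x, (u x : ℂ) * γ x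

/-- Multiplier of a weight. -/
noncomputable def mu (w : G → ℝ) (γ : AddChar G ℂ) : ℂ := ∑ y, (w y : ℂ) * γ (-y)

lemma hat_sm (w u : G → ℝ) (γ : AddChar G ℂ) : hat (sm w u) γ = hat u γ * mu w γ := by
  simp only [hat, mu, sm, Complex.ofReal_sum, Complex.ofReal_mul, Finset.sum_mul, Finset.mul_sum]
  rw [Finset.sum_comm]
  refine Finset.sum_congr rfl fun y _ => ?_
  have : ∑ x, (u x : ℂ) * γ x * (w y * γ (-y)) =
      ∑ x, (u (x + y) : ℂ) * γ (x + y) * (w y * γ (-y)) :=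
    (Fintype.sum_equiv (Equiv.addRight y) _ _ (fun _ => rfl)).symm
  rw [this]
  refine Finset.sum_congr rfl fun x _ => ?_
  have e : γ (x + y) * γ (-y) = γ x := by rw [← AddChar.map_add_eq_mul]; simp
  calc _ = (w y : ℂ) * u (x + y) * γ x := by ring
    _ = (w y : ℂ) * u (x + y) * (γ (x + y) * γ (-y)) := by rw [e]
    _ = _ := by ring

lemma hat_sub (u v : G → ℝ) (γ : AddChar G ℂ) : hat (u - v) γ = hat u γ - hat v γ := by
  simp [hat, sub_mul]

lemma conj_char (γ : AddChar G ℂ) (x : G) : (starRingEnd ℂ) (γ x) = γ (-x) :=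
  (AddChar.map_neg_eq_conj γ x).symm

lemma parseval (u : G → ℝ) :
    ∑ γ : AddChar G ℂ, ‖hat u γ‖ ^ 2 = Fintype.card G * ∑ x, u x ^ 2 := by
  have h1 : ∀ γ : AddChar G ℂ, ((‖hat u γ‖ ^ 2 : ℝ) : ℂ) =
      ∑ x, ∑ y, (u x : ℂ) * u y * γ (x - y) := by
    intro γ
    rw [← Complex.normSq_eq_norm_sq, Complex.normSq_eq_conj_mul_self, mul_comm]
    simp only [hat, map_sum, map_mul, Complex.conj_ofReal, conj_char]
    rw [Finset.sum_mul_sum]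
    refine Finset.sum_congr rfl fun x _ => Finset.sum_congr rfl fun y _ => ?_
    rw [sub_eq_add_neg, AddChar.map_add_eq_mul]; ring
  have h2 : ((∑ γ : AddChar G ℂ, ‖hat u γ‖ ^ 2 : ℝ) : ℂ) =
      ((Fintype.card G * ∑ x, u x ^ 2 : ℝ) : ℂ) := by
    rw [Complex.ofReal_sum]
    simp only [h1]
    rw [Finset.sum_comm]
    push_cast
    rw [Finset.mul_sum]
    refine Finset.sum_congr rfl fun x _ => ?_
    rw [Finset.sum_comm]
    simp only [← Finset.mul_sum, AddChar.sum_apply_eq_ite, sub_eq_zero]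
    simp
    ring
  exact_mod_cast h2

lemma l2_bound {u v : G → ℝ} {m : AddChar G ℂ → ℂ} {κ : ℝ}
    (h : ∀ γ, hat v γ = hat u γ * m γ) (hm : ∀ γ, ‖m γ‖ ≤ κ) :
    ∑ x, v x ^ 2 ≤ κ ^ 2 * ∑ x, u x ^ 2 := by
  have hc : (0 : ℝ) < Fintype.card G := by exact_mod_cast Fintype.card_pos
  have h1 : ∑ γ : AddChar G ℂ, ‖hat v γ‖ ^ 2 ≤ κ ^ 2 * ∑ γ : AddChar G ℂ, ‖hat u γ‖ ^ 2 := by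
    rw [Finset.mul_sum]
    refine Finset.sum_le_sum fun γ _ => ?_
    rw [h, norm_mul, mul_pow, mul_comm]
    gcongr
    exact hm γ
  rw [parseval, parseval] at h1
  have : Fintype.card G * ∑ x, v x ^ 2 ≤ Fintype.card G * (κ ^ 2 * ∑ x, u x ^ 2) := by
    linarith
  exact le_of_mul_le_mul_left this hc

lemma mu_norm_le {w : G → ℝ} (h : Pr w) (γ : AddChar G ℂ) : ‖mu w γ‖ ≤ 1 := by
  unfold mu
  refine (norm_sum_le _ _).trans ?_
  rw [← h.2]
  refine Finset.sum_le_sum fun y _ => ?_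
  rw [norm_mul, nrm, mul_one, Complex.norm_real, Real.norm_of_nonneg (h.1 y)]

lemma mu_near {w : G → ℝ} (h : Pr w) (γ : AddChar G ℂ) {κ : ℝ}
    (hk : ∀ y, w y ≠ 0 → ‖γ y - 1‖ ≤ κ) : ‖1 - mu w γ‖ ≤ κ := by
  have e : 1 - mu w γ = ∑ y, (w y : ℂ) * (1 - γ (-y)) := by
    simp only [mul_sub, Finset.sum_sub_distrib, mul_one, mu]
    rw [← Complex.ofReal_sum, h.2]; simp
  rw [e]
  refine (norm_sum_le _ _).trans ?_
  calc _ ≤ ∑ y, w y * κ := by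
        refine Finset.sum_le_sum fun y _ => ?_
        rw [norm_mul, Complex.norm_real, Real.norm_of_nonneg (h.1 y)]
        rcases eq_or_ne (w y) 0 with h0 | h0
        · simp [h0]
        · refine mul_le_mul_of_nonneg_left ?_ (h.1 y)
          rw [norm_sub_rev, norm_neg_sub_one]; exact hk y h0
    _ = κ := by rw [← Finset.sum_mul, h.2, one_mul]

lemma mu_un_neg (S : Finset G) (γ : AddChar G ℂ) :
    mu (fun x => un S (-x)) γ = (starRingEnd ℂ) (mu (un S) γ) := by
  simp only [mu, map_sum, map_mul, Complex.conj_ofReal, conj_char, neg_neg]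
  rw [← Equiv.sum_comp (Equiv.neg G)]
  simp

end RB


set_option linter.unusedSectionVars false
set_option linter.unusedVariables false

namespace RB

variable {G : Type} [AddCommGroup G] [Fintype G] [DecidableEq G]

/-- Riesz product. -/
noncomputable def rz (Λ : Finset (AddChar G ℂ)) (ω : AddChar G ℂ → ℂ) (x : G) : ℝ :=
  ∏ γ ∈ Λ, (1 + (ω γ * γ x).re)

/-- Dissociativity relative to a weight. -/
def Diss (ν : G → ℝ) (Λ : Finset (AddChar G ℂ)) : Prop :=
  ∀ ω : AddChar G ℂ → ℂ, (∀ γ, ‖ω γ‖ ≤ 1) →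
    ∑ x, ν x * rz Λ ω x ≤ Real.exp (Λ.card / 16)

lemma re_bd {ω : ℂ} (h : ‖ω‖ ≤ 1) (γ : AddChar G ℂ) (x : G) : |(ω * γ x).re| ≤ 1 :=
  (Complex.abs_re_le_norm _).trans (by rw [norm_mul, nrm, mul_one]; exact h)

lemma exists_phase (z : ℂ) : ∃ ω : ℂ, ‖ω‖ ≤ 1 ∧ ω * z = ‖z‖ := by
  rcases eq_or_ne z 0 with h | h
  · exact ⟨0, by simp, by simp [h]⟩
  · have hz : (‖z‖ : ℂ) ≠ 0 := by exact_mod_cast (norm_pos_iff.2 h).ne'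
    refine ⟨(starRingEnd ℂ) z / ‖z‖, ?_, ?_⟩
    · rw [norm_div, RCLike.norm_conj, Complex.norm_real, norm_norm]
      exact div_self_le_one _
    · rw [div_mul_eq_mul_div, div_eq_iff hz, ← Complex.normSq_eq_conj_mul_self,
        Complex.normSq_eq_norm_sq]
      push_cast; ring

lemma chang_bound {ν : G → ℝ} {Λ : Finset (AddChar G ℂ)} (hD : Diss ν Λ) {T : Finset G}
    (hT : T.Nonempty) {C : ℝ} (hC : 0 < C) (hν : ∀ x, un T x ≤ C * ν x)
    (hΛ : ∀ γ ∈ Λ, 1 / 2 < ‖hat (un T) γ‖) : (Λ.card : ℝ) ≤ 16 * Real.log C := by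
  choose ω hω1 hω2 using fun γ : AddChar G ℂ => exists_phase (hat (un T) γ)
  have hp := un_pr hT
  set S : G → ℝ := fun x => ∑ γ ∈ Λ, (ω γ * γ x).re with hS
  set N : ℝ := (Λ.card : ℝ) with hN
  have h1 : N / 2 ≤ ∑ x, un T x * S x := by
    have e : ∑ x, un T x * S x = ∑ γ ∈ Λ, ‖hat (un T) γ‖ := by
      simp only [hS, Finset.mul_sum]
      rw [Finset.sum_comm]
      refine Finset.sum_congr rfl fun γ _ => ?_
      have := congrArg Complex.re (hω2 γ)
      rw [Complex.ofReal_re] at this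
      rw [← this, hat, Finset.mul_sum, Complex.re_sum]
      refine Finset.sum_congr rfl fun x _ => ?_
      rw [mul_left_comm, Complex.re_ofReal_mul]
    rw [e]
    have := Finset.card_nsmul_le_sum Λ (fun γ => ‖hat (un T) γ‖) (1 / 2)
      (fun γ hγ => (hΛ γ hγ).le)
    rw [nsmul_eq_mul] at this
    linarith
  have h2 : Real.exp (N / 4) ≤ ∑ x, un T x * Real.exp (1 / 2 * S x) := by
    have : ∀ x, un T x * (Real.exp (N / 4) * (1 + (1 / 2 * S x - N / 4))) ≤
        un T x * Real.exp (1 / 2 * S x) := by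
      intro x
      refine mul_le_mul_of_nonneg_left ?_ (hp.1 x)
      have e : Real.exp (1 / 2 * S x) = Real.exp (N / 4) * Real.exp (1 / 2 * S x - N / 4) := by
        rw [← Real.exp_add]; congr 1; ring
      rw [e]
      refine mul_le_mul_of_nonneg_left ?_ (Real.exp_pos _).le
      have := Real.add_one_le_exp (1 / 2 * S x - N / 4)
      linarith
    refine le_trans ?_ (Finset.sum_le_sum fun x _ => this x)
    have e : ∑ x, un T x * (Real.exp (N / 4) * (1 + (1 / 2 * S x - N / 4))) =
        Real.exp (N / 4) * ((1 - N / 4) * ∑ x, un T x + 1 / 2 * ∑ x, un T x * S x) := by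
      rw [Finset.mul_sum, Finset.mul_sum, ← Finset.sum_add_distrib, Finset.mul_sum]
      refine Finset.sum_congr rfl fun x _ => ?_
      ring
    rw [e, hp.2]
    have h0 := Real.exp_pos (N / 4)
    nlinarith
  set c := Real.cosh (1 / 2) with hc
  set s := Real.sinh (1 / 2) with hs
  have hcpos : 0 < c := Real.cosh_pos _
  have hs0 : 0 ≤ s := Real.sinh_nonneg_iff.2 (by norm_num)
  have hsc : s ≤ c := (Real.sinh_lt_cosh _).le
  have h3 : ∀ x, Real.exp (1 / 2 * S x) ≤ c ^ Λ.card * rz Λ (fun γ => (s / c : ℝ) * ω γ) x := by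
    intro x
    rw [hS, Finset.mul_sum, Real.exp_sum, rz, ← Finset.prod_const, ← Finset.prod_mul_distrib]
    refine Finset.prod_le_prod (fun _ _ => (Real.exp_pos _).le) fun γ _ => ?_
    have := Real.exp_mul_le_cosh_add_mul_sinh (re_bd (hω1 γ) γ x) (1 / 2)
    rw [mul_comm (1 / 2 : ℝ)]
    refine this.trans (le_of_eq ?_)
    rw [mul_assoc, Complex.re_ofReal_mul]
    rw [← hc, ← hs]
    field_simp
  have h4 : ∑ x, un T x * Real.exp (1 / 2 * S x) ≤ C * (c ^ Λ.card * Real.exp (N / 16)) := by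
    have hω : ∀ γ, ‖((s / c : ℝ) : ℂ) * ω γ‖ ≤ 1 := by
      intro γ
      rw [norm_mul, Complex.norm_real, Real.norm_of_nonneg (by positivity)]
      exact mul_le_one₀ ((div_le_one hcpos).2 hsc) (norm_nonneg _) (hω1 γ)
    have := hD _ hω
    refine le_trans ?_ (mul_le_mul_of_nonneg_left (mul_le_mul_of_nonneg_left this
      (by positivity : 0 ≤ c ^ Λ.card)) hC.le)
    rw [Finset.mul_sum, Finset.mul_sum]
    refine Finset.sum_le_sum fun x _ => ?_
    calc un T x * Real.exp (1 / 2 * S x) ≤ (C * ν x) * Real.exp (1 / 2 * S x) :=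
          mul_le_mul_of_nonneg_right (hν x) (Real.exp_pos _).le
      _ ≤ (C * ν x) * _ := mul_le_mul_of_nonneg_left (h3 x) ((hp.1 x).trans (hν x))
      _ = _ := by ring
  have h5 : c ^ Λ.card ≤ Real.exp (N / 8) := by
    have : c ≤ Real.exp (1 / 8) := by
      refine (Real.cosh_le_exp_half_sq _).trans (le_of_eq ?_); norm_num
    calc c ^ Λ.card ≤ Real.exp (1 / 8) ^ Λ.card := by gcongr
      _ = _ := by rw [← Real.exp_nat_mul]; congr 1; rw [hN]; ring
  have h6 : Real.exp (N / 4) ≤ C * (Real.exp (N / 8) * Real.exp (N / 16)) := by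
    refine (h2.trans h4).trans ?_
    gcongr
  have h7 : Real.exp (N / 16) ≤ C := by
    have e : Real.exp (N / 4) = Real.exp (N / 16) * (Real.exp (N / 8) * Real.exp (N / 16)) := by
      rw [← Real.exp_add, ← Real.exp_add]; congr 1; ring
    rw [e] at h6
    exact le_of_mul_le_mul_right h6 (by positivity)
  have := (Real.le_log_iff_exp_le hC).2 h7
  linarith

lemma rz_insert {Λ : Finset (AddChar G ℂ)} {γ : AddChar G ℂ} (h : γ ∉ Λ) (ω : AddChar G ℂ → ℂ)
    (x : G) : rz (insert γ Λ) ω x = (1 + (ω γ * γ x).re) * rz Λ ω x := by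
  rw [rz, Finset.prod_insert h]; rfl

lemma norm_mul_char (ψ γ : AddChar G ℂ) (x : G) : ‖ψ x - 1‖ ≤ ‖(ψ * γ) x - 1‖ + ‖γ x - 1‖ := by
  have e : ‖ψ x - 1‖ = ‖(ψ x - 1) * γ x‖ := by rw [norm_mul, nrm, mul_one]
  rw [e, AddChar.mul_apply]
  have : (ψ x - 1) * γ x = (ψ x * γ x - 1) - (γ x - 1) := by ring
  rw [this]; exact norm_sub_le _ _

lemma norm_inv_char (γ : AddChar G ℂ) (x : G) : ‖γ⁻¹ x - 1‖ = ‖γ x - 1‖ := by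
  rw [AddChar.inv_apply, norm_neg_sub_one]

lemma unfold_riesz {ν : G → ℝ} {η : ℝ} (ω : AddChar G ℂ → ℂ) (hω : ∀ γ, ‖ω γ‖ ≤ 1)
    (Λ : Finset (AddChar G ℂ)) :
    ∀ ψ : AddChar G ℂ, 2 ^ Λ.card * η < ‖∑ x, (ν x : ℂ) * ψ x * (rz Λ ω x : ℂ)‖ →
    ∃ ψ' : AddChar G ℂ, η < ‖hat ν ψ'‖ ∧
      ∀ x, ‖ψ x - 1‖ ≤ ‖ψ' x - 1‖ + ∑ γ ∈ Λ, ‖γ x - 1‖ := by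
  classical
  induction Λ using Finset.induction_on with
  | empty =>
    intro ψ h
    refine ⟨ψ, ?_, fun x => by simp⟩
    simpa [rz, hat] using h
  | insert γ Λ hγ ih =>
    intro ψ h
    have key : ∑ x, (ν x : ℂ) * ψ x * (rz (insert γ Λ) ω x : ℂ) =
        ∑ x, (ν x : ℂ) * ψ x * (rz Λ ω x : ℂ)
        + ω γ / 2 * ∑ x, (ν x : ℂ) * (ψ * γ) x * (rz Λ ω x : ℂ)
        + (starRingEnd ℂ) (ω γ) / 2 * ∑ x, (ν x : ℂ) * (ψ * γ⁻¹) x * (rz Λ ω x : ℂ) := by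
      rw [Finset.mul_sum, Finset.mul_sum, ← Finset.sum_add_distrib, ← Finset.sum_add_distrib]
      refine Finset.sum_congr rfl fun x _ => ?_
      rw [rz_insert hγ, AddChar.mul_apply, AddChar.mul_apply, AddChar.inv_apply, ← conj_char]
      have : (((ω γ * γ x).re : ℝ) : ℂ) =
          (ω γ * γ x + (starRingEnd ℂ) (ω γ) * (starRingEnd ℂ) (γ x)) / 2 := by
        rw [Complex.re_eq_add_conj, map_mul]
      push_cast
      rw [this]; ring
    by_contra! hcon
    have hstep : ∀ ψ₁ : AddChar G ℂ,
        (∀ x, ‖ψ x - 1‖ ≤ ‖ψ₁ x - 1‖ + ‖γ x - 1‖) →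
        ‖∑ x, (ν x : ℂ) * ψ₁ x * (rz Λ ω x : ℂ)‖ ≤ 2 ^ Λ.card * η := by
      intro ψ₁ h1
      by_contra! h2
      obtain ⟨ψ', h3, h4⟩ := ih ψ₁ h2
      obtain ⟨x, hx⟩ := hcon ψ' h3
      rw [Finset.sum_insert hγ] at hx
      have := h1 x
      have := h4 x
      linarith
    have a1 := hstep ψ (fun x => by have := norm_nonneg (γ x - 1); linarith)
    have a2 := hstep (ψ * γ) (fun x => norm_mul_char ψ γ x)
    have a3 := hstep (ψ * γ⁻¹) (fun x => by
      have := norm_mul_char ψ γ⁻¹ x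
      rwa [norm_inv_char] at this)
    rw [key, Finset.card_insert_of_notMem hγ, pow_succ] at h
    have b := norm_add₃_le (a := ∑ x, (ν x : ℂ) * ψ x * (rz Λ ω x : ℂ))
      (b := ω γ / 2 * ∑ x, (ν x : ℂ) * (ψ * γ) x * (rz Λ ω x : ℂ))
      (c := (starRingEnd ℂ) (ω γ) / 2 * ∑ x, (ν x : ℂ) * (ψ * γ⁻¹) x * (rz Λ ω x : ℂ))
    rw [norm_mul, norm_mul, norm_div, norm_div, RCLike.norm_conj, RCLike.norm_ofNat] at b
    have c1 := mul_le_mul (hω γ) a2 (norm_nonneg _) (by norm_num)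
    have c2 := mul_le_mul (hω γ) a3 (norm_nonneg _) (by norm_num)
    linarith

lemma hat_cv (w w' : G → ℝ) (γ : AddChar G ℂ) : hat (cv w w') γ = hat w γ * hat w' γ := by
  simp only [hat, cv, Complex.ofReal_sum, Complex.ofReal_mul, Finset.sum_mul, Finset.mul_sum]
  rw [Finset.sum_comm, Finset.sum_comm (f := fun i x => (w x : ℂ) * γ x * (w' i * γ i))]
  refine Finset.sum_congr rfl fun y _ => ?_
  rw [← Fintype.sum_equiv (Equiv.addRight y) (fun x => (w y : ℂ) * w' (x + y - y) * γ (x + y)) _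
    (fun _ => rfl)]
  refine Finset.sum_congr rfl fun x _ => ?_
  rw [add_sub_cancel_right, AddChar.map_add_eq_mul]; ring

lemma hat_norm_le {w : G → ℝ} (h : Pr w) (γ : AddChar G ℂ) : ‖hat w γ‖ ≤ 1 := by
  unfold hat
  refine (norm_sum_le _ _).trans ?_
  rw [← h.2]
  refine Finset.sum_le_sum fun y _ => ?_
  rw [norm_mul, nrm, mul_one, Complex.norm_real, Real.norm_of_nonneg (h.1 y)]

/-- Iterated convolution. -/
noncomputable def cvi (σ w : G → ℝ) (k : ℕ) : G → ℝ := (cv σ)^[k] w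

lemma cvi_succ (σ w : G → ℝ) (k : ℕ) : cvi σ w (k + 1) = cv σ (cvi σ w k) := by
  rw [cvi, Function.iterate_succ_apply']; rfl

lemma cvi_pr {σ w : G → ℝ} (hσ : Pr σ) (hw : Pr w) (k : ℕ) : Pr (cvi σ w k) := by
  induction k with
  | zero => exact hw
  | succ k ih => rw [cvi_succ]; exact cv_pr hσ ih

lemma cvi_hat {σ w : G → ℝ} (hw : Pr w) (k : ℕ) (γ : AddChar G ℂ) :
    ‖hat (cvi σ w k) γ‖ ≤ ‖hat σ γ‖ ^ k := by
  induction k with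
  | zero => simpa [cvi] using hat_norm_le hw γ
  | succ k ih =>
    rw [cvi_succ, hat_cv, norm_mul, pow_succ, mul_comm (‖hat σ γ‖ ^ k)]
    gcongr

lemma cvi_val {Γ : Finset (AddChar G ℂ)} {R s : ℝ} (hs : 0 ≤ s) (k : ℕ) :
    ∀ x ∈ bohr Γ (R - k * s), cvi (un (bohr Γ s)) (un (bohr Γ R)) k x =
      ((bohr Γ R).card : ℝ)⁻¹ := by
  induction k with
  | zero =>
    intro x hx
    have : x ∈ bohr Γ R := by simpa using hx
    simp [cvi, un, this]
  | succ k ih =>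
    intro x hx
    rw [cvi_succ, cv]
    have : ∀ y, un (bohr Γ s) y * cvi (un (bohr Γ s)) (un (bohr Γ R)) k (x - y) =
        un (bohr Γ s) y * ((bohr Γ R).card : ℝ)⁻¹ := by
      intro y
      rcases eq_or_ne (un (bohr Γ s) y) 0 with h | h
      · simp [h]
      · rw [ih]
        have := sub_mem_bohr hx (un_supp h)
        refine bohr_mono (le_of_eq ?_) this
        push_cast; ring
    simp only [this]
    rw [← Finset.sum_mul, (un_pr ⟨0, zero_mem_bohr hs⟩).2, one_mul]

lemma near_one {Γ : Finset (AddChar G ℂ)} {r w ε : ℝ} (hr : 0 ≤ r)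
    (hreg : ((bohr Γ (r + w)).card : ℝ) ≤ (1 + ε) * (bohr Γ r).card) {ψ : AddChar G ℂ}
    (hψ : 1 / 2 ≤ ‖hat (un (bohr Γ r)) ψ‖) {y : G} (hy : y ∈ bohr Γ w) : ‖ψ y - 1‖ ≤ 4 * ε := by
  set S := bohr Γ r with hS
  set S' := bohr Γ (r + w) with hS'
  have hc : (0 : ℝ) < S.card := bohr_card_pos hr
  -- difference
  have e : (ψ y - 1) * hat (un S) ψ = ∑ x, ((un S (x - y) - un S x : ℝ) : ℂ) * ψ x := by
    simp only [Complex.ofReal_sub, sub_mul, Finset.sum_sub_distrib, one_mul, hat]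
    congr 1
    rw [← Fintype.sum_equiv (Equiv.addRight y) (fun x => (un S (x + y - y) : ℂ) * ψ (x + y))
      (fun x => (un S (x - y) : ℂ) * ψ x) (fun _ => rfl), Finset.mul_sum]
    refine Finset.sum_congr rfl fun x _ => ?_
    rw [add_sub_cancel_right, AddChar.map_add_eq_mul]; ring
  have h1 : ‖ψ y - 1‖ * (1 / 2) ≤ ∑ x, |un S (x - y) - un S x| := by
    calc _ ≤ ‖ψ y - 1‖ * ‖hat (un S) ψ‖ := by gcongr
      _ = ‖∑ x, ((un S (x - y) - un S x : ℝ) : ℂ) * ψ x‖ := by rw [← norm_mul, e]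
      _ ≤ _ := by
        refine (norm_sum_le _ _).trans (le_of_eq ?_)
        refine Finset.sum_congr rfl fun x _ => ?_
        rw [norm_mul, nrm, mul_one, Complex.norm_real, Real.norm_eq_abs]
  -- card of symmetric difference
  have h2 : ∀ x, |un S (x - y) - un S x| ≤
      (if x ∈ S' then (S.card : ℝ)⁻¹ else 0) - un S x
      + ((if x ∈ S' then (S.card : ℝ)⁻¹ else 0) - un S (x - y)) := by
    intro x
    have hi : 0 < (S.card : ℝ)⁻¹ := by positivity
    by_cases a : x ∈ S
    · by_cases b : x - y ∈ S
      · have c : x ∈ S' := by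
          have := add_mem_bohr b hy
          simpa using this
        simp [un, a, b, c]
      · by_cases c : x ∈ S'
        · simp only [un, a, b, c, if_true, if_false]; simp [abs_of_pos hi]
        · exfalso
          -- then w < 0; but y ∈ bohr Γ w
          apply c
          rcases Finset.eq_empty_or_nonempty Γ with h | ⟨γ, hγ⟩
          · simp [hS', h, mem_bohr]
          · have : 0 ≤ w := (norm_nonneg _).trans (mem_bohr.1 hy γ hγ)
            exact bohr_mono (by linarith) a
    · by_cases b : x - y ∈ S
      · have c : x ∈ S' := by
          have := add_mem_bohr b hy
          simpa using this
        simp only [un, a, b, c, if_true, if_false]; simp [abs_of_pos hi]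
      · simp only [un, a, b, if_false]
        split_ifs <;> simp
  have h3 : ∑ x, ((if x ∈ S' then (S.card : ℝ)⁻¹ else 0) - un S x
      + ((if x ∈ S' then (S.card : ℝ)⁻¹ else 0) - un S (x - y))) ≤ 2 * ε := by
    rw [Finset.sum_add_distrib, Finset.sum_sub_distrib, Finset.sum_sub_distrib]
    have a := sum_shift (un S) (-y)
    simp only [← sub_eq_add_neg] at a
    rw [a, (un_pr ⟨0, zero_mem_bohr hr⟩).2, Finset.sum_ite_mem, Finset.univ_inter,
      Finset.sum_const, nsmul_eq_mul]
    have : (S'.card : ℝ) * (S.card : ℝ)⁻¹ ≤ 1 + ε := by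
      rw [← div_eq_mul_inv, div_le_iff₀ hc]; exact hreg
    linarith
  have h4 := Finset.sum_le_sum fun x (_ : x ∈ Finset.univ) => h2 x
  linarith

lemma local_chang (Γ : Finset (AddChar G ℂ)) {r₃ w₃ r₄ w₄ ε : ℝ} (n : ℕ) {T : Finset G}
    (hT : T.Nonempty) (hT3 : T ⊆ bohr Γ r₃) (h3 : 0 ≤ r₃) (hw3 : 0 ≤ w₃) (h4 : 0 ≤ r₄) (hε : 0 ≤ ε)
    (hn : (n + 5) * r₄ ≤ w₃)
    (hreg : ((bohr Γ (r₄ + w₄)).card : ℝ) ≤ (1 + ε) * (bohr Γ r₄).card)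
    (hsize : 16 * Real.log ((bohr Γ (r₃ + w₃)).card / T.card) ≤ n) :
    ∃ Λ : Finset (AddChar G ℂ), Λ.card ≤ n ∧ ∀ γ : AddChar G ℂ, 1 / 2 < ‖hat (un T) γ‖ →
      ∀ ρ : ℝ, 0 ≤ ρ → ∀ y ∈ bohr Γ w₄, y ∈ bohr Λ ρ → ‖γ y - 1‖ ≤ 4 * ε + (n + 1) * ρ := by
  classical
  set σ := un (bohr Γ r₄) with hσ
  have hσp : Pr σ := un_pr ⟨0, zero_mem_bohr h4⟩
  have hBp : Pr (un (bohr Γ (r₃ + w₃))) := un_pr ⟨0, zero_mem_bohr (by linarith)⟩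
  have hBc : (0 : ℝ) < (bohr Γ (r₃ + w₃)).card := bohr_card_pos (by linarith)
  have hTc : (0 : ℝ) < T.card := by exact_mod_cast hT.card_pos
  set ν := cvi σ (un (bohr Γ (r₃ + w₃))) (n + 5) with hν
  have hνp : Pr ν := cvi_pr hσp hBp _
  set C : ℝ := (bohr Γ (r₃ + w₃)).card / T.card with hC
  have hC0 : 0 < C := by positivity
  have hνT : ∀ x, un T x ≤ C * ν x := by
    intro x
    by_cases hx : x ∈ T
    · have : ν x = ((bohr Γ (r₃ + w₃)).card : ℝ)⁻¹ := by
        refine cvi_val h4 _ x (bohr_mono ?_ (hT3 hx))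
        push_cast; linarith
      rw [this, un, if_pos hx, hC]
      apply le_of_eq; field_simp
    · rw [un, if_neg hx]; exact mul_nonneg hC0.le (hνp.1 x)
  -- maximal dissociated set
  let F : Finset (Finset (AddChar G ℂ)) :=
    Finset.univ.filter fun Λ => Diss ν Λ ∧ ∀ γ ∈ Λ, 1 / 2 < ‖hat (un T) γ‖
  have hF : F.Nonempty := by
    refine ⟨∅, ?_⟩
    simp only [F, Finset.mem_filter, Finset.mem_univ, true_and]
    refine ⟨fun ω _ => ?_, by simp⟩
    simp [rz, hνp.2]
  obtain ⟨Λ, hΛF, hmax⟩ := Finset.exists_max_image F Finset.card hF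
  simp only [F, Finset.mem_filter, Finset.mem_univ, true_and] at hΛF hmax
  have hcard : Λ.card ≤ n := by
    have := (chang_bound hΛF.1 hT hC0 hνT hΛF.2).trans hsize
    exact_mod_cast this
  refine ⟨Λ, hcard, fun γ hγ ρ hρ y hy hyΛ => ?_⟩
  by_cases hin : γ ∈ Λ
  · have := mem_bohr.1 hyΛ γ hin
    have h0 : 0 ≤ (n : ℝ) * ρ := by positivity
    linarith
  have hnd : ¬ Diss ν (insert γ Λ) := by
    intro hd
    have := hmax (insert γ Λ) ⟨hd, fun γ' h' => by
      rcases Finset.mem_insert.1 h' with h | h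
      · rw [h]; exact hγ
      · exact hΛF.2 γ' h⟩
    rw [Finset.card_insert_of_notMem hin] at this
    omega
  simp only [Diss, not_forall, not_le] at hnd
  obtain ⟨ω, hω, hlt⟩ := hnd
  have hle := hΛF.1 ω hω
  have hbig : 1 / 16 ≤ ‖∑ x, (ν x : ℂ) * γ x * (rz Λ ω x : ℂ)‖ := by
    have e : ∑ x, ν x * rz (insert γ Λ) ω x =
        ∑ x, ν x * rz Λ ω x + (ω γ * ∑ x, (ν x : ℂ) * γ x * (rz Λ ω x : ℂ)).re := by
      rw [Finset.mul_sum, Complex.re_sum, ← Finset.sum_add_distrib]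
      refine Finset.sum_congr rfl fun x _ => ?_
      rw [rz_insert hin, show ω γ * ((ν x : ℂ) * γ x * (rz Λ ω x : ℂ)) =
        ((ν x * rz Λ ω x : ℝ) : ℂ) * (ω γ * γ x) by push_cast; ring, Complex.re_ofReal_mul]
      ring
    rw [e, Finset.card_insert_of_notMem hin] at hlt
    have h5 : (ω γ * ∑ x, (ν x : ℂ) * γ x * (rz Λ ω x : ℂ)).re ≤
        ‖∑ x, (ν x : ℂ) * γ x * (rz Λ ω x : ℂ)‖ := by
      refine (Complex.re_le_norm _).trans ?_
      rw [norm_mul]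
      exact mul_le_of_le_one_left (norm_nonneg _) (hω γ)
    have h6 : Real.exp ((Λ.card : ℝ) / 16) + 1 / 16 ≤ Real.exp (((Λ.card + 1 : ℕ) : ℝ) / 16) := by
      have e2 : Real.exp (((Λ.card + 1 : ℕ) : ℝ) / 16) =
          Real.exp ((Λ.card : ℝ) / 16) * Real.exp (1 / 16) := by
        rw [← Real.exp_add]; congr 1; push_cast; ring
      rw [e2]
      have a := Real.add_one_le_exp (1 / 16 : ℝ)
      have b : 1 ≤ Real.exp ((Λ.card : ℝ) / 16) := Real.one_le_exp (by positivity)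
      nlinarith
    linarith
  obtain ⟨ψ, hψ1, hψ2⟩ := unfold_riesz (ν := ν) (η := (1 / 2) ^ (n + 5)) ω hω Λ γ (by
    refine lt_of_lt_of_le ?_ hbig
    have : (2 : ℝ) ^ Λ.card ≤ 2 ^ n := by gcongr; norm_num
    calc (2 : ℝ) ^ Λ.card * (1 / 2) ^ (n + 5) ≤ 2 ^ n * (1 / 2) ^ (n + 5) := by gcongr
      _ = 1 / 32 := by
        rw [pow_add, ← mul_assoc, ← mul_pow]; norm_num
      _ < 1 / 16 := by norm_num)
  have hhalf : 1 / 2 ≤ ‖hat σ ψ‖ := by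
    have := hψ1.trans_le (cvi_hat hBp (n + 5) ψ)
    exact (lt_of_pow_lt_pow_left₀ _ (norm_nonneg _) this).le
  have h7 := near_one h4 hreg hhalf hy
  have h8 : ∑ γ ∈ Λ, ‖γ y - 1‖ ≤ n * ρ := by
    have := Finset.sum_le_card_nsmul Λ (fun γ => ‖γ y - 1‖) ρ (fun γ hγ => mem_bohr.1 hyΛ γ hγ)
    rw [nsmul_eq_mul] at this
    refine this.trans ?_
    gcongr
  have := hψ2 y
  linarith

end RB


set_option linter.unusedSectionVars false
set_option linter.unusedVariables false

namespace RB

variable {G : Type} [AddCommGroup G] [Fintype G] [DecidableEq G]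

lemma exp_quad {y : ℝ} (h : |y| ≤ 1) : Real.exp y ≤ 1 + y + y ^ 2 := by
  have := Real.abs_exp_sub_one_sub_id_le h
  have := (abs_le.1 this).2
  linarith

lemma mgf {ι : Type} (S : Finset ι) (hS : S.Nonempty) (X : ι → ℝ) (hX : ∀ i ∈ S, 0 ≤ X i ∧ X i ≤ 1)
    {p : ℝ} (hp : ∑ i ∈ S, X i = S.card * p) {t : ℝ} (ht : |t| ≤ 1) :
    ∑ i ∈ S, Real.exp (t * (X i - p)) ≤ S.card * Real.exp (t ^ 2 * p) := by
  have hc : (0 : ℝ) < S.card := by exact_mod_cast hS.card_pos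
  have hp0 : 0 ≤ p := by
    have : 0 ≤ (S.card : ℝ) * p := by rw [← hp]; exact Finset.sum_nonneg fun i hi => (hX i hi).1
    exact nonneg_of_mul_nonneg_right this hc
  have hp1 : p ≤ 1 := by
    have : (S.card : ℝ) * p ≤ S.card * 1 := by
      rw [← hp, ← nsmul_eq_mul]; exact Finset.sum_le_card_nsmul _ _ _ fun i hi => (hX i hi).2
    exact le_of_mul_le_mul_left this hc
  have h1 : ∀ i ∈ S, Real.exp (t * (X i - p)) ≤
      (1 + t ^ 2 * (p ^ 2) - t * p) + (t + t ^ 2 * (1 - 2 * p)) * X i := by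
    intro i hi
    obtain ⟨h0, h1⟩ := hX i hi
    have : |t * (X i - p)| ≤ 1 := by
      rw [abs_mul]
      exact mul_le_one₀ ht (abs_nonneg _) (abs_le.2 ⟨by linarith, by linarith⟩)
    refine (exp_quad this).trans ?_
    nlinarith [mul_nonneg (sq_nonneg t) (mul_nonneg h0 (sub_nonneg.2 h1))]
  refine (Finset.sum_le_sum h1).trans ?_
  rw [Finset.sum_add_distrib, ← Finset.mul_sum, hp, Finset.sum_const, nsmul_eq_mul]
  have h2 := Real.add_one_le_exp (t ^ 2 * p)
  have : (1 + t ^ 2 * p ^ 2 - t * p) + (t + t ^ 2 * (1 - 2 * p)) * p ≤ Real.exp (t ^ 2 * p) := by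
    nlinarith [mul_nonneg (sq_nonneg t) (sq_nonneg p)]
  nlinarith

lemma pow8_le (y : ℝ) : y ^ 8 ≤ 40320 * (Real.exp y + Real.exp (-y)) := by
  have h := Real.pow_div_factorial_le_exp |y| (abs_nonneg y) 8
  rw [Even.pow_abs (by decide)] at h
  have h2 : Real.exp |y| ≤ Real.exp y + Real.exp (-y) := by
    rcases abs_cases y with ⟨e, _⟩ | ⟨e, _⟩ <;> rw [e]
    · linarith [Real.exp_pos (-y)]
    · linarith [Real.exp_pos y]
  have h3 : ((Nat.factorial 8 : ℕ) : ℝ) = 40320 := by norm_num [Nat.factorial]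
  rw [h3, div_le_iff₀ (by norm_num)] at h
  linarith

lemma moment (S : Finset G) (hS : S.Nonempty) (X : G → ℝ)
    (hX : ∀ i ∈ S, 0 ≤ X i ∧ X i ≤ 1) {p : ℝ} (hp : ∑ i ∈ S, X i = S.card * p) (hp0 : 0 ≤ p)
    (k : ℕ) :
    ∑ c ∈ Fintype.piFinset (fun _ : Fin k => S), (∑ i, (X (c i) - p)) ^ 8 ≤
      (S.card : ℝ) ^ k * (240000 * (k * p + 1) ^ 4) := by
  have hD : 1 ≤ k * p + 1 := by have : 0 ≤ k * p := by positivity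
                                linarith
  set t : ℝ := (√(k * p + 1))⁻¹ with ht
  have ht2 : t ^ 2 * (k * p + 1) = 1 := by
    rw [ht, inv_pow, Real.sq_sqrt (by linarith), inv_mul_cancel₀ (by linarith)]
  have htp : 0 < t := by positivity
  have ht1 : |t| ≤ 1 := by
    rw [abs_of_pos htp]
    nlinarith
  have key : ∀ s : ℝ, |s| ≤ 1 → s ^ 2 * (k * p + 1) = 1 →
      ∑ c ∈ Fintype.piFinset (fun _ : Fin k => S), Real.exp (s * ∑ i, (X (c i) - p)) ≤
        (S.card : ℝ) ^ k * Real.exp 1 := by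
    intro s hs hs2
    have e : ∑ c ∈ Fintype.piFinset (fun _ : Fin k => S), Real.exp (s * ∑ i, (X (c i) - p)) =
        (∑ a ∈ S, Real.exp (s * (X a - p))) ^ k := by
      have := Finset.sum_prod_piFinset (ι := Fin k) S (fun _ a => Real.exp (s * (X a - p)))
      rw [Finset.prod_const, Finset.card_univ, Fintype.card_fin] at this
      rw [← this]
      refine Finset.sum_congr rfl fun c _ => ?_
      rw [Finset.mul_sum, Real.exp_sum]
    rw [e]
    calc _ ≤ (S.card * Real.exp (s ^ 2 * p)) ^ k :=
          pow_le_pow_left₀ (Finset.sum_nonneg fun _ _ => (Real.exp_pos _).le) (mgf S hS X hX hp hs) k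
      _ = (S.card : ℝ) ^ k * Real.exp (k * (s ^ 2 * p)) := by rw [mul_pow, ← Real.exp_nat_mul]
      _ ≤ _ := by
        gcongr
        nlinarith [sq_nonneg s]
  have k1 := key t ht1 ht2
  have k2 := key (-t) (by rwa [abs_neg]) (by rw [neg_sq]; exact ht2)
  have h8 : ∑ c ∈ Fintype.piFinset (fun _ : Fin k => S), (t * ∑ i, (X (c i) - p)) ^ 8 ≤
      40320 * (2 * ((S.card : ℝ) ^ k * Real.exp 1)) := by
    refine (Finset.sum_le_sum fun c _ => pow8_le _).trans ?_
    rw [← Finset.mul_sum, Finset.sum_add_distrib]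
    simp only [neg_mul] at k2
    linarith
  simp only [mul_pow] at h8
  rw [← Finset.mul_sum] at h8
  set A := ∑ c ∈ Fintype.piFinset (fun _ : Fin k => S), (∑ i, (X (c i) - p)) ^ 8 with hA
  have h9 : A = (t ^ 8 * A) * (k * p + 1) ^ 4 := by
    have : t ^ 8 * (k * p + 1) ^ 4 = 1 := by
      calc t ^ 8 * (k * p + 1) ^ 4 = (t ^ 2 * (k * p + 1)) ^ 4 := by ring
        _ = 1 := by rw [ht2, one_pow]
    calc A = (t ^ 8 * (k * p + 1) ^ 4) * A := by rw [this, one_mul]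
      _ = _ := by ring
  rw [h9]
  have he := Real.exp_one_lt_d9
  calc (t ^ 8 * A) * (k * p + 1) ^ 4 ≤
        (40320 * (2 * ((S.card : ℝ) ^ k * Real.exp 1))) * (k * p + 1) ^ 4 := by gcongr
    _ = (S.card : ℝ) ^ k * (80640 * Real.exp 1 * (k * p + 1) ^ 4) := by ring
    _ ≤ _ := by gcongr; linarith

/-- empirical average -/
noncomputable def emp {k : ℕ} (f : G → ℝ) (c : Fin k → G) (x : G) : ℝ :=
  (k : ℝ)⁻¹ * ∑ i, f (x + c i)

lemma emp_total (f : G → ℝ) (hf : ∀ x, 0 ≤ f x ∧ f x ≤ 1) (S U : Finset G) (hS : S.Nonempty)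
    (hU : ∀ x, x ∉ U → ∀ c ∈ S, f (x + c) = 0) (k : ℕ) (hk : 0 < k) {a : ℝ} (ha : 1 ≤ k * a) :
    ∑ c ∈ Fintype.piFinset (fun _ : Fin k => S), N8 (emp f c - sm (un S) f) ≤
      (S.card : ℝ) ^ k * (240000 * 2 ^ 7 / (k * a) ^ 4 * (N8 (sm (un S) f) + U.card * a ^ 8)) := by
  have hk' : (0 : ℝ) < k := by exact_mod_cast hk
  have hc : (0 : ℝ) < S.card := by exact_mod_cast hS.card_pos
  have ha0 : 0 < a := by
    by_contra! h
    nlinarith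
  set g := sm (un S) f with hg
  have hg0 : ∀ x, 0 ≤ g x := sm_nonneg (un_pr hS) (fun x => (hf x).1)
  have hgs : ∀ x, ∑ c ∈ S, f (x + c) = S.card * g x := by
    intro x; rw [hg, sm_un]; field_simp
  have h1 : ∀ x, ∑ c ∈ Fintype.piFinset (fun _ : Fin k => S), (emp f c x - g x) ^ 8 ≤
      (S.card : ℝ) ^ k * (240000 * 2 ^ 7 / (k * a) ^ 4 *
        (g x ^ 8 + if x ∈ U then a ^ 8 else 0)) := by
    intro x
    by_cases hx : x ∈ U
    · have hm := moment S hS (fun c => f (x + c)) (fun c _ => hf _) (hgs x) (hg0 x) k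
      have e : ∑ c ∈ Fintype.piFinset (fun _ : Fin k => S), (emp f c x - g x) ^ 8 =
          ((k : ℝ) ^ 8)⁻¹ * ∑ c ∈ Fintype.piFinset (fun _ : Fin k => S),
            (∑ i, (f (x + c i) - g x)) ^ 8 := by
        rw [Finset.mul_sum]
        refine Finset.sum_congr rfl fun c _ => ?_
        rw [← inv_pow, ← mul_pow, Finset.sum_sub_distrib, emp]
        congr 1
        simp only [Finset.sum_const, Finset.card_univ, Fintype.card_fin, nsmul_eq_mul]
        field_simp
      rw [e, if_pos hx]
      have h2 : (k * g x + 1) ^ 4 ≤ k ^ 8 / (k * a) ^ 4 * (2 ^ 7 * (g x ^ 8 + a ^ 8)) := by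
        have b1 : k * g x + 1 ≤ k * (g x + a) := by linarith
        have b2 : a ≤ g x + a := by linarith [hg0 x]
        have b3 := add_pow_le (hg0 x) ha0.le 8
        have hg0x := hg0 x
        have b4 : a ^ 4 * (g x + a) ^ 4 ≤ (g x + a) ^ 8 := by
          calc a ^ 4 * (g x + a) ^ 4 ≤ (g x + a) ^ 4 * (g x + a) ^ 4 := by gcongr
            _ = _ := by ring
        calc (k * g x + 1) ^ 4 ≤ (k * (g x + a)) ^ 4 := by gcongr
          _ = k ^ 8 / (k * a) ^ 4 * (a ^ 4 * (g x + a) ^ 4) := by field_simp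
          _ ≤ k ^ 8 / (k * a) ^ 4 * (2 ^ 7 * (g x ^ 8 + a ^ 8)) :=
            mul_le_mul_of_nonneg_left (b4.trans b3) (by positivity)
      calc ((k : ℝ) ^ 8)⁻¹ * _ ≤ ((k : ℝ) ^ 8)⁻¹ * ((S.card : ℝ) ^ k * (240000 *
            (k ^ 8 / (k * a) ^ 4 * (2 ^ 7 * (g x ^ 8 + a ^ 8))))) := by
            gcongr; exact hm.trans (by gcongr)
        _ = _ := by field_simp
    · have hz : g x = 0 := by
        have := hgs x
        rw [Finset.sum_eq_zero (hU x hx)] at this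
        rcases mul_eq_zero.1 this.symm with h | h
        · exact absurd h hc.ne'
        · exact h
      have e : ∑ c ∈ Fintype.piFinset (fun _ : Fin k => S), (emp f c x - g x) ^ 8 = 0 := by
        refine Finset.sum_eq_zero fun c hcS => ?_
        rw [hz, emp, Finset.sum_eq_zero (fun i _ => hU x hx _ (Fintype.mem_piFinset.1 hcS i))]
        simp
      rw [e, if_neg hx, hz]
      positivity
  simp only [N8, Pi.sub_apply]
  rw [Finset.sum_comm]
  refine (Finset.sum_le_sum fun x _ => h1 x).trans (le_of_eq ?_)
  rw [← Finset.mul_sum, ← Finset.mul_sum, Finset.sum_add_distrib, Finset.sum_ite_mem,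
    Finset.univ_inter, Finset.sum_const, nsmul_eq_mul]

lemma N8_sub_le {u v : G → ℝ} {E : ℝ} (hu : N8 u ≤ E) (hv : N8 v ≤ E) :
    N8 (u - v) ≤ 2 ^ 8 * E := by
  have h := N8_add_le u (-v)
  have e : N8 (-v) = N8 v := by
    unfold N8; refine Finset.sum_congr rfl fun x _ => ?_
    rw [Pi.neg_apply, Even.neg_pow (by decide)]
  rw [e, ← sub_eq_add_neg] at h
  linarith

lemma croot_sisask (f : G → ℝ) (S P Z : Finset G) (hS : S.Nonempty) (hZ : Z.Nonempty)
    (hP : ∀ c ∈ S, ∀ z ∈ Z, c + z ∈ P) (k : ℕ) {E : ℝ} (hE0 : 0 < E)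
    (hE : ∑ c ∈ Fintype.piFinset (fun _ : Fin k => S), N8 (emp f c - sm (un S) f) ≤
      (S.card : ℝ) ^ k * E) :
    ∃ T ⊆ Z, T.Nonempty ∧ (Z.card : ℝ) * S.card ^ k ≤ 2 * P.card ^ k * T.card ∧
      ∀ t ∈ T, ∀ t' ∈ T, N8 (fun x => sm (un S) f (x + (t - t')) - sm (un S) f x) ≤ 2 ^ 9 * E := by
  classical
  set g := sm (un S) f with hg
  set Ω := Fintype.piFinset (fun _ : Fin k => S) with hΩ
  have hΩc : (Ω.card : ℝ) = (S.card : ℝ) ^ k := by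
    rw [hΩ, Fintype.card_piFinset_const]; push_cast; rfl
  have hSc : (0 : ℝ) < S.card := by exact_mod_cast hS.card_pos
  set good := Ω.filter (fun c => N8 (emp f c - g) ≤ 2 * E) with hgood
  have hbad : ((Ω.filter (fun c => ¬ N8 (emp f c - g) ≤ 2 * E)).card : ℝ) * (2 * E) ≤
      (S.card : ℝ) ^ k * E := by
    refine le_trans ?_ hE
    rw [← nsmul_eq_mul]
    refine le_trans ?_ (Finset.sum_le_sum_of_subset_of_nonneg (Finset.filter_subset
      (fun c => ¬ N8 (emp f c - g) ≤ 2 * E) Ω) (fun c _ _ => N8_nonneg _))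
    refine Finset.card_nsmul_le_sum _ _ _ fun c hc => ?_
    exact (not_le.1 (Finset.mem_filter.1 hc).2).le
  have hgc : (S.card : ℝ) ^ k ≤ 2 * good.card := by
    have h1 : (good.card : ℝ) + (Ω.filter (fun c => ¬ N8 (emp f c - g) ≤ 2 * E)).card =
        (S.card : ℝ) ^ k := by
      rw [← hΩc]; exact_mod_cast Finset.card_filter_add_card_filter_not _
    have h2 : ((Ω.filter (fun c => ¬ N8 (emp f c - g) ≤ 2 * E)).card : ℝ) * 2 ≤
        (S.card : ℝ) ^ k := by
      refine le_of_mul_le_mul_right ?_ hE0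
      linarith
    linarith
  set Q := Fintype.piFinset (fun _ : Fin k => P) with hQ
  have hQc : (Q.card : ℝ) = (P.card : ℝ) ^ k := by
    rw [hQ, Fintype.card_piFinset_const]; push_cast; rfl
  -- T b
  let Tb : (Fin k → G) → Finset G := fun b => Z.filter (fun z => (fun i => b i - z) ∈ good)
  have hcount : (Z.card : ℝ) * good.card ≤ ∑ b ∈ Q, ((Tb b).card : ℝ) := by
    have : (Z ×ˢ good).card ≤ (Q.sigma Tb).card := by
      refine Finset.card_le_card_of_injOn (fun zc => ⟨fun i => zc.2 i + zc.1, zc.1⟩) ?_ ?_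
      · rintro ⟨z, c⟩ hzc
        simp only [Finset.coe_product, Set.mem_prod, Finset.mem_coe] at hzc
        obtain ⟨hz, hc⟩ := hzc
        have hcS := Fintype.mem_piFinset.1 (Finset.mem_filter.1 hc).1
        simp only [Finset.mem_coe, Finset.mem_sigma, Tb, Finset.mem_filter, add_sub_cancel_right]
        exact ⟨Fintype.mem_piFinset.2 fun i => hP _ (hcS i) _ hz, hz, hc⟩
      · rintro ⟨z, c⟩ _ ⟨z', c'⟩ _ h
        simp only [Sigma.mk.injEq, heq_eq_eq] at h
        obtain ⟨h1, h2⟩ := h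
        subst h2
        congr 1
        ext i
        exact add_right_cancel (congrFun h1 i)
    rw [Finset.card_product, Finset.card_sigma] at this
    exact_mod_cast this
  have hZc : (0 : ℝ) < Z.card := by exact_mod_cast hZ.card_pos
  have hQne : Q.Nonempty := by
    obtain ⟨c, hc⟩ := hS
    obtain ⟨z, hz⟩ := hZ
    exact ⟨fun _ => c + z, Fintype.mem_piFinset.2 fun _ => hP c hc z hz⟩
  obtain ⟨b, hbQ, hb⟩ := Finset.exists_max_image Q (fun b => (Tb b).card) hQne
  have hTb : (Z.card : ℝ) * S.card ^ k ≤ 2 * P.card ^ k * (Tb b).card := by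
    have h1 : ∑ b ∈ Q, ((Tb b).card : ℝ) ≤ Q.card * (Tb b).card := by
      rw [← nsmul_eq_mul]
      exact Finset.sum_le_card_nsmul _ _ _ fun b' hb' => by exact_mod_cast hb b' hb'
    rw [hQc] at h1
    nlinarith
  refine ⟨Tb b, Finset.filter_subset _ _, ?_, hTb, ?_⟩
  · rw [← Finset.card_pos]
    by_contra! h
    have h0 : (Tb b).card = 0 := by omega
    rw [h0] at hTb
    simp only [Nat.cast_zero, mul_zero] at hTb
    have : 0 < (Z.card : ℝ) * S.card ^ k := by positivity
    linarith
  · have hTt : ∀ t ∈ Tb b, N8 (emp f b - fun x => g (x + t)) ≤ 2 * E := by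
      intro t ht
      have h1 := (Finset.mem_filter.1 (Finset.mem_filter.1 ht).2).2
      rw [← N8_shift _ t] at h1
      convert h1 using 2
      ext x
      simp only [Pi.sub_apply, emp]
      congr 3
      ext i
      congr 1
      abel
    intro t ht t' ht'
    have := N8_sub_le (hTt t' ht') (hTt t ht)
    rw [← N8_shift _ (-t')] at this
    refine le_trans (le_of_eq ?_) (this.trans (by linarith))
    congr 1
    ext x
    simp only [Pi.sub_apply]
    rw [show x + -t' + t = x + (t - t') by abel, show x + -t' + t' = x by abel]
    ring

lemma N8_sm_sub {w : G → ℝ} (h : Pr w) {u : G → ℝ} {E : ℝ}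
    (hE : ∀ y, w y ≠ 0 → N8 (fun x => u (x + y) - u x) ≤ E) : N8 (sm w u - u) ≤ E := by
  have key : ∀ x, (sm w u - u) x ^ 8 ≤ ∑ y, w y * (u (x + y) - u x) ^ 8 := by
    intro x
    have e : (sm w u - u) x = ∑ y, w y * (u (x + y) - u x) := by
      simp only [mul_sub, Finset.sum_sub_distrib, ← Finset.sum_mul, h.2, one_mul]; rfl
    rw [e]
    exact Real.pow_arith_mean_le_arith_mean_pow_of_even Finset.univ w (fun y => u (x + y) - u x)
      (fun y _ => h.1 y) h.2 (by decide)
  refine (Finset.sum_le_sum fun x _ => key x).trans ?_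
  rw [Finset.sum_comm]
  calc _ ≤ ∑ y, w y * E := by
        refine Finset.sum_le_sum fun y _ => ?_
        rw [← Finset.mul_sum]
        rcases eq_or_ne (w y) 0 with h0 | h0
        · simp [h0]
        · exact mul_le_mul_of_nonneg_left (hE y h0) (h.1 y)
    _ = E := by rw [← Finset.sum_mul, h.2, one_mul]

lemma sum_pow8_le (m : ℕ) (a : ℕ → ℝ) :
    (∑ j ∈ Finset.range m, a j) ^ 8 ≤ (m : ℝ) ^ 7 * ∑ j ∈ Finset.range m, a j ^ 8 := by
  rcases Nat.eq_zero_or_pos m with h | h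
  · subst h; simp
  have hm : (0 : ℝ) < m := by exact_mod_cast h
  have := Real.pow_arith_mean_le_arith_mean_pow_of_even (Finset.range m) (fun _ => (m : ℝ)⁻¹) a
    (fun _ _ => by positivity) (by simp [hm.ne']) (n := 8) (by decide)
  rw [← Finset.mul_sum, ← Finset.mul_sum, mul_pow] at this
  have h2 := mul_le_mul_of_nonneg_left this (by positivity : (0 : ℝ) ≤ (m : ℝ) ^ 8)
  calc _ = (m : ℝ) ^ 8 * ((m : ℝ)⁻¹ ^ 8 * (∑ j ∈ Finset.range m, a j) ^ 8) := by field_simp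
    _ ≤ _ := h2
    _ = _ := by field_simp

lemma N8_iter {w : G → ℝ} (h : Pr w) {u : G → ℝ} {E : ℝ} (hE : N8 (sm w u - u) ≤ E) (m : ℕ) :
    N8 ((sm w)^[m] u - u) ≤ (m : ℝ) ^ 8 * E := by
  have h1 : ∀ j, N8 ((sm w)^[j] (sm w u - u)) ≤ E := by
    intro j
    induction j with
    | zero => exact hE
    | succ j ih => rw [Function.iterate_succ_apply']; exact (N8_sm h _).trans ih
  have h2 : ∀ j, (sm w)^[j] (sm w u - u) = (sm w)^[j + 1] u - (sm w)^[j] u := by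
    intro j
    induction j with
    | zero => rfl
    | succ j ih =>
      rw [Function.iterate_succ_apply', ih, sm_sub, ← Function.iterate_succ_apply' (sm w),
        ← Function.iterate_succ_apply' (sm w)]
  have h3 : ∀ x, ((sm w)^[m] u - u) x =
      ∑ j ∈ Finset.range m, ((sm w)^[j] (sm w u - u)) x := by
    intro x
    simp only [h2, Pi.sub_apply]
    rw [Finset.sum_range_sub (fun j => (sm w)^[j] u x)]
    rfl
  calc N8 ((sm w)^[m] u - u) ≤ ∑ x, (m : ℝ) ^ 7 *
        ∑ j ∈ Finset.range m, ((sm w)^[j] (sm w u - u)) x ^ 8 := by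
        refine Finset.sum_le_sum fun x _ => ?_
        rw [h3]; exact sum_pow8_le m _
    _ = (m : ℝ) ^ 7 * ∑ j ∈ Finset.range m, N8 ((sm w)^[j] (sm w u - u)) := by
        rw [← Finset.mul_sum, Finset.sum_comm]; rfl
    _ ≤ (m : ℝ) ^ 7 * ∑ j ∈ Finset.range m, E := by
        gcongr with j _; exact h1 j
    _ = _ := by rw [Finset.sum_const, Finset.card_range, nsmul_eq_mul]; ring

end RB


set_option linter.unusedSectionVars false
set_option linter.unusedVariables false

namespace RB

variable {G : Type} [AddCommGroup G] [Fintype G] [DecidableEq G]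

lemma mu_eq_conj_hat (w : G → ℝ) (γ : AddChar G ℂ) : mu w γ = (starRingEnd ℂ) (hat w γ) := by
  simp only [mu, hat, map_sum, map_mul, Complex.conj_ofReal, conj_char]

lemma mu_norm (w : G → ℝ) (γ : AddChar G ℂ) : ‖mu w γ‖ = ‖hat w γ‖ := by
  rw [mu_eq_conj_hat, RCLike.norm_conj]

lemma mu_cv (w w' : G → ℝ) (γ : AddChar G ℂ) : mu (cv w w') γ = mu w γ * mu w' γ := by
  rw [mu_eq_conj_hat, mu_eq_conj_hat, mu_eq_conj_hat, hat_cv, map_mul]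

lemma mu_cvi (σ w : G → ℝ) (k : ℕ) (γ : AddChar G ℂ) :
    mu (cvi σ w k) γ = mu σ γ ^ k * mu w γ := by
  induction k with
  | zero => simp [cvi]
  | succ k ih => rw [cvi_succ, mu_cv, ih]; ring

lemma sm_cvi (σ w u : G → ℝ) (k : ℕ) : sm (cvi σ w k) u = (sm σ)^[k] (sm w u) := by
  induction k with
  | zero => simp [cvi]
  | succ k ih => rw [cvi_succ, sm_cv, ih, ← Function.iterate_succ_apply' (sm σ)]

lemma neg_pr {w : G → ℝ} (h : Pr w) : Pr (fun x => w (-x)) :=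
  ⟨fun y => h.1 _, by rw [← h.2]; exact Equiv.sum_comp (Equiv.neg G) w⟩

lemma cvi_supp {Γ : Finset (AddChar G ℂ)} {σ w : G → ℝ} {s r : ℝ}
    (hσ : ∀ y, σ y ≠ 0 → y ∈ bohr Γ s) (hw : ∀ y, w y ≠ 0 → y ∈ bohr Γ r) (k : ℕ) :
    ∀ y, cvi σ w k y ≠ 0 → y ∈ bohr Γ (r + k * s) := by
  induction k with
  | zero => intro y hy; simpa using hw y hy
  | succ k ih =>
    intro y hy
    rw [cvi_succ] at hy
    obtain ⟨z, h1, h2⟩ := cv_supp hy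
    have := add_mem_bohr (hσ z h1) (ih _ h2)
    rw [add_sub_cancel] at this
    refine bohr_mono (le_of_eq ?_) this
    push_cast; ring

lemma smooth (Γ : Finset (AddChar G ℂ)) {r₂ w₂ r₃ w₃ r₄ w₄ ε a b : ℝ} (m n k : ℕ)
    (f : G → ℝ) (hf : ∀ x, 0 ≤ f x ∧ f x ≤ 1) (S U : Finset G) (hS : S.Nonempty) (hUn : U.Nonempty)
    (hS2 : S ⊆ bohr Γ r₂) (hU : ∀ x, x ∉ U → ∀ c ∈ S, f (x + c) = 0)
    (hk : 0 < k) (ha : 1 ≤ k * a) (hb : 0 < b) (hSb : b * (bohr Γ (r₂ + w₂)).card ≤ S.card)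
    (h3 : 0 ≤ r₃) (hw3 : 0 ≤ w₃) (h4 : 0 ≤ r₄) (hε : 0 ≤ ε) (h32 : r₃ ≤ w₂)
    (hm : m * (2 * r₃) ≤ w₂) (hn : (n + 5) * r₄ ≤ w₃)
    (hreg3 : ((bohr Γ (r₃ + w₃)).card : ℝ) ≤ 2 * (bohr Γ r₃).card)
    (hreg4 : ((bohr Γ (r₄ + w₄)).card : ℝ) ≤ (1 + ε) * (bohr Γ r₄).card)
    (hsize : 16 * Real.log (4 * (1 / b) ^ k) ≤ n) :
    ∃ (Λ : Finset (AddChar G ℂ)) (W : G → ℝ), Λ.card ≤ n ∧ Pr W ∧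
      (∀ y, W y ≠ 0 → y ∈ bohr Γ (r₂ + w₂)) ∧
      N8 (sm W f - sm (un S) f) ≤ (m : ℝ) ^ 8 * (2 ^ 9 * (240000 * 2 ^ 7 / (k * a) ^ 4 *
        (N8 (sm (un S) f) + U.card * a ^ 8))) ∧
      ∀ (κ ρ : ℝ), 0 ≤ ρ → 2 * (1 / 4) ^ m ≤ κ → 2 * (4 * ε + (n + 1) * ρ) ≤ κ →
        ∀ N : Finset G, N.Nonempty → (∀ y ∈ N, y ∈ bohr Γ w₄ ∧ y ∈ bohr Λ ρ) →
        ∑ x, (sm W f - sm (un N) (sm (un N) (sm W f))) x ^ 2 ≤ κ ^ 2 * ∑ x, f x ^ 2 := by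
  have hk' : (0 : ℝ) < k := by exact_mod_cast hk
  have ha0 : 0 < a := by
    by_contra! h
    nlinarith
  have hUc : (0 : ℝ) < U.card := by exact_mod_cast hUn.card_pos
  have hSc : (0 : ℝ) < S.card := by exact_mod_cast hS.card_pos
  set E : ℝ := 240000 * 2 ^ 7 / (k * a) ^ 4 * (N8 (sm (un S) f) + U.card * a ^ 8) with hE
  have hE0 : 0 < E := by
    have := N8_nonneg (sm (un S) f)
    positivity
  obtain ⟨T, hTZ, hTn, hTc, hTt⟩ := croot_sisask f S (bohr Γ (r₂ + w₂)) (bohr Γ r₃) hS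
    ⟨0, zero_mem_bohr h3⟩ (fun c hc z hz => bohr_mono (by linarith) (add_mem_bohr (hS2 hc) hz))
    k hE0 (emp_total f hf S U hS hU k hk ha)
  have hTpos : (0 : ℝ) < T.card := by exact_mod_cast hTn.card_pos
  have hsz : ((bohr Γ (r₃ + w₃)).card : ℝ) / T.card ≤ 4 * (1 / b) ^ k := by
    rw [div_le_iff₀ hTpos]
    have h1 : ((bohr Γ (r₂ + w₂)).card : ℝ) ^ k ≤ (1 / b) ^ k * S.card ^ k := by
      rw [← mul_pow]
      refine pow_le_pow_left₀ (by positivity) ?_ k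
      rw [one_div, ← div_eq_inv_mul, le_div_iff₀ hb, mul_comm]; exact hSb
    have h2 : ((bohr Γ r₃).card : ℝ) * S.card ^ k ≤ (2 * (1 / b) ^ k * T.card) * S.card ^ k := by
      refine hTc.trans ?_
      calc 2 * ((bohr Γ (r₂ + w₂)).card : ℝ) ^ k * T.card ≤
          2 * ((1 / b) ^ k * S.card ^ k) * T.card := by gcongr
        _ = _ := by ring
    have h3 := le_of_mul_le_mul_right h2 (by positivity)
    linarith
  have hB3 : (0 : ℝ) < (bohr Γ (r₃ + w₃)).card := bohr_card_pos (by linarith)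
  obtain ⟨Λ, hΛ, hch⟩ := local_chang Γ n hTn hTZ h3 hw3 h4 hε hn hreg4 (by
    refine le_trans ?_ hsize
    have := Real.log_le_log (by positivity) hsz
    linarith)
  set w : G → ℝ := cv (un T) (fun x => un T (-x)) with hw
  have hwp : Pr w := cv_pr (un_pr hTn) (neg_pr (un_pr hTn))
  have hws : ∀ y, w y ≠ 0 → ∃ t ∈ T, ∃ t' ∈ T, y = t - t' := by
    intro y hy
    obtain ⟨z, h1, h2⟩ := cv_supp hy
    exact ⟨z, un_supp h1, _, un_supp h2, by abel⟩
  set W := cvi w (un S) m with hW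
  have hWp : Pr W := cvi_pr hwp (un_pr hS) m
  have hWf : sm W f = (sm w)^[m] (sm (un S) f) := sm_cvi _ _ _ _
  refine ⟨Λ, W, hΛ, hWp, ?_, ?_, ?_⟩
  · intro y hy
    have := cvi_supp (Γ := Γ) (s := 2 * r₃) (r := r₂) (fun y hy => by
      obtain ⟨t, ht, t', ht', e⟩ := hws y hy
      rw [e]
      exact bohr_mono (by linarith) (sub_mem_bohr (hTZ ht) (hTZ ht')))
      (fun y hy => hS2 (un_supp hy)) m y hy
    exact bohr_mono (by linarith) this
  · rw [hWf]
    refine N8_iter hwp (N8_sm_sub hwp fun y hy => ?_) m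
    obtain ⟨t, ht, t', ht', e⟩ := hws y hy
    rw [e]
    exact hTt t ht t' ht'
  · intro κ ρ hρ hκ1 hκ2 N hN hNB
    have hmuw : ∀ γ, ‖mu w γ‖ = ‖hat (un T) γ‖ ^ 2 := by
      intro γ
      rw [hw, mu_cv, mu_un_neg, norm_mul, RCLike.norm_conj, mu_norm]; ring
    refine l2_bound (m := fun γ => mu W γ * (1 - mu (un N) γ * mu (un N) γ)) ?_ ?_
    · intro γ
      rw [hat_sub, hat_sm (un N), hat_sm (un N), hat_sm W]; ring
    · intro γ
      rw [norm_mul]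
      have h1 := mu_norm_le hWp γ
      have hN1 := mu_norm_le (un_pr hN) γ
      have h2 : ‖1 - mu (un N) γ * mu (un N) γ‖ ≤ 2 * ‖1 - mu (un N) γ‖ := by
        have e : 1 - mu (un N) γ * mu (un N) γ = (1 + mu (un N) γ) * (1 - mu (un N) γ) := by ring
        rw [e, norm_mul]
        refine mul_le_mul_of_nonneg_right ?_ (norm_nonneg _)
        refine (norm_add_le _ _).trans ?_
        rw [norm_one]; linarith
      have h2' : ‖1 - mu (un N) γ * mu (un N) γ‖ ≤ 2 := by
        refine (norm_sub_le _ _).trans ?_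
        rw [norm_one, norm_mul]
        have := mul_le_one₀ hN1 (norm_nonneg _) hN1
        linarith
      by_cases hγ : 1 / 2 < ‖hat (un T) γ‖
      · have h3 : ‖1 - mu (un N) γ‖ ≤ 4 * ε + (n + 1) * ρ :=
          mu_near (un_pr hN) γ fun y hy =>
            hch γ hγ ρ hρ y (hNB y (un_supp hy)).1 (hNB y (un_supp hy)).2
        have h4 := norm_nonneg (mu W γ)
        have h5 := norm_nonneg (1 - mu (un N) γ * mu (un N) γ)
        nlinarith
      · push Not at hγ
        have h3 : ‖mu W γ‖ ≤ (1 / 4) ^ m := by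
          rw [hW, mu_cvi, norm_mul, norm_pow, hmuw]
          have a1 : ‖hat (un T) γ‖ ^ 2 ≤ 1 / 4 := by
            have := pow_le_pow_left₀ (norm_nonneg _) hγ 2
            linarith
          calc _ ≤ (1 / 4 : ℝ) ^ m * 1 := by
                refine mul_le_mul (pow_le_pow_left₀ (by positivity) a1 m)
                  (mu_norm_le (un_pr hS) γ) (norm_nonneg _) (by positivity)
            _ = _ := mul_one _
        calc _ ≤ (1 / 4 : ℝ) ^ m * 2 := mul_le_mul h3 h2' (norm_nonneg _) (by positivity)
          _ ≤ κ := by linarith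

lemma young7 {x y : ℝ} (hx : 0 ≤ x) : x ^ 7 * |y| ≤ x ^ 8 / 16 + 16 ^ 7 * y ^ 8 := by
  have e : y ^ 8 = |y| ^ 8 := (Even.pow_abs (by decide) y).symm
  rw [e]
  have hy := abs_nonneg y
  set z := |y|
  rcases le_total z (x / 16) with h | h
  · have : x ^ 7 * z ≤ x ^ 7 * (x / 16) := by gcongr
    have h2 : 0 ≤ 16 ^ 7 * z ^ 8 := by positivity
    nlinarith
  · have h1 : x ≤ 16 * z := by linarith
    have : x ^ 7 * z ≤ (16 * z) ^ 7 * z := by gcongr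
    have h2 : 0 ≤ x ^ 8 / 16 := by positivity
    nlinarith

lemma young1 {a y : ℝ} (ha : 0 < a) : |y| ≤ a / 20 + (20 / a) ^ 7 * y ^ 8 := by
  have e : y ^ 8 = |y| ^ 8 := (Even.pow_abs (by decide) y).symm
  rw [e]
  have hy := abs_nonneg y
  set z := |y|
  rcases le_total z (a / 20) with h | h
  · have h2 : 0 ≤ (20 / a) ^ 7 * z ^ 8 := by positivity
    linarith
  · have h1 : 1 ≤ 20 / a * z := by
      rw [div_mul_eq_mul_div, le_div_iff₀ ha]; linarith
    have h3 : 1 ≤ (20 / a * z) ^ 7 := one_le_pow₀ h1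
    have : z * 1 ≤ z * (20 / a * z) ^ 7 := by gcongr
    have h4 : z * (20 / a * z) ^ 7 = (20 / a) ^ 7 * z ^ 8 := by ring
    have h5 : 0 < a / 20 := by positivity
    linarith

lemma g7 {g M : ℝ} (hg : 0 ≤ g) (hM : 0 ≤ M) : M * g ^ 7 ≤ g ^ 8 / 4 + M * (4 * M) ^ 7 := by
  rcases le_total (4 * M) g with h | h
  · have : (4 * M) * g ^ 7 ≤ g * g ^ 7 := by gcongr
    have h2 : 0 ≤ M * (4 * M) ^ 7 := by positivity
    nlinarith
  · have : M * g ^ 7 ≤ M * (4 * M) ^ 7 := by gcongr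
    have h2 : 0 ≤ g ^ 8 / 4 := by positivity
    linarith

set_option maxHeartbeats 2000000 in
lemma analytic {f₁ f₂ W β s : G → ℝ} {D' : Finset G} {a κ δ Dc : ℝ}
    (hf1 : ∀ x, 0 ≤ f₁ x ∧ f₁ x ≤ 1) (hf2 : ∀ x, 0 ≤ f₂ x ∧ f₂ x ≤ 1)
    (hW : Pr W) (hβ : Pr β) (hs : Pr s) (hβs : ∀ y, β (-y) = β y)
    (ha : 0 < a) (ha1 : a ≤ 1) (hDc : 0 < Dc) (hD' : (D'.card : ℝ) ≤ 1.01 * Dc)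
    (hDD : Dc ≤ D'.card)
    (h1s : ∀ x, x ∉ D' → ∀ y, s y ≠ 0 → f₁ (x + y) = 0)
    (h1W : ∀ x, x ∉ D' → ∀ y, W y ≠ 0 → ∀ z, β z ≠ 0 → f₁ (x + y + z) = 0)
    (h2W : ∀ x, x ∉ D' → ∀ z, β z ≠ 0 → f₂ (x + z) = 0)
    (hlow1 : 0.95 * a * Dc ≤ ∑ x, f₁ x) (hlow2 : 0.95 * a * Dc ≤ ∑ x, f₂ x)
    (hup1 : ∑ x, f₁ x ≤ Dc) (hup2 : ∑ x, f₂ x ≤ Dc)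
    (hM1 : ∀ x, sm β f₁ x ≤ 1.01 * a) (hM2 : ∀ x, sm β f₂ x ≤ 1.01 * a)
    (hκ : 0 < κ) (hκa : κ ≤ a ^ 8 / 20)
    (hδ0 : 0 ≤ δ) (hδ : δ ≤ a / 10 ^ 16)
    (hN8 : N8 (sm W f₁ - sm s f₁) ≤ δ * (N8 (sm s f₁) + D'.card * a ^ 8))
    (hL2 : ∑ x, (sm W f₁ - sm β (sm β (sm W f₁))) x ^ 2 ≤ κ ^ 2 * ∑ x, f₁ x ^ 2) :
    a ^ 2 * Dc / 2 ≤ ∑ x, f₂ x * sm s f₁ x := by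
  set g := sm s f₁ with hg
  set h := sm W f₁ with hh
  set v := sm β (sm β h) with hv
  set M : ℝ := 1.01 * a with hM
  have hM0 : 0 < M := by positivity
  have hg0 : ∀ x, 0 ≤ g x := sm_nonneg hs fun x => (hf1 x).1
  have hg1 : ∀ x, g x ≤ 1 := sm_le hs fun x => (hf1 x).2
  have hv' : v = sm W (sm β (sm β f₁)) := by
    rw [hv, hh, sm_comm β W, sm_comm β W]
  have hvM : ∀ x, v x ≤ M := by
    rw [hv']; exact sm_le hW (sm_le hβ hM1)
  have hD'c : (0 : ℝ) < D'.card := by linarith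
  have hL2' : ∑ x, (h x - v x) ^ 2 ≤ κ ^ 2 * Dc := by
    refine hL2.trans ?_
    gcongr
    refine le_trans (Finset.sum_le_sum fun x _ => ?_) hup1
    nlinarith [hf1 x]
  have hgU : ∀ x, x ∉ D' → g x = 0 := by
    intro x hx
    refine Finset.sum_eq_zero fun y _ => ?_
    rcases eq_or_ne (s y) 0 with h0 | h0
    · simp [h0]
    · rw [h1s x hx y h0, mul_zero]
  set Q := N8 g with hQ
  have hQ0 : 0 ≤ Q := N8_nonneg g
  have e8 : N8 (h - g) = ∑ x, (g x - h x) ^ 8 := by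
    unfold N8; refine Finset.sum_congr rfl fun x _ => ?_
    rw [Pi.sub_apply, ← Even.neg_pow (by decide : Even 8), neg_sub]
  rw [e8] at hN8
  -- Step A
  have hA : Q ≤ Q / 16 + 16 ^ 7 * ∑ x, (g x - h x) ^ 8 + κ * Dc
      + (Q / 4 + D'.card * (M * (4 * M) ^ 7)) := by
    have hpt : ∀ x, g x ^ 8 ≤ (g x ^ 8 / 16 + 16 ^ 7 * (g x - h x) ^ 8)
        + (κ / 2 * g x + 1 / (2 * κ) * (h x - v x) ^ 2)
        + (g x ^ 8 / 4 + if x ∈ D' then M * (4 * M) ^ 7 else 0) := by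
      intro x
      have a1 := young7 (y := g x - h x) (hg0 x)
      have a2 : g x ^ 7 * (h x - v x) ≤ κ / 2 * g x + 1 / (2 * κ) * (h x - v x) ^ 2 := by
        have b1 : (g x ^ 7) ^ 2 ≤ g x := by
          rw [← pow_mul]
          exact pow_le_of_le_one (hg0 x) (hg1 x) (by norm_num)
        have b2 : g x ^ 7 * (h x - v x) ≤
            κ / 2 * (g x ^ 7) ^ 2 + 1 / (2 * κ) * (h x - v x) ^ 2 := by
          have : 0 ≤ 1 / (2 * κ) * (κ * g x ^ 7 - (h x - v x)) ^ 2 := by positivity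
          have e : 1 / (2 * κ) * (κ * g x ^ 7 - (h x - v x)) ^ 2 =
            κ / 2 * (g x ^ 7) ^ 2 - g x ^ 7 * (h x - v x) + 1 / (2 * κ) * (h x - v x) ^ 2 := by
            field_simp; ring
          linarith
        have : κ / 2 * (g x ^ 7) ^ 2 ≤ κ / 2 * g x := by gcongr
        linarith
      have a3 : g x ^ 7 * v x ≤ g x ^ 8 / 4 + if x ∈ D' then M * (4 * M) ^ 7 else 0 := by
        split_ifs with hx
        · have := g7 (hg0 x) hM0.le
          have h3 : g x ^ 7 * v x ≤ g x ^ 7 * M :=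
            mul_le_mul_of_nonneg_left (hvM x) (pow_nonneg (hg0 x) 7)
          linarith
        · rw [hgU x hx]; simp
      have a4 : g x ^ 7 * (g x - h x) ≤ g x ^ 7 * |g x - h x| :=
        mul_le_mul_of_nonneg_left (le_abs_self _) (pow_nonneg (hg0 x) 7)
      have e : g x ^ 8 = g x ^ 7 * (g x - h x) + g x ^ 7 * (h x - v x) + g x ^ 7 * v x := by ring
      linarith
    have := Finset.sum_le_sum fun x (_ : x ∈ Finset.univ) => hpt x
    simp only [Finset.sum_add_distrib, ← Finset.mul_sum, ← Finset.sum_div, Finset.sum_ite_mem,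
      Finset.univ_inter, Finset.sum_const, nsmul_eq_mul] at this
    have hgs : ∑ x, g x ≤ Dc := by rw [hg, sum_sm hs]; exact hup1
    have c1 : κ / 2 * ∑ x, g x ≤ κ / 2 * Dc := by gcongr
    have c2 : 1 / (2 * κ) * ∑ x, (h x - v x) ^ 2 ≤ κ / 2 * Dc := by
      calc _ ≤ 1 / (2 * κ) * (κ ^ 2 * Dc) := by gcongr
        _ = _ := by field_simp
    change Q ≤ Q / 16 + 16 ^ 7 * ∑ x, (g x - h x) ^ 8 + _ + (Q / 4 + _) at this
    linarith
  have ha8 : 0 < a ^ 8 := by positivity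
  have hδ1 : δ ≤ 1 / 10 ^ 16 := hδ.trans (by gcongr)
  have hMM : M * (4 * M) ^ 7 ≤ 18000 * a ^ 8 := by
    have : M * (4 * M) ^ 7 = (4 ^ 7 * 1.01 ^ 8) * a ^ 8 := by rw [hM]; ring
    rw [this]; gcongr; norm_num
  set V := (D'.card : ℝ) * a ^ 8 with hV
  have hV0 : 0 < V := by positivity
  have hQV : Q ≤ 30000 * V := by
    have b1 : (16 : ℝ) ^ 7 * (δ * (Q + V)) ≤ 1 / 16 * (Q + V) := by
      rw [← mul_assoc]; gcongr
      calc (16 : ℝ) ^ 7 * δ ≤ 16 ^ 7 * (1 / 10 ^ 16) := by gcongr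
        _ ≤ _ := by norm_num
    have b2 : κ * Dc ≤ V := by
      calc κ * Dc ≤ (a ^ 8 / 20) * D'.card := by gcongr
        _ ≤ V := by rw [hV]; nlinarith
    have b3 : (D'.card : ℝ) * (M * (4 * M) ^ 7) ≤ 18000 * V := by
      calc _ ≤ (D'.card : ℝ) * (18000 * a ^ 8) := by gcongr
        _ = _ := by rw [hV]; ring
    have b4 : (16 : ℝ) ^ 7 * ∑ x, (g x - h x) ^ 8 ≤ 16 ^ 7 * (δ * (Q + V)) := by gcongr
    linarith
  have hN8' : ∑ x, (g x - h x) ^ 8 ≤ (a / 10 ^ 16) * (30001 * V) := by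
    refine hN8.trans ?_
    gcongr
    linarith
  -- Step B lower bound
  have hF1 : ∀ x, 0 ≤ sm β f₁ x := sm_nonneg hβ fun x => (hf1 x).1
  have hF2 : ∀ x, 0 ≤ sm β f₂ x := sm_nonneg hβ fun x => (hf2 x).1
  have hlow : 0.88 * a ^ 2 * Dc ≤ ∑ x, f₂ x * v x := by
    have e1 : ∑ x, f₂ x * v x = ∑ y, W y * ∑ x, sm β f₂ x * sm β f₁ (x + y) := by
      have : v = sm β (sm W (sm β f₁)) := by rw [hv', sm_comm β W]
      rw [this, ← sm_adj hβs]
      simp only [sm.eq_1 W, Finset.mul_sum]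
      rw [Finset.sum_comm]
      refine Finset.sum_congr rfl fun y _ => Finset.sum_congr rfl fun x _ => ?_
      ring
    have e2 : ∀ y, W y * (0.88 * a ^ 2 * Dc) ≤ W y * ∑ x, sm β f₂ x * sm β f₁ (x + y) := by
      intro y
      rcases eq_or_ne (W y) 0 with h0 | h0
      · simp [h0]
      refine mul_le_mul_of_nonneg_left ?_ (hW.1 y)
      have z2 : ∀ x, x ∉ D' → sm β f₂ x = 0 := by
        intro x hx
        refine Finset.sum_eq_zero fun z _ => ?_
        rcases eq_or_ne (β z) 0 with h1 | h1
        · simp [h1]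
        · rw [h2W x hx z h1, mul_zero]
      have z1 : ∀ x, x ∉ D' → sm β f₁ (x + y) = 0 := by
        intro x hx
        refine Finset.sum_eq_zero fun z _ => ?_
        rcases eq_or_ne (β z) 0 with h1 | h1
        · simp [h1]
        · rw [h1W x hx y h0 z h1, mul_zero]
      have pt : ∀ x, M * sm β f₁ (x + y) + M * sm β f₂ x - (if x ∈ D' then M ^ 2 else 0) ≤
          sm β f₂ x * sm β f₁ (x + y) := by
        intro x
        split_ifs with hx
        · nlinarith [hM1 (x + y), hM2 x]
        · rw [z1 x hx, z2 x hx]; simp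
      have := Finset.sum_le_sum fun x (_ : x ∈ Finset.univ) => pt x
      rw [Finset.sum_sub_distrib, Finset.sum_add_distrib, ← Finset.mul_sum, ← Finset.mul_sum,
        sum_shift (sm β f₁) y, sum_sm hβ, sum_sm hβ, Finset.sum_ite_mem,
        Finset.univ_inter, Finset.sum_const, nsmul_eq_mul] at this
      refine le_trans ?_ this
      have c1 : M * (0.95 * a * Dc) ≤ M * ∑ x, f₁ x := by gcongr
      have c2 : M * (0.95 * a * Dc) ≤ M * ∑ x, f₂ x := by gcongr
      have c3 : (D'.card : ℝ) * M ^ 2 ≤ 1.01 * Dc * M ^ 2 := by gcongr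
      have c4 : 0 < a ^ 2 * Dc := by positivity
      rw [hM] at *
      nlinarith
    rw [e1]
    refine le_trans ?_ (Finset.sum_le_sum fun y _ => e2 y)
    rw [← Finset.sum_mul, hW.2, one_mul]
  have hup2' : ∑ x, f₂ x ≤ 1.03 * a * Dc := by
    have z2 : ∀ x, x ∉ D' → sm β f₂ x = 0 := by
      intro x hx
      refine Finset.sum_eq_zero fun z _ => ?_
      rcases eq_or_ne (β z) 0 with h1 | h1
      · simp [h1]
      · rw [h2W x hx z h1, mul_zero]
    rw [← sum_sm hβ]
    have pt : ∀ x, sm β f₂ x ≤ if x ∈ D' then M else 0 := by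
      intro x
      split_ifs with hx
      · exact hM2 x
      · exact (z2 x hx).le
    refine (Finset.sum_le_sum fun x _ => pt x).trans ?_
    rw [Finset.sum_ite_mem, Finset.univ_inter, Finset.sum_const, nsmul_eq_mul]
    have c3 : (D'.card : ℝ) * M ≤ 1.01 * Dc * M := by gcongr
    have c4 : 0 < a * Dc := by positivity
    rw [hM] at *
    nlinarith
  have hB : ∑ x, f₂ x * v x ≤ ∑ x, f₂ x * g x + (a / 20 * ∑ x, f₂ x
      + (20 / a) ^ 7 * ∑ x, (g x - h x) ^ 8) + κ * Dc := by
    have hpt : ∀ x, f₂ x * v x ≤ f₂ x * g x + (a / 20 * f₂ x + (20 / a) ^ 7 * (g x - h x) ^ 8)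
        + (κ / 2 * f₂ x + 1 / (2 * κ) * (h x - v x) ^ 2) := by
      intro x
      obtain ⟨p0, p1⟩ := hf2 x
      have a1 : f₂ x * |g x - h x| ≤ a / 20 * f₂ x + (20 / a) ^ 7 * (g x - h x) ^ 8 := by
        have := mul_le_mul_of_nonneg_left (young1 (y := g x - h x) ha) p0
        have h2 : f₂ x * ((20 / a) ^ 7 * (g x - h x) ^ 8) ≤ 1 * ((20 / a) ^ 7 * (g x - h x) ^ 8) := by
          have : 0 ≤ (g x - h x) ^ 8 := by positivity
          gcongr
        linarith
      have a2 : f₂ x * (v x - h x) ≤ κ / 2 * f₂ x + 1 / (2 * κ) * (h x - v x) ^ 2 := by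
        have : 0 ≤ 1 / (2 * κ) * (κ * f₂ x - (v x - h x)) ^ 2 := by positivity
        have e : 1 / (2 * κ) * (κ * f₂ x - (v x - h x)) ^ 2 =
          κ / 2 * (f₂ x) ^ 2 - f₂ x * (v x - h x) + 1 / (2 * κ) * (h x - v x) ^ 2 := by
          field_simp; ring
        have b1 : f₂ x ^ 2 ≤ f₂ x := by nlinarith
        have : κ / 2 * f₂ x ^ 2 ≤ κ / 2 * f₂ x := by gcongr
        linarith
      have a4 : f₂ x * (h x - g x) ≤ f₂ x * |g x - h x| :=
        mul_le_mul_of_nonneg_left (by rw [abs_sub_comm]; exact le_abs_self _) p0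
      have e : f₂ x * v x = f₂ x * g x + f₂ x * (h x - g x) + f₂ x * (v x - h x) := by ring
      linarith
    have := Finset.sum_le_sum fun x (_ : x ∈ Finset.univ) => hpt x
    simp only [Finset.sum_add_distrib, ← Finset.mul_sum] at this
    have c1 : κ / 2 * ∑ x, f₂ x ≤ κ / 2 * Dc := by gcongr
    have c2 : 1 / (2 * κ) * ∑ x, (h x - v x) ^ 2 ≤ κ / 2 * Dc := by
      calc _ ≤ 1 / (2 * κ) * (κ ^ 2 * Dc) := by gcongr
        _ = _ := by field_simp
    linarith
  have d1 : a / 20 * ∑ x, f₂ x ≤ 0.06 * (a ^ 2 * Dc) := by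
    have : a / 20 * ∑ x, f₂ x ≤ a / 20 * (1.03 * a * Dc) := by gcongr
    have c4 : 0 < a ^ 2 * Dc := by positivity
    nlinarith
  have d2 : (20 / a) ^ 7 * ∑ x, (g x - h x) ^ 8 ≤ 0.1 * (a ^ 2 * Dc) := by
    calc _ ≤ (20 / a) ^ 7 * ((a / 10 ^ 16) * (30001 * V)) := by gcongr
      _ = (20 ^ 7 * 30001 / 10 ^ 16) * a ^ 2 * D'.card := by rw [hV]; field_simp
      _ ≤ (20 ^ 7 * 30001 / 10 ^ 16) * a ^ 2 * (1.01 * Dc) := by gcongr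
      _ = (20 ^ 7 * 30001 / 10 ^ 16 * 1.01) * (a ^ 2 * Dc) := by ring
      _ ≤ _ := by gcongr; norm_num
  have d3 : κ * Dc ≤ 0.05 * (a ^ 2 * Dc) := by
    have : a ^ 8 ≤ a ^ 2 := pow_le_pow_of_le_one ha.le ha1 (by norm_num)
    calc κ * Dc ≤ (a ^ 2 / 20) * Dc := by gcongr; linarith
      _ = _ := by ring
  have c4 : 0 < a ^ 2 * Dc := by positivity
  linarith

end RB


set_option linter.unusedSectionVars false
set_option linter.unusedVariables false

namespace RB

variable {G : Type} [AddCommGroup G] [Fintype G] [DecidableEq G]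

/-- indicator -/
noncomputable def ind (A : Finset G) (x : G) : ℝ := if x ∈ A then 1 else 0

lemma ind_nonneg (A : Finset G) (x : G) : 0 ≤ ind A x := by unfold ind; split_ifs <;> norm_num
lemma ind_le_one (A : Finset G) (x : G) : ind A x ≤ 1 := by unfold ind; split_ifs <;> norm_num

/-- pull back of a set of characters -/
noncomputable def pl (e : G ≃+ G) (Γ : Finset (AddChar G ℂ)) : Finset (AddChar G ℂ) :=
  Γ.image fun γ => γ.compAddMonoidHom e.toAddMonoidHom

lemma pl_card (e : G ≃+ G) (Γ : Finset (AddChar G ℂ)) : (pl e Γ).card ≤ Γ.card :=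
  Finset.card_image_le

lemma mem_pl (e : G ≃+ G) (Γ : Finset (AddChar G ℂ)) (r : ℝ) (x : G) :
    x ∈ bohr (pl e Γ) r ↔ e x ∈ bohr Γ r := by
  simp only [mem_bohr, pl, Finset.mem_image, forall_exists_index, and_imp,
    forall_apply_eq_imp_iff₂]
  rfl

lemma pl_map (e : G ≃+ G) (Γ : Finset (AddChar G ℂ)) (r : ℝ) :
    (bohr (pl e Γ) r).map e.toEquiv.toEmbedding = bohr Γ r := by
  ext x
  simp only [Finset.mem_map, mem_pl]
  constructor
  · rintro ⟨y, hy, rfl⟩; exact hy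
  · intro hx; exact ⟨e.symm x, by simpa using hx, by simp⟩

lemma pl_bohr_card (e : G ≃+ G) (Γ : Finset (AddChar G ℂ)) (r : ℝ) :
    (bohr (pl e Γ) r).card = (bohr Γ r).card := by
  rw [← pl_map e Γ r, Finset.card_map]

lemma pl_sum (e : G ≃+ G) (Γ : Finset (AddChar G ℂ)) (r : ℝ) (u : G → ℝ) :
    ∑ y ∈ bohr (pl e Γ) r, u (e y) = ∑ y ∈ bohr Γ r, u y := by
  rw [← pl_map e Γ r, Finset.sum_map]; rfl

/-- Iteration state. -/
def State (A : Finset G) (d : ℕ) (w a : ℝ) : Prop :=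
  ∃ (Γ : Finset (AddChar G ℂ)) (r : ℝ) (x : G), 0 ≤ r ∧ Γ.card ≤ d ∧
    ((bohr Γ (r + w)).card : ℝ) ≤ 1.01 * (bohr Γ r).card ∧
    a * (bohr Γ r).card ≤ ∑ y ∈ bohr Γ r, ind A (x + y)

lemma State.up {A : Finset G} {d : ℕ} {w a : ℝ} (h : ¬ State A d w a)
    {Γ : Finset (AddChar G ℂ)} {r wd : ℝ} (hr : 0 ≤ r) (hΓ : Γ.card ≤ d) (hw : w ≤ wd)
    (hreg : ((bohr Γ (r + wd)).card : ℝ) ≤ 1.01 * (bohr Γ r).card) (x : G) :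
    ∑ y ∈ bohr Γ r, ind A (x + y) ≤ a * (bohr Γ r).card := by
  by_contra! hc
  refine h ⟨Γ, r, x, hr, hΓ, ?_, hc.le⟩
  refine le_trans ?_ hreg
  exact_mod_cast Finset.card_le_card (bohr_mono (by linarith))

lemma avg_big (u : G → ℝ) (hu : ∀ x, 0 ≤ u x) {Γ : Finset (AddChar G ℂ)} {r w : ℝ} {E : Finset G}
    (hE : E.Nonempty) (hEw : E ⊆ bohr Γ w) :
    ∑ y ∈ bohr Γ r, u y ≤ ∑ y ∈ bohr Γ (r + w), sm (un E) u y := by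
  have hp := un_pr hE
  have h1 : ∀ z, un E z * ∑ y ∈ bohr Γ r, u y ≤
      un E z * ∑ y ∈ bohr Γ (r + w), u (y + z) := by
    intro z
    rcases eq_or_ne (un E z) 0 with h0 | h0
    · simp [h0]
    refine mul_le_mul_of_nonneg_left ?_ (hp.1 z)
    have hz := hEw (un_supp h0)
    have e1 : ∑ y ∈ bohr Γ r, u y = ∑ y, if y ∈ bohr Γ r then u y else 0 := by
      rw [Finset.sum_ite_mem, Finset.univ_inter]
    have e2 : ∑ y ∈ bohr Γ (r + w), u (y + z) =
        ∑ y, if y ∈ bohr Γ (r + w) then u (y + z) else 0 := by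
      rw [Finset.sum_ite_mem, Finset.univ_inter]
    rw [e1, e2, ← sum_shift (fun y => if y ∈ bohr Γ r then u y else 0) z]
    refine Finset.sum_le_sum fun y _ => ?_
    by_cases hy : y + z ∈ bohr Γ r
    · have : y ∈ bohr Γ (r + w) := by simpa using sub_mem_bohr hy hz
      simp [hy, this]
    · simp only [hy, if_false]
      split_ifs
      · exact hu _
      · exact le_rfl
  have := Finset.sum_le_sum fun z (_ : z ∈ Finset.univ) => h1 z
  rw [← Finset.sum_mul, hp.2, one_mul] at this
  refine this.trans (le_of_eq ?_)
  simp only [sm, Finset.mul_sum]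
  rw [Finset.sum_comm]

lemma three_avg (A : Finset G) {Γ : Finset (AddChar G ℂ)} {r w a : ℝ} (x : G) (hr : 0 ≤ r)
    (hw : 0 ≤ w) (ha : 0 < a)
    (hreg : ((bohr Γ (r + w)).card : ℝ) ≤ 1.01 * (bohr Γ r).card)
    (hA : a * (bohr Γ r).card ≤ ∑ y ∈ bohr Γ r, ind A (x + y))
    (E₁ E₂ E₃ : Finset G) (h1 : E₁.Nonempty) (h2 : E₂.Nonempty) (h3 : E₃.Nonempty)
    (h1w : E₁ ⊆ bohr Γ w) (h2w : E₂ ⊆ bohr Γ w) (h3w : E₃ ⊆ bohr Γ w)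
    (h1u : ∀ x, ∑ y ∈ E₁, ind A (x + y) ≤ 1.01 * a * E₁.card)
    (h2u : ∀ x, ∑ y ∈ E₂, ind A (x + y) ≤ 1.01 * a * E₂.card)
    (h3u : ∀ x, ∑ y ∈ E₃, ind A (x + y) ≤ 1.01 * a * E₃.card) :
    ∃ x₀, 0.95 * a * E₁.card ≤ ∑ y ∈ E₁, ind A (x₀ + y) ∧
      0.95 * a * E₂.card ≤ ∑ y ∈ E₂, ind A (x₀ + y) ∧
      0.95 * a * E₃.card ≤ ∑ y ∈ E₃, ind A (x₀ + y) := by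
  set u : G → ℝ := fun y => ind A (x + y) with hu
  have hu0 : ∀ y, 0 ≤ u y := fun y => ind_nonneg A _
  have hB : (0 : ℝ) < (bohr Γ r).card := bohr_card_pos hr
  have hB' : (0 : ℝ) < (bohr Γ (r + w)).card := bohr_card_pos (by linarith)
  have hform : ∀ (E : Finset G), E.Nonempty → ∀ y,
      sm (un E) u y * E.card = ∑ z ∈ E, ind A ((x + y) + z) := by
    intro E hE y
    have : (0 : ℝ) < E.card := by exact_mod_cast hE.card_pos
    rw [sm_un, mul_comm, ← mul_assoc, mul_inv_cancel₀ this.ne', one_mul]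
    refine Finset.sum_congr rfl fun z _ => ?_
    simp only [hu, add_assoc]
  have hupp : ∀ (E : Finset G), E.Nonempty → (∀ x, ∑ y ∈ E, ind A (x + y) ≤ 1.01 * a * E.card) →
      ∀ y, sm (un E) u y ≤ 1.01 * a := by
    intro E hE hEu y
    have hc : (0 : ℝ) < E.card := by exact_mod_cast hE.card_pos
    have := hEu (x + y)
    rw [← hform E hE y] at this
    exact le_of_mul_le_mul_right this hc
  have s1 := avg_big u hu0 (r := r) h1 h1w
  have s2 := avg_big u hu0 (r := r) h2 h2w
  have s3 := avg_big u hu0 (r := r) h3 h3w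
  obtain ⟨y, hy, hy2⟩ : ∃ y ∈ bohr Γ (r + w), 2.97 * a ≤
      sm (un E₁) u y + sm (un E₂) u y + sm (un E₃) u y := by
    by_contra! hc
    have : ∑ y ∈ bohr Γ (r + w), (sm (un E₁) u y + sm (un E₂) u y + sm (un E₃) u y) ≤
        (bohr Γ (r + w)).card * (2.97 * a) := by
      rw [← nsmul_eq_mul]
      exact Finset.sum_le_card_nsmul _ _ _ fun y hy => (hc y hy).le
    rw [Finset.sum_add_distrib, Finset.sum_add_distrib] at this
    have h4 : ((bohr Γ (r + w)).card : ℝ) * (2.97 * a) ≤ 1.01 * (bohr Γ r).card * (2.97 * a) := by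
      gcongr
    have h5 : 0 < a * (bohr Γ r).card := by positivity
    nlinarith
  have u1 := hupp E₁ h1 h1u y
  have u2 := hupp E₂ h2 h2u y
  have u3 := hupp E₃ h3 h3u y
  refine ⟨x + y, ?_, ?_, ?_⟩
  · rw [← hform E₁ h1]; gcongr; linarith
  · rw [← hform E₂ h2]; gcongr; linarith
  · rw [← hform E₃ h3]; gcongr; linarith

/-- Count of three term progressions. -/
def Xc (e : G ≃+ G) (A : Finset G) : ℕ :=
  ((A ×ˢ A).filter fun q => e.symm (q.1 + q.2) ∈ A).card

lemma count_bound (e : G ≃+ G) (he : ∀ x, e x = x + x) (A S D : Finset G) (hS : S.Nonempty)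
    (x₀ : G) (hSA : ∀ c ∈ S, x₀ + c ∈ A) {f₁ f₂ : G → ℝ}
    (h1 : ∀ y, f₁ y ≤ ind A (x₀ + e.symm y)) (h10 : ∀ y, 0 ≤ f₁ y)
    (h2 : ∀ y, f₂ y ≤ ind A (x₀ + y)) (h20 : ∀ y, 0 ≤ f₂ y) :
    S.card * ∑ x, f₂ x * sm (un S) f₁ x ≤ Xc e A := by
  have hc : (0 : ℝ) < S.card := by exact_mod_cast hS.card_pos
  have e1 : S.card * ∑ x, f₂ x * sm (un S) f₁ x = ∑ x, ∑ c ∈ S, f₂ x * f₁ (x + c) := by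
    rw [Finset.mul_sum]
    refine Finset.sum_congr rfl fun x _ => ?_
    rw [sm_un, ← Finset.mul_sum]; field_simp
  rw [e1]
  have e2 : ∀ x, ∀ c ∈ S, f₂ x * f₁ (x + c) ≤
      if (x₀ + x ∈ A ∧ e.symm ((x₀ + x) + (x₀ + c)) ∈ A) then (1 : ℝ) else 0 := by
    intro x c hcS
    have eq : e.symm ((x₀ + x) + (x₀ + c)) = x₀ + e.symm (x + c) := by
      rw [show (x₀ + x) + (x₀ + c) = (x₀ + x₀) + (x + c) by abel, map_add, ← he,
        AddEquiv.symm_apply_apply]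
    rw [eq]
    have := mul_le_mul (h2 x) (h1 (x + c)) (h10 _) (ind_nonneg _ _)
    refine this.trans ?_
    unfold ind
    split_ifs <;> simp_all
  refine (Finset.sum_le_sum fun x _ => Finset.sum_le_sum fun c hc => e2 x c hc).trans ?_
  rw [← Finset.sum_product', Finset.sum_ite, Finset.sum_const_zero, add_zero, Finset.sum_const,
    nsmul_eq_mul, mul_one]
  unfold Xc
  norm_cast
  refine Finset.card_le_card_of_injOn (fun q => (x₀ + q.1, x₀ + q.2)) ?_ ?_
  · rintro ⟨x, c⟩ hq
    simp only [Finset.coe_filter, Finset.mem_product, Finset.mem_univ, true_and,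
      Set.mem_setOf_eq] at hq ⊢
    exact ⟨⟨hq.2.1, hSA c hq.1⟩, hq.2.2⟩
  · rintro ⟨x, c⟩ _ ⟨x', c'⟩ _ h
    simp only [Prod.mk.injEq, add_right_inj] at h
    exact Prod.ext h.1 h.2

/-- radius shrinking factor -/
noncomputable def stp (α : ℝ) (m n L : ℕ) : ℝ :=
  (α ^ 8 / 20) / (4096 * m * (n + 5) * (n + 1) * L ^ 5)

lemma stp_pos {α : ℝ} {m n L : ℕ} (hα : 0 < α) (hm : 0 < m) (hL : 0 < L) : 0 < stp α m n L := by
  have : (0 : ℝ) < m := by exact_mod_cast hm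
  have : (0 : ℝ) < L := by exact_mod_cast hL
  unfold stp; positivity

end RB


set_option linter.unusedSectionVars false
set_option linter.unusedVariables false

namespace RB

variable {G : Type} [AddCommGroup G] [Fintype G] [DecidableEq G]

lemma pl_sub (e : G ≃+ G) (he : ∀ x, e x = x + x) (Γ : Finset (AddChar G ℂ)) (s : ℝ) :
    bohr (pl e.symm Γ) s ⊆ bohr Γ (2 * s) := by
  intro y hy
  rw [mem_pl] at hy
  have := add_mem_bohr hy hy
  rw [← he, AddEquiv.apply_symm_apply] at this
  exact bohr_mono (by linarith) this

lemma sm_un_le {S : Finset G} (hS : S.Nonempty) {u : G → ℝ} {x : G} {M : ℝ}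
    (h : ∑ y ∈ S, u (x + y) ≤ M * S.card) : sm (un S) u x ≤ M := by
  have : (0 : ℝ) < S.card := by exact_mod_cast hS.card_pos
  rw [sm_un, ← div_eq_inv_mul, div_le_iff₀ this]; exact h

lemma stp_def (α : ℝ) (m n L : ℕ) : stp α m n L =
    (α ^ 8 / 20) / (4096 * m * (n + 5) * (n + 1) * L ^ 5) := rfl

lemma scales {α w κ m n L : ℝ} (hα : 0 < α) (hα1 : α ≤ 1) (hw : 0 < w) (hm : 1 ≤ m)
    (hL : 1 ≤ L) (hn : 0 ≤ n) (hκ : κ = α ^ 8 / 20) :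
    ∃ ρ₁ ρ₂ ρ₃ ρ₄ ρ₅ w₁ w₂ w₃ w₄ w₅ : ℝ, w₁ = ρ₁ / L ∧ w₂ = ρ₂ / L ∧ w₃ = ρ₃ / L ∧ w₄ = ρ₄ / L ∧
      w₅ = ρ₅ / L ∧ 0 < ρ₁ ∧ 0 < ρ₂ ∧ 0 < ρ₃ ∧ 0 < ρ₄ ∧ 0 < ρ₅ ∧ 0 < w₁ ∧ 0 < w₂ ∧ 0 < w₃ ∧ 0 < w₄ ∧
      0 < w₅ ∧ w₅ = (α ^ 8 / 20) / (4096 * m * (n + 5) * (n + 1) * L ^ 5) * w ∧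
      w₁ ≤ ρ₁ ∧ w₂ ≤ ρ₂ ∧ w₃ ≤ ρ₃ ∧ w₄ ≤ ρ₄ ∧ w₅ ≤ ρ₅ ∧ ρ₁ = w / 8 ∧ ρ₂ = w₁ / 8 ∧
      ρ₃ * (4 * m) = w₂ ∧ ρ₄ * (2 * (n + 5)) = w₃ ∧ ρ₅ * (8 * (n + 1)) = w₄ * κ ∧
      ρ₃ ≤ w₂ / 4 ∧ ρ₄ ≤ w₃ / 10 ∧ ρ₅ ≤ w₄ / 8 := by
  have hL0 : 0 < L := by linarith
  have hm0 : 0 < m := by linarith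
  have hα8 : α ^ 8 ≤ 1 := pow_le_one₀ hα.le hα1
  have hα80 : 0 < α ^ 8 := by positivity
  have hκ0 : 0 < κ := by linarith
  have hκ1 : κ ≤ 1 := by linarith
  have hdiv : ∀ x : ℝ, 0 < x → 0 < x / L := fun x hx => by positivity
  have hle : ∀ x : ℝ, 0 < x → x / L ≤ x := fun x hx => div_le_self hx.le hL
  obtain ⟨ρ₁, h1⟩ : ∃ z, z = w / 8 := ⟨_, rfl⟩
  have p1 : 0 < ρ₁ := by linarith
  obtain ⟨w₁, g1⟩ : ∃ z, z = ρ₁ / L := ⟨_, rfl⟩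
  have v1 : 0 < w₁ := g1 ▸ hdiv _ p1
  obtain ⟨ρ₂, h2⟩ : ∃ z, z = w₁ / 8 := ⟨_, rfl⟩
  have p2 : 0 < ρ₂ := by linarith
  obtain ⟨w₂, g2⟩ : ∃ z, z = ρ₂ / L := ⟨_, rfl⟩
  have v2 : 0 < w₂ := g2 ▸ hdiv _ p2
  obtain ⟨ρ₃, h3⟩ : ∃ z, z = w₂ / (4 * m) := ⟨_, rfl⟩
  have p3 : 0 < ρ₃ := by rw [h3]; positivity
  obtain ⟨w₃, g3⟩ : ∃ z, z = ρ₃ / L := ⟨_, rfl⟩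
  have v3 : 0 < w₃ := g3 ▸ hdiv _ p3
  obtain ⟨ρ₄, h4⟩ : ∃ z, z = w₃ / (2 * (n + 5)) := ⟨_, rfl⟩
  have p4 : 0 < ρ₄ := by rw [h4]; positivity
  obtain ⟨w₄, g4⟩ : ∃ z, z = ρ₄ / L := ⟨_, rfl⟩
  have v4 : 0 < w₄ := g4 ▸ hdiv _ p4
  obtain ⟨ρ₅, h5⟩ : ∃ z, z = w₄ * (κ / (8 * (n + 1))) := ⟨_, rfl⟩
  have p5 : 0 < ρ₅ := by rw [h5]; positivity
  obtain ⟨w₅, g5⟩ : ∃ z, z = ρ₅ / L := ⟨_, rfl⟩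
  have v5 : 0 < w₅ := g5 ▸ hdiv _ p5
  have q3 : ρ₃ * (4 * m) = w₂ := by rw [h3]; field_simp
  have q4 : ρ₄ * (2 * (n + 5)) = w₃ := by rw [h4]; field_simp
  have q5 : ρ₅ * (8 * (n + 1)) = w₄ * κ := by rw [h5]; field_simp
  refine ⟨ρ₁, ρ₂, ρ₃, ρ₄, ρ₅, w₁, w₂, w₃, w₄, w₅, g1, g2, g3, g4, g5, p1, p2, p3, p4, p5, v1, v2, v3,
    v4, v5, ?_, g1 ▸ hle _ p1, g2 ▸ hle _ p2, g3 ▸ hle _ p3, g4 ▸ hle _ p4, g5 ▸ hle _ p5, h1, h2, q3,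
    q4, q5, ?_, ?_, ?_⟩
  · rw [g5, h5, g4, h4, g3, h3, g2, h2, g1, h1, hκ]
    field_simp
    norm_num
  · nlinarith only [q3, mul_le_mul_of_nonneg_left hm p3.le]
  · nlinarith only [q4, mul_nonneg p4.le hn]
  · nlinarith only [q5, mul_nonneg p5.le hn, mul_le_mul_of_nonneg_left hκ1 v4.le]

set_option maxHeartbeats 1000000 in
lemma step (e : G ≃+ G) (he : ∀ x, e x = x + x) (A : Finset G) {d m n k L : ℕ} {α a w : ℝ}
    (hα : 0 < α) (hαa : α ≤ a) (ha1 : a ≤ 1) (hw : 0 < w) (hw1 : w ≤ 1) (hm : 0 < m) (hk : 0 < k)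
    (hL0 : 0 < L) (hkα : 1 ≤ k * α) (hδ : 10 ^ 27 * (m : ℝ) ^ 8 ≤ (k : ℝ) ^ 4 * α ^ 5)
    (hκ : 2 * (1 / 4 : ℝ) ^ m ≤ α ^ 8 / 20)
    (hn : 16 * Real.log (4 * (2 / α) ^ k) ≤ n)
    (hL : 1000 * ((d : ℝ) + n) ≤ L) (hL2 : 10 * (d : ℝ) ≤ α ^ 8 / 320 * L)
    (hS : State A d w a) :
    State A (d + n) (stp α m n L * w) (1.01 * a) ∨
      ∃ Γ' : Finset (AddChar G ℂ), Γ'.card ≤ d ∧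
        a ^ 3 / 4 * ((bohr Γ' (stp α m n L * w)).card : ℝ) ^ 2 ≤ Xc e A := by
  classical
  by_cases hinc : State A (d + n) (stp α m n L * w) (1.01 * a)
  · exact Or.inl hinc
  right
  obtain ⟨Γ, r, x, hr, hΓd, hreg, hA⟩ := hS
  have ha : 0 < a := hα.trans_le hαa
  have hα1 : α ≤ 1 := hαa.trans ha1
  have hm' : (1 : ℝ) ≤ m := by exact_mod_cast hm
  have hL' : (1 : ℝ) ≤ L := by exact_mod_cast hL0
  have hk' : (1 : ℝ) ≤ k := by exact_mod_cast hk
  have hn0 : (0 : ℝ) ≤ n := by positivity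
  have hd0 : (0 : ℝ) ≤ d := by positivity
  obtain ⟨κ, hκd⟩ : ∃ z, z = α ^ 8 / 20 := ⟨_, rfl⟩
  rw [← hκd] at hκ
  have hκ0 : 0 < κ := by rw [hκd]; positivity
  have hα8 : α ^ 8 ≤ 1 := pow_le_one₀ hα.le hα1
  have hε0 : 0 < α ^ 8 / 320 := by positivity
  have hκ1 : κ ≤ 1 := by rw [hκd]; linarith only [hα8]
  obtain ⟨Γ₂, hΓ₂⟩ : ∃ z, z = pl e.symm Γ := ⟨_, rfl⟩
  have hΓ₂d : Γ₂.card ≤ d := by rw [hΓ₂]; exact (pl_card _ _).trans hΓd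
  have hΓ₂d' : (Γ₂.card : ℝ) ≤ d := by exact_mod_cast hΓ₂d
  have hdn : d ≤ d + n := Nat.le_add_right _ _
  -- scales
  obtain ⟨ρ₁, ρ₂, ρ₃, ρ₄, ρ₅, w₁, w₂, w₃, w₄, w₅, hw₁, hw₂, hw₃, hw₄, hw₅, hρ₁0, hρ₂0, hρ₃0, hρ₄0,
    hρ₅0, hw₁0, hw₂0, hw₃0, hw₄0, hw₅0, hw₅s, l1, l2, l3, l4, l5, q1, q2, q3, q4, q5, m3, m4, m5⟩ :=
    scales hα hα1 hw hm' hL' hn0 hκd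
  have hw41 : w₄ ≤ 1 := by linarith only [hw1, l1, l2, l3, l4, q1, q2, m3, m4, hρ₁0, hρ₂0, hρ₃0]
  rw [stp_def, ← hw₅s] at hinc ⊢
  -- regular radii
  have hreg_c : 10 * (Γ₂.card : ℝ) ≤ 0.01 * L := by linarith only [hL, hΓ₂d', hn0]
  obtain ⟨r₁, hr1l, hr1u, hreg1⟩ := bohr_reg Γ₂ hρ₁0 (ε := 0.01) (by norm_num) (by norm_num) L hL0
    hreg_c
  obtain ⟨r₂, hr2l, hr2u, hreg2⟩ := bohr_reg Γ₂ hρ₂0 (ε := 0.01) (by norm_num) (by norm_num) L hL0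
    hreg_c
  obtain ⟨r₃, hr3l, hr3u, hreg3⟩ := bohr_reg Γ₂ hρ₃0 (ε := 0.01) (by norm_num) (by norm_num) L hL0
    hreg_c
  obtain ⟨r₄, hr4l, hr4u, hreg4⟩ := bohr_reg Γ₂ hρ₄0 (ε := α ^ 8 / 320) (by positivity)
    (by linarith only [hα8]) L hL0 (by linarith only [hL2, hΓ₂d'])
  have sw4 : w₅ ≤ w₄ := by linarith only [l5, m5, hw₄0]
  have sw3 : w₅ ≤ w₃ := by linarith only [sw4, l4, m4, hw₃0]
  have sw2 : w₅ ≤ w₂ := by linarith only [sw3, l3, m3, hw₂0]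
  have sw1 : w₅ ≤ w₁ := by linarith only [sw2, l2, q2, hw₁0]
  rw [← hw₁] at hreg1
  rw [← hw₂] at hreg2
  rw [← hw₃] at hreg3
  rw [← hw₄] at hreg4
  have one01 : (1 + 0.01 : ℝ) = 1.01 := by norm_num
  rw [one01] at hreg1 hreg2 hreg3
  have hr10 : 0 ≤ r₁ := by linarith only [hr1l, hρ₁0]
  have hr20 : 0 ≤ r₂ := by linarith only [hr2l, hρ₂0]
  have hr30 : 0 ≤ r₃ := by linarith only [hr3l, hρ₃0]
  have hr40 : 0 ≤ r₄ := by linarith only [hr4l, hρ₄0]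
  obtain ⟨D, hD⟩ : ∃ z, z = bohr Γ₂ r₁ := ⟨_, rfl⟩
  obtain ⟨D', hD'⟩ : ∃ z, z = bohr Γ₂ (r₁ + w₁) := ⟨_, rfl⟩
  obtain ⟨B₂, hB₂⟩ : ∃ z, z = bohr Γ₂ r₂ := ⟨_, rfl⟩
  rw [← hD, ← hD'] at hreg1
  have hDE : D.card = (bohr Γ r₁).card := by rw [hD, hΓ₂]; exact pl_bohr_card _ _ _
  have hDE' : D'.card = (bohr Γ (r₁ + w₁)).card := by rw [hD', hΓ₂]; exact pl_bohr_card _ _ _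
  have hDc : (0 : ℝ) < D.card := by rw [hD]; exact bohr_card_pos hr10
  have hBc : (0 : ℝ) < B₂.card := by rw [hB₂]; exact bohr_card_pos hr20
  -- choose x₀
  have hDn : D.Nonempty := by rw [hD]; exact ⟨0, zero_mem_bohr hr10⟩
  have hBn : B₂.Nonempty := by rw [hB₂]; exact ⟨0, zero_mem_bohr hr20⟩
  have hu1 : ∀ x, ∑ y ∈ bohr Γ r₁, ind A (x + y) ≤ 1.01 * a * (bohr Γ r₁).card :=
    State.up hinc hr10 (hΓd.trans hdn) (wd := w₁) sw1 (by
      rw [← hDE, ← hDE']; exact hreg1)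
  have hu2 : ∀ x, ∑ y ∈ D, ind A (x + y) ≤ 1.01 * a * D.card := by
    rw [hD]
    exact State.up hinc hr10 (hΓ₂d.trans hdn) (wd := w₁) sw1 (by rw [← hD, ← hD']; exact hreg1)
  have hu3 : ∀ x, ∑ y ∈ B₂, ind A (x + y) ≤ 1.01 * a * B₂.card := by
    rw [hB₂]
    exact State.up hinc hr20 (hΓ₂d.trans hdn) (wd := w₂) sw2 hreg2
  have hr1w : 2 * r₁ ≤ w := by linarith only [hr1u, q1, hw]
  have hr2w : 2 * r₂ ≤ w := by linarith only [hr2u, q1, q2, l1, hw]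
  have hDw : D ⊆ bohr Γ w := by
    rw [hD, hΓ₂]; exact (pl_sub e he Γ r₁).trans (bohr_mono hr1w)
  have hBw : B₂ ⊆ bohr Γ w := by
    rw [hB₂, hΓ₂]; exact (pl_sub e he Γ r₂).trans (bohr_mono hr2w)
  obtain ⟨x₀, hx1, hx2, hx3⟩ := three_avg A x hr hw.le ha hreg hA (bohr Γ r₁) D B₂
    ⟨0, zero_mem_bohr hr10⟩ hDn hBn
    (bohr_mono (by linarith only [hr1w, hr10])) hDw hBw hu1 hu2 hu3
  obtain ⟨f₁, hf₁⟩ : ∃ z : G → ℝ, z = fun y => if y ∈ D then ind A (x₀ + e.symm y) else 0 := ⟨_, rfl⟩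
  obtain ⟨f₂, hf₂⟩ : ∃ z : G → ℝ, z = fun y => if y ∈ D then ind A (x₀ + y) else 0 := ⟨_, rfl⟩
  have hf1 : ∀ y, 0 ≤ f₁ y ∧ f₁ y ≤ 1 := by
    intro y; simp only [hf₁]; split_ifs
    · exact ⟨ind_nonneg _ _, ind_le_one _ _⟩
    · norm_num
  have hf2 : ∀ y, 0 ≤ f₂ y ∧ f₂ y ≤ 1 := by
    intro y; simp only [hf₂]; split_ifs
    · exact ⟨ind_nonneg _ _, ind_le_one _ _⟩
    · norm_num
  have hf1i : ∀ y, f₁ y ≤ ind A (x₀ + e.symm y) := by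
    intro y; simp only [hf₁]; split_ifs
    · exact le_rfl
    · exact ind_nonneg _ _
  have hf2i : ∀ y, f₂ y ≤ ind A (x₀ + y) := by
    intro y; simp only [hf₂]; split_ifs
    · exact le_rfl
    · exact ind_nonneg _ _
  have hf1D : ∀ y, f₁ y ≠ 0 → y ∈ D := by
    intro y hy; by_contra h; exact hy (by simp [hf₁, h])
  have hf2D : ∀ y, f₂ y ≠ 0 → y ∈ D := by
    intro y hy; by_contra h; exact hy (by simp [hf₂, h])
  have hs1 : ∑ y, f₁ y = ∑ y ∈ bohr Γ r₁, ind A (x₀ + y) := by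
    rw [← pl_sum e.symm Γ r₁ (fun y => ind A (x₀ + y))]
    simp only [hf₁]; rw [Finset.sum_ite_mem, Finset.univ_inter, hD, hΓ₂]
  have hs2 : ∑ y, f₂ y = ∑ y ∈ D, ind A (x₀ + y) := by
    simp only [hf₂]; rw [Finset.sum_ite_mem, Finset.univ_inter]
  have hup : ∀ (B : Finset G) (u : G → ℝ), (∀ y, u y ≤ 1) → ∑ y ∈ B, u y ≤ B.card := by
    intro B u hu
    have := Finset.sum_le_card_nsmul B u 1 (fun y _ => hu y)
    simpa using this
  -- S
  obtain ⟨S, hS⟩ : ∃ z, z = B₂.filter (fun c => x₀ + c ∈ A) := ⟨_, rfl⟩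
  have hSc : (S.card : ℝ) = ∑ c ∈ B₂, ind A (x₀ + c) := by
    simp only [ind]; rw [Finset.sum_boole, hS]
  have hSl : 0.95 * a * B₂.card ≤ S.card := by rw [hSc]; exact hx3
  have hSn : S.Nonempty := by
    rw [← Finset.card_pos]
    have : (0 : ℝ) < S.card := lt_of_lt_of_le (by positivity) hSl
    exact_mod_cast this
  have hS2 : S ⊆ bohr Γ₂ r₂ := by rw [hS, ← hB₂]; exact Finset.filter_subset _ _
  have hU : ∀ x, x ∉ D' → ∀ c ∈ S, f₁ (x + c) = 0 := by
    intro x hx c hc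
    by_contra h
    apply hx
    have h3 := hf1D _ h
    rw [hD] at h3
    have := sub_mem_bohr h3 (hS2 hc)
    rw [add_sub_cancel_right] at this
    rw [hD']
    exact bohr_mono (by linarith only [hr2u, q2, hw₁0]) this
  have hD'n : D'.Nonempty := by
    rw [hD']; exact ⟨0, zero_mem_bohr (by linarith only [hr10, hw₁0])⟩
  have z1 : 1 ≤ k * a := hkα.trans (by gcongr)
  have z2 : a / 2 * ((bohr Γ₂ (r₂ + w₂)).card : ℝ) ≤ S.card := by
    rw [hB₂] at hSl
    have h1 : a * ((bohr Γ₂ (r₂ + w₂)).card : ℝ) ≤ a * (1.01 * (bohr Γ₂ r₂).card) := by gcongr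
    have h2 : 0 ≤ a * ((bohr Γ₂ r₂).card : ℝ) := by positivity
    linarith only [h1, h2, hSl]
  have z3 : r₃ ≤ w₂ := by linarith only [hr3u, m3, hw₂0]
  have z4 : m * (2 * r₃) ≤ w₂ := by
    have h1 : m * (2 * r₃) ≤ m * (2 * (2 * ρ₃)) := by gcongr
    linarith only [h1, q3]
  have z5 : (n + 5) * r₄ ≤ w₃ := by
    have h1 : (n + 5) * r₄ ≤ (n + 5) * (2 * ρ₄) := by gcongr
    linarith only [h1, q4]
  have z6 : ((bohr Γ₂ (r₃ + w₃)).card : ℝ) ≤ 2 * (bohr Γ₂ r₃).card := by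
    have h1 : (0 : ℝ) ≤ (bohr Γ₂ r₃).card := by positivity
    linarith only [h1, hreg3]
  obtain ⟨Λ, W, hΛ, hWp, hWs, hN8, hL2'⟩ := smooth Γ₂ (a := a) (b := a / 2) (ε := α ^ 8 / 320)
    (w₄ := w₄) m n k f₁ hf1 S D' hSn hD'n hS2 hU hk
    z1 (by positivity) z2
    hr30 hw₃0.le hr40 hε0.le z3 z4 z5 z6 hreg4 (by
      refine le_trans ?_ hn
      have h1 : 1 / (a / 2) ≤ 2 / α := by
        rw [one_div_div]; gcongr
      have h2 : (4 : ℝ) * (1 / (a / 2)) ^ k ≤ 4 * (2 / α) ^ k := by gcongr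
      have := Real.log_le_log (by positivity) h2
      linarith only [this])
  -- new Bohr set
  obtain ⟨Γ₅, hΓ₅⟩ : ∃ z, z = Γ₂ ∪ Λ := ⟨_, rfl⟩
  have hΓ₅c : Γ₅.card ≤ d + n := by rw [hΓ₅]; exact (Finset.card_union_le _ _).trans (add_le_add hΓ₂d hΛ)
  have hΓ₅c' : (Γ₅.card : ℝ) ≤ d + n := by exact_mod_cast hΓ₅c
  obtain ⟨r₅, hr5l, hr5u, hreg5⟩ := bohr_reg Γ₅ hρ₅0 (ε := 0.01) (by norm_num) (by norm_num) L hL0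
    (by linarith only [hL, hΓ₅c'])
  rw [← hw₅, one01] at hreg5
  have hr50 : 0 ≤ r₅ := by linarith only [hr5l, hρ₅0]
  have hr54 : r₅ ≤ w₄ := by linarith only [hr5u, m5, hw₄0]
  obtain ⟨N, hN⟩ : ∃ z, z = bohr Γ₅ r₅ := ⟨_, rfl⟩
  have hNn : N.Nonempty := by rw [hN]; exact ⟨0, zero_mem_bohr hr50⟩
  have hN2 : ∀ y ∈ N, y ∈ bohr Γ₂ r₅ := by
    intro y hy; rw [hN, hΓ₅] at hy; exact bohr_anti Finset.subset_union_left hy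
  have hNL : ∀ y ∈ N, y ∈ bohr Λ r₅ := by
    intro y hy; rw [hN, hΓ₅] at hy; exact bohr_anti Finset.subset_union_right hy
  have z7 : 2 * (4 * (α ^ 8 / 320) + (n + 1) * (2 * ρ₅)) ≤ κ := by
    have h1 : α ^ 8 / 320 = κ / 16 := by rw [hκd]; ring
    have h2 : w₄ * κ ≤ 1 * κ := by gcongr
    rw [h1]
    linarith only [h2, q5]
  have hL2'' := hL2' κ (2 * ρ₅) (by linarith only [hρ₅0]) hκ z7 N hNn
    (fun y hy => ⟨bohr_mono hr54 (hN2 y hy), bohr_mono hr5u (hNL y hy)⟩)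
  have hM1 : ∀ y, sm (un N) f₁ y ≤ 1.01 * a := by
    intro y
    apply sm_un_le hNn
    have h1 : ∑ b ∈ N, f₁ (y + b) ≤ ∑ b ∈ N, ind A (x₀ + e.symm y + e.symm b) := by
      refine Finset.sum_le_sum fun b _ => ?_
      have := hf1i (y + b)
      rwa [map_add, ← add_assoc] at this
    refine h1.trans ?_
    have h2 := pl_sum e Γ₅ r₅ (fun b => ind A (x₀ + e.symm y + e.symm b))
    simp only [AddEquiv.symm_apply_apply] at h2
    rw [hN, ← h2, ← pl_bohr_card e Γ₅ r₅]
    exact State.up hinc hr50 ((pl_card e Γ₅).trans hΓ₅c) (wd := w₅) le_rfl (by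
      rw [pl_bohr_card, pl_bohr_card]; exact hreg5) _
  have hM2 : ∀ y, sm (un N) f₂ y ≤ 1.01 * a := by
    intro y
    apply sm_un_le hNn
    have h1 : ∑ b ∈ N, f₂ (y + b) ≤ ∑ b ∈ N, ind A (x₀ + y + b) := by
      refine Finset.sum_le_sum fun b _ => ?_
      have := hf2i (y + b)
      rwa [← add_assoc] at this
    refine h1.trans ?_
    rw [hN]
    exact State.up hinc hr50 hΓ₅c (wd := w₅) le_rfl hreg5 _
  have hDD : (D.card : ℝ) ≤ D'.card := by
    rw [hD, hD']
    exact_mod_cast Finset.card_le_card (bohr_mono (by linarith only [hw₁0]))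
  have z8 : r₁ + r₅ ≤ r₁ + w₁ := by linarith only [hr54, l4, m4, l3, m3, l2, q2, hw₁0, hw₂0, hw₃0]
  have z9 : r₁ + r₅ + (r₂ + w₂) ≤ r₁ + w₁ := by
    linarith only [hr54, l4, m4, l3, m3, l2, q2, hw₁0, hw₂0, hw₃0, hr2u]
  have g1 : ∀ x, x ∉ D' → ∀ y, W y ≠ 0 → ∀ z, un N z ≠ 0 → f₁ (x + y + z) = 0 := by
    intro x hx y hy z hz
    by_contra h
    apply hx
    have h3 := hf1D _ h
    rw [hD] at h3
    have h1 := sub_mem_bohr (sub_mem_bohr h3 (hN2 z (un_supp hz))) (hWs y hy)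
    rw [add_sub_cancel_right, add_sub_cancel_right] at h1
    rw [hD']
    exact bohr_mono z9 h1
  have g2 : ∀ x, x ∉ D' → ∀ z, un N z ≠ 0 → f₂ (x + z) = 0 := by
    intro x hx z hz
    by_contra h
    apply hx
    have h3 := hf2D _ h
    rw [hD] at h3
    have h1 := sub_mem_bohr h3 (hN2 z (un_supp hz))
    rw [add_sub_cancel_right] at h1
    rw [hD']
    exact bohr_mono z8 h1
  have g3 : ∀ y, un N (-y) = un N y := fun y => by simp only [un, hN, neg_mem_bohr_iff]
  have g4 : κ ≤ a ^ 8 / 20 := by rw [hκd]; gcongr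
  have g5 : (m : ℝ) ^ 8 * (2 ^ 9 * (240000 * 2 ^ 7 / (k * a) ^ 4)) ≤ a / 10 ^ 16 := by
    have h1 : 10 ^ 27 * (m : ℝ) ^ 8 ≤ (k : ℝ) ^ 4 * a ^ 5 := hδ.trans (by gcongr)
    rw [show (m : ℝ) ^ 8 * (2 ^ 9 * (240000 * 2 ^ 7 / (k * a) ^ 4)) =
      (m : ℝ) ^ 8 * (2 ^ 9 * (240000 * 2 ^ 7)) / (k * a) ^ 4 by ring, div_le_iff₀ (by positivity),
      div_mul_eq_mul_div, le_div_iff₀ (by positivity)]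
    have h2 : a * (k * a) ^ 4 = (k : ℝ) ^ 4 * a ^ 5 := by ring
    rw [h2]
    refine le_trans ?_ h1
    have h3 : (0 : ℝ) ≤ (m : ℝ) ^ 8 := by positivity
    linarith only [h3]
  have hfinal := analytic (f₁ := f₁) (f₂ := f₂) (W := W) (β := un N) (s := un S) (D' := D')
    (a := a) (κ := κ) (δ := (m : ℝ) ^ 8 * (2 ^ 9 * (240000 * 2 ^ 7 / (k * a) ^ 4)))
    (Dc := (D.card : ℝ)) hf1 hf2 hWp (un_pr hNn) (un_pr hSn)
    g3 ha ha1 hDc hreg1 hDD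
    (fun x hx y hy => hU x hx y (un_supp hy)) g1 g2
    (by rw [hs1, hDE]; exact hx1) (by rw [hs2]; exact hx2)
    (by rw [hs1, hDE]; exact hup _ _ fun y => ind_le_one _ _)
    (by rw [hs2]; exact hup _ _ fun y => ind_le_one _ _)
    hM1 hM2 hκ0 g4 (by positivity) g5
    (hN8.trans (le_of_eq (by ring))) hL2''
  have hX := count_bound e he A S D hSn x₀ (fun c hc => by rw [hS] at hc; exact (Finset.mem_filter.1 hc).2) hf1i
    (fun y => (hf1 y).1) hf2i (fun y => (hf2 y).1)
  refine ⟨Γ₂, hΓ₂d, le_trans ?_ hX⟩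
  have c1 : ((bohr Γ₂ w₅).card : ℝ) ≤ D.card := by
    rw [hD]
    exact_mod_cast Finset.card_le_card (bohr_mono (by linarith only [sw1, l1, hr1l]))
  have c2 : ((bohr Γ₂ w₅).card : ℝ) ≤ B₂.card := by
    rw [hB₂]
    exact_mod_cast Finset.card_le_card (bohr_mono (by linarith only [sw2, l2, hr2l]))
  calc a ^ 3 / 4 * ((bohr Γ₂ w₅).card : ℝ) ^ 2
      = a ^ 3 / 4 * ((bohr Γ₂ w₅).card * (bohr Γ₂ w₅).card) := by ring
    _ ≤ a ^ 3 / 4 * (B₂.card * D.card) := by gcongr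
    _ ≤ (0.95 * a * B₂.card) * (a ^ 2 * D.card / 2) := by
      have : 0 < a ^ 3 * ((B₂.card : ℝ) * D.card) := by positivity
      linarith only [this]
    _ ≤ S.card * (a ^ 2 * D.card / 2) := by gcongr
    _ ≤ _ := by gcongr

end RB


set_option linter.unusedSectionVars false
set_option linter.unusedVariables false

namespace RB

variable {G : Type} [AddCommGroup G] [Fintype G] [DecidableEq G]

lemma State.le_one {A : Finset G} {d : ℕ} {w a : ℝ} (h : State A d w a) : a ≤ 1 := by
  obtain ⟨Γ, r, x, hr, -, -, hA⟩ := h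
  have hB : (0 : ℝ) < (bohr Γ r).card := bohr_card_pos hr
  have h1 := Finset.sum_le_card_nsmul (bohr Γ r) (fun y => ind A (x + y)) 1
    (fun y _ => ind_le_one A _)
  rw [nsmul_eq_mul, mul_one] at h1
  by_contra! hc
  have := mul_lt_mul_of_pos_right hc hB
  linarith

lemma iter (e : G ≃+ G) (he : ∀ x, e x = x + x) (A : Finset G) {m n k L J : ℕ} {α : ℝ}
    (hα : 0 < α) (hm : 0 < m) (hk : 0 < k)
    (hL0 : 0 < L) (hkα : 1 ≤ k * α) (hδ : 10 ^ 27 * (m : ℝ) ^ 8 ≤ (k : ℝ) ^ 4 * α ^ 5)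
    (hκ : 2 * (1 / 4 : ℝ) ^ m ≤ α ^ 8 / 20)
    (hn : 16 * Real.log (4 * (2 / α) ^ k) ≤ n)
    (hL : 1000 * (((J : ℝ) + 1) * n) ≤ L) (hL2 : 10 * ((J : ℝ) * n) ≤ α ^ 8 / 320 * L)
    (hs1 : stp α m n L ≤ 1) (hJ : 1 < 1.01 ^ (J + 1) * α)
    (hA : α * Fintype.card G ≤ A.card) :
    ∃ Γ' : Finset (AddChar G ℂ), Γ'.card ≤ J * n ∧
        α ^ 3 / 4 * ((bohr Γ' (stp α m n L ^ (J + 1))).card : ℝ) ^ 2 ≤ Xc e A := by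
  have hs0 := stp_pos (n := n) hα hm hL0
  have key : ∀ j, j ≤ J + 1 → State A (j * n) (stp α m n L ^ j) (1.01 ^ j * α) ∨
      ∃ Γ' : Finset (AddChar G ℂ), Γ'.card ≤ J * n ∧
        α ^ 3 / 4 * ((bohr Γ' (stp α m n L ^ (J + 1))).card : ℝ) ^ 2 ≤ Xc e A := by
    intro j
    induction j with
    | zero =>
      intro _
      left
      have hu : ∀ r, bohr (∅ : Finset (AddChar G ℂ)) r = Finset.univ := by
        intro r; ext x; simp [mem_bohr]
      refine ⟨∅, 0, 0, le_rfl, by simp, ?_, ?_⟩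
      · rw [hu, hu]
        have : (0 : ℝ) ≤ (Finset.univ : Finset G).card := by positivity
        linarith
      · rw [hu]
        simp only [pow_zero, one_mul, zero_add, ind]
        rw [Finset.sum_boole]
        simpa using hA
    | succ j ih =>
      intro hj
      rcases ih (by omega) with h | h
      swap
      · exact Or.inr h
      have ha1 := h.le_one
      have hjJ : j ≤ J := by omega
      have hjJ' : (j : ℝ) ≤ J := by exact_mod_cast hjJ
      have hn0 : (0 : ℝ) ≤ n := by positivity
      have h101 : (1 : ℝ) ≤ 1.01 ^ j := one_le_pow₀ (by norm_num)
      have hαa : α ≤ 1.01 ^ j * α := by nlinarith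
      have hjn : (j : ℝ) * n ≤ J * n := by gcongr
      have hst := step e he A (d := j * n) (a := 1.01 ^ j * α) (w := stp α m n L ^ j) hα hαa ha1
        (by positivity) (pow_le_one₀ hs0.le hs1) hm hk hL0 hkα hδ hκ hn
        (by push_cast; linarith) (by push_cast; linarith) h
      rcases hst with h' | ⟨Γ', hc, hX⟩
      · left
        have e1 : (j + 1) * n = j * n + n := by ring
        have e2 : (1.01 : ℝ) ^ (j + 1) * α = 1.01 * (1.01 ^ j * α) := by ring
        have e3 : stp α m n L ^ (j + 1) = stp α m n L * stp α m n L ^ j := by ring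
        rw [e1, e2, e3]; exact h'
      · right
        refine ⟨Γ', hc.trans (Nat.mul_le_mul_right n hjJ), le_trans ?_ hX⟩
        have e3 : stp α m n L * stp α m n L ^ j = stp α m n L ^ (j + 1) := by ring
        rw [e3]
        have : ((bohr Γ' (stp α m n L ^ (J + 1))).card : ℝ) ≤
            (bohr Γ' (stp α m n L ^ (j + 1))).card := by
          exact_mod_cast Finset.card_le_card (bohr_mono (pow_le_pow_of_le_one hs0.le hs1 hj))
        gcongr
  rcases key (J + 1) le_rfl with h | h
  · have := h.le_one
    linarith
  · exact h

lemma iter2 (e : G ≃+ G) (he : ∀ x, e x = x + x) (A : Finset G) {m n k L J q : ℕ} {α : ℝ}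
    (hα : 0 < α) (hm : 0 < m) (hk : 0 < k)
    (hL0 : 0 < L) (hkα : 1 ≤ k * α) (hδ : 10 ^ 27 * (m : ℝ) ^ 8 ≤ (k : ℝ) ^ 4 * α ^ 5)
    (hκ : 2 * (1 / 4 : ℝ) ^ m ≤ α ^ 8 / 20)
    (hn : 16 * Real.log (4 * (2 / α) ^ k) ≤ n)
    (hL : 1000 * (((J : ℝ) + 1) * n) ≤ L) (hL2 : 10 * ((J : ℝ) * n) ≤ α ^ 8 / 320 * L)
    (hs1 : stp α m n L ≤ 1) (hJ : 1 < 1.01 ^ (J + 1) * α)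
    (hq : 1 ≤ 2 ^ q * stp α m n L)
    (hA : α * Fintype.card G ≤ A.card) :
    α ^ 3 * (Fintype.card G : ℝ) ^ 2 ≤
      4 * (100 ^ (J * n * (q * (J + 1) + 1))) ^ 2 * Xc e A := by
  obtain ⟨Γ, hc, hX⟩ := iter e he A hα hm hk hL0 hkα hδ hκ hn hL hL2 hs1 hJ hA
  have h1 := bohr_lower Γ (q * (J + 1) + 1)
  have h2 : (2 : ℝ) / 2 ^ (q * (J + 1) + 1) ≤ stp α m n L ^ (J + 1) := by
    have e1 : (2 : ℝ) ^ (q * (J + 1) + 1) = (2 ^ q) ^ (J + 1) * 2 := by rw [← pow_mul, ← pow_succ]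
    rw [div_le_iff₀ (by positivity), e1]
    have : (1 : ℝ) ≤ (2 ^ q * stp α m n L) ^ (J + 1) := one_le_pow₀ hq
    rw [mul_pow] at this
    linarith
  have h3 : (Fintype.card G : ℝ) ≤ 100 ^ (J * n * (q * (J + 1) + 1)) *
      (bohr Γ (stp α m n L ^ (J + 1))).card := by
    have h4 : (Fintype.card G : ℝ) ≤ 100 ^ (Γ.card * (q * (J + 1) + 1)) *
      (bohr Γ (2 / 2 ^ (q * (J + 1) + 1))).card := by exact_mod_cast h1
    refine h4.trans ?_
    have h5 : ((bohr Γ (2 / 2 ^ (q * (J + 1) + 1))).card : ℝ) ≤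
      (bohr Γ (stp α m n L ^ (J + 1))).card := by
        exact_mod_cast Finset.card_le_card (bohr_mono h2)
    gcongr
    norm_num
  calc α ^ 3 * (Fintype.card G : ℝ) ^ 2
      ≤ α ^ 3 * (100 ^ (J * n * (q * (J + 1) + 1)) *
      (bohr Γ (stp α m n L ^ (J + 1))).card) ^ 2 := by gcongr
    _ = 4 * (100 ^ (J * n * (q * (J + 1) + 1))) ^ 2 *
        (α ^ 3 / 4 * ((bohr Γ (stp α m n L ^ (J + 1))).card : ℝ) ^ 2) := by ring
    _ ≤ _ := by gcongr

lemma nat_two_pow (U : ℕ) : (U : ℝ) ≤ 2 ^ U := by exact_mod_cast Nat.lt_two_pow_self.le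

lemma pw {c : ℝ} {U t a b : ℕ} (hU : 1 ≤ U) (h : c ≤ 2 ^ a * 2 ^ (b * U)) (ht : a + b ≤ t) :
    c ≤ 2 ^ (t * U) := by
  refine h.trans ?_
  rw [← pow_add]
  refine pow_le_pow_right₀ (by norm_num) ?_
  nlinarith

set_option maxHeartbeats 1000000 in
lemma roth_U (e : G ≃+ G) (he : ∀ x, e x = x + x) (A : Finset G) {U : ℕ} {α : ℝ} (hU : 1 ≤ U)
    (hα : 0 < α) (hα1 : α ≤ 1) (hαU : 1 ≤ (U : ℝ) ^ 24 * α)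
    (hA : α * Fintype.card G ≤ A.card) :
    (Fintype.card G : ℝ) ^ 2 ≤ Real.exp (10 ^ 30 * U ^ 36) * Xc e A := by
  have hU' : (1 : ℝ) ≤ U := by exact_mod_cast hU
  have hUp : ∀ b : ℕ, (U : ℝ) ^ b ≤ 2 ^ (b * U) := by
    intro b
    rw [mul_comm, pow_mul]
    exact pow_le_pow_left₀ (by positivity) (nat_two_pow U) b
  have hU1 : ∀ b : ℕ, 1 ≤ (U : ℝ) ^ b := fun b => one_le_pow₀ hU'
  obtain ⟨m, hm⟩ : ∃ m : ℕ, m = 200 * U := ⟨_, rfl⟩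
  obtain ⟨k, hk⟩ : ∃ k : ℕ, k = 4 * 10 ^ 11 * U ^ 32 := ⟨_, rfl⟩
  obtain ⟨n, hn⟩ : ∃ n : ℕ, n = 432 * k * U := ⟨_, rfl⟩
  obtain ⟨J, hJ⟩ : ∃ J : ℕ, J = 4800 * U := ⟨_, rfl⟩
  obtain ⟨L, hL⟩ : ∃ L : ℕ, L = 3200 * (J + 1) * n * U ^ 192 := ⟨_, rfl⟩
  have hm0 : 0 < m := by rw [hm]; positivity
  have hk0 : 0 < k := by rw [hk]; positivity
  have hn0 : 0 < n := by rw [hn]; positivity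
  have hL0 : 0 < L := by rw [hL]; positivity
  have hm' : (m : ℝ) = 200 * U := by rw [hm]; push_cast; ring
  have hk' : (k : ℝ) = 4 * 10 ^ 11 * U ^ 32 := by rw [hk]; push_cast; ring
  have hn' : (n : ℝ) = 432 * k * U := by rw [hn]; push_cast; ring
  have hJ' : (J : ℝ) = 4800 * U := by rw [hJ]; push_cast; ring
  have hL' : (L : ℝ) = 3200 * (J + 1) * n * U ^ 192 := by rw [hL]; push_cast; ring
  have hα8 : 1 ≤ (U : ℝ) ^ 192 * α ^ 8 := by
    have := one_le_pow₀ hαU (n := 8)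
    calc 1 ≤ _ := this
      _ = _ := by ring
  have hα5 : 1 ≤ (U : ℝ) ^ 120 * α ^ 5 := by
    have := one_le_pow₀ hαU (n := 5)
    calc 1 ≤ _ := this
      _ = _ := by ring
  have b1 : (1 : ℝ) ≤ k * α := by
    rw [hk']
    calc (1 : ℝ) ≤ U ^ 24 * α := hαU
      _ ≤ (4 * 10 ^ 11 * U ^ 32) * α := by
        gcongr
        have := pow_le_pow_right₀ hU' (show 24 ≤ 32 by norm_num)
        have := hU1 32
        linarith
  have b2 : 10 ^ 27 * (m : ℝ) ^ 8 ≤ (k : ℝ) ^ 4 * α ^ 5 := by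
    rw [hm', hk']
    calc 10 ^ 27 * (200 * (U : ℝ)) ^ 8 = 10 ^ 27 * 200 ^ 8 * U ^ 8 * 1 := by ring
      _ ≤ 10 ^ 27 * 200 ^ 8 * U ^ 8 * (U ^ 120 * α ^ 5) := by gcongr
      _ = (10 ^ 27 * 200 ^ 8) * (U ^ 128 * α ^ 5) := by ring
      _ ≤ ((4 * 10 ^ 11) ^ 4) * (U ^ 128 * α ^ 5) := by gcongr ?_ * _; norm_num
      _ = _ := by ring
  have b3 : 2 * (1 / 4 : ℝ) ^ m ≤ α ^ 8 / 20 := by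
    rw [one_div, inv_pow, ← div_eq_mul_inv, div_le_iff₀ (by positivity)]
    have h1 : 40 * (U : ℝ) ^ 192 ≤ 4 ^ m := by
      have e4 : (4 : ℝ) ^ m = 2 ^ (400 * U) := by
        rw [hm, show (4 : ℝ) = 2 ^ 2 by norm_num, ← pow_mul]; congr 1; ring
      rw [e4]
      refine pw (a := 6) (b := 192) hU ?_ (by norm_num)
      have := hUp 192
      gcongr
      norm_num
    have h2 : 40 * ((U : ℝ) ^ 192 * α ^ 8) ≤ 4 ^ m * α ^ 8 := by
      rw [← mul_assoc]; gcongr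
    linarith
  have b4 : 16 * Real.log (4 * (2 / α) ^ k) ≤ n := by
    have h1 : 4 * (2 / α) ^ k ≤ Real.exp (27 * k * U) := by
      have e1 : 2 / α ≤ Real.exp (25 * U) := by
        have : 2 / α ≤ 2 * U ^ 24 := by
          rw [div_le_iff₀ hα]; linarith
        refine this.trans ?_
        have h2 : (2 : ℝ) ≤ Real.exp 1 := by linarith [Real.add_one_le_exp (1 : ℝ)]
        have h3 : (U : ℝ) ≤ Real.exp U := by linarith [Real.add_one_le_exp (U : ℝ)]
        calc 2 * (U : ℝ) ^ 24 ≤ Real.exp 1 * Real.exp U ^ 24 := by gcongr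
          _ = Real.exp (1 + 24 * U) := by rw [← Real.exp_nat_mul, ← Real.exp_add]; norm_num
          _ ≤ _ := Real.exp_le_exp.2 (by linarith)
      have h4 : (4 : ℝ) ≤ Real.exp (2 * k * U) := by
        have : (1 : ℝ) ≤ k * U := by
          have : (1 : ℝ) ≤ k := by exact_mod_cast hk0
          nlinarith
        have h5 : (2 : ℝ) ≤ Real.exp 1 := by linarith [Real.add_one_le_exp (1 : ℝ)]
        calc (4 : ℝ) = 2 * 2 := by norm_num
          _ ≤ Real.exp 1 * Real.exp 1 := by gcongr
          _ = Real.exp 2 := by rw [← Real.exp_add]; norm_num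
          _ ≤ _ := Real.exp_le_exp.2 (by linarith)
      calc 4 * (2 / α) ^ k ≤ Real.exp (2 * k * U) * Real.exp (25 * U) ^ k := by gcongr
        _ = _ := by rw [← Real.exp_nat_mul, ← Real.exp_add]; congr 1; ring
    have h2 := Real.log_le_log (by positivity) h1
    rw [Real.log_exp] at h2
    rw [hn']
    linarith
  have hn1 : (1 : ℝ) ≤ n := by exact_mod_cast hn0
  have b5 : 1000 * (((J : ℝ) + 1) * n) ≤ L := by
    rw [hL']
    have h1 : 0 ≤ ((J : ℝ) + 1) * n := by positivity
    calc 1000 * (((J : ℝ) + 1) * n) ≤ 3200 * (J + 1) * n * 1 := by linarith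
      _ ≤ _ := by gcongr; exact hU1 _
  have b6 : 10 * ((J : ℝ) * n) ≤ α ^ 8 / 320 * L := by
    rw [hL']
    calc 10 * ((J : ℝ) * n) ≤ 10 * ((J + 1) * n) * 1 := by
          rw [mul_one]; gcongr; linarith
      _ ≤ 10 * ((J + 1) * n) * (U ^ 192 * α ^ 8) := by gcongr
      _ = _ := by ring
  have hL1 : (1 : ℝ) ≤ L := by exact_mod_cast hL0
  have hm1 : (1 : ℝ) ≤ m := by exact_mod_cast hm0
  have b7 : stp α m n L ≤ 1 := by
    unfold stp
    have h0 : α ^ 8 / 20 ≤ 1 := by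
      have := pow_le_one₀ hα.le hα1 (n := 8)
      linarith
    refine div_le_one_of_le₀ (h0.trans ?_) (by positivity)
    have h5 : (1 : ℝ) ≤ 4096 * m := by linarith
    have h6 : (1 : ℝ) ≤ 4096 * m * (n + 5) := one_le_mul_of_one_le_of_one_le h5 (by linarith)
    have h7 : (1 : ℝ) ≤ 4096 * m * (n + 5) * (n + 1) :=
      one_le_mul_of_one_le_of_one_le h6 (by linarith)
    exact one_le_mul_of_one_le_of_one_le h7 (one_le_pow₀ hL1)
  have b8 : 1 < 1.01 ^ (J + 1) * α := by
    have h1 : (2 : ℝ) ≤ 1.01 ^ 100 := by norm_num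
    have h2 : (U : ℝ) ^ 24 ≤ 1.01 ^ J := by
      have e1 : (1.01 : ℝ) ^ J = (1.01 ^ 100) ^ (48 * U) := by
        rw [hJ, ← pow_mul]; congr 1; ring
      rw [e1]
      refine (hUp 24).trans ?_
      calc (2 : ℝ) ^ (24 * U) ≤ 2 ^ (48 * U) := pow_le_pow_right₀ (by norm_num) (by omega)
        _ ≤ _ := by gcongr
    have h3 : (U : ℝ) ^ 24 * α ≤ 1.01 ^ J * α := by gcongr
    rw [pow_succ]
    have : 0 < 1.01 ^ J * α := by positivity
    linarith
  have b9 : 1 ≤ 2 ^ (2000 * U) * stp α m n L := by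
    have c1 : (m : ℝ) ≤ 2 ^ (9 * U) := by
      rw [hm']
      refine pw (a := 8) (b := 1) hU ?_ (by norm_num)
      have := hUp 1
      rw [pow_one] at this
      gcongr; norm_num
    have c2 : (k : ℝ) ≤ 2 ^ (71 * U) := by
      rw [hk']
      refine pw (a := 39) (b := 32) hU ?_ (by norm_num)
      have := hUp 32
      gcongr; norm_num
    have c3 : (n : ℝ) ≤ 2 ^ (81 * U) := by
      rw [hn']
      refine pw (a := 9) (b := 72) hU ?_ (by norm_num)
      have := hUp 1
      rw [pow_one] at this
      calc 432 * (k : ℝ) * U ≤ 2 ^ 9 * 2 ^ (71 * U) * 2 ^ (1 * U) := by gcongr; norm_num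
        _ = _ := by rw [mul_assoc, ← pow_add]; congr 2; ring
    have c4 : (n : ℝ) + 5 ≤ 2 ^ (84 * U) := by
      refine pw (a := 3) (b := 81) hU ?_ (by norm_num)
      have : (1 : ℝ) ≤ 2 ^ (81 * U) := one_le_pow₀ (by norm_num)
      linarith
    have c5 : (n : ℝ) + 1 ≤ 2 ^ (84 * U) := by linarith
    have c6 : (J : ℝ) + 1 ≤ 2 ^ (14 * U) := by
      rw [hJ']
      refine pw (a := 13) (b := 1) hU ?_ (by norm_num)
      have := hUp 1
      rw [pow_one] at this
      calc 4800 * (U : ℝ) + 1 ≤ 2 ^ 13 * U := by linarith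
        _ ≤ _ := by gcongr
    have c7 : (L : ℝ) ≤ 2 ^ (299 * U) := by
      rw [hL']
      refine pw (a := 12) (b := 287) hU ?_ (by norm_num)
      have := hUp 192
      calc 3200 * ((J : ℝ) + 1) * n * U ^ 192
          ≤ 2 ^ 12 * 2 ^ (14 * U) * 2 ^ (81 * U) * 2 ^ (192 * U) := by gcongr; norm_num
        _ = _ := by rw [mul_assoc, mul_assoc, ← pow_add, ← pow_add]; congr 2; ring
    have c8 : 20 * (4096 * (m : ℝ) * (n + 5) * (n + 1) * L ^ 5) * U ^ 192 ≤ 2 ^ (2000 * U) := by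
      refine pw (a := 17) (b := 9 + 84 + 84 + 299 * 5 + 192) hU ?_ (by norm_num)
      have := hUp 192
      calc 20 * (4096 * (m : ℝ) * (n + 5) * (n + 1) * L ^ 5) * U ^ 192
          = (20 * 4096) * m * (n + 5) * (n + 1) * L ^ 5 * U ^ 192 := by ring
        _ ≤ 2 ^ 17 * 2 ^ (9 * U) * 2 ^ (84 * U) * 2 ^ (84 * U) * (2 ^ (299 * U)) ^ 5 * 2 ^ (192 * U) := by
          gcongr; norm_num
        _ = _ := by rw [← pow_mul, ← pow_add, ← pow_add, ← pow_add, ← pow_add, ← pow_add,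
                      ← pow_add]; congr 1; ring
    unfold stp
    rw [mul_div_assoc', le_div_iff₀ (by positivity), one_mul]
    have h9 : 0 < 20 * (4096 * (m : ℝ) * (n + 5) * (n + 1) * L ^ 5) := by positivity
    have h10 : 20 * (4096 * (m : ℝ) * (n + 5) * (n + 1) * L ^ 5) * (U ^ 192 * α ^ 8) ≤
        2 ^ (2000 * U) * α ^ 8 := by
      rw [← mul_assoc]; gcongr
    have h11 : 20 * (4096 * (m : ℝ) * (n + 5) * (n + 1) * L ^ 5) * 1 ≤
        20 * (4096 * (m : ℝ) * (n + 5) * (n + 1) * L ^ 5) * (U ^ 192 * α ^ 8) := by gcongr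
    linarith
  have hfin := iter2 e he A hα hm0 hk0 hL0 b1 b2 b3 b4 b5 b6 b7 b8 b9 hA
  have hα3 : 1 ≤ (U : ℝ) ^ 72 * α ^ 3 := by
    have := one_le_pow₀ hαU (n := 3)
    calc 1 ≤ _ := this
      _ = _ := by ring
  have hb : (U : ℝ) ^ 72 * (4 * (100 ^ (J * n * (2000 * U * (J + 1) + 1))) ^ 2) ≤
      Real.exp (10 ^ 30 * U ^ 36) := by
    have h100 : (100 : ℝ) ≤ Real.exp 5 := by
      have h1 : (2.7 : ℝ) ≤ Real.exp 1 := by linarith [Real.exp_one_gt_d9]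
      calc (100 : ℝ) ≤ 2.7 ^ 5 := by norm_num
        _ ≤ Real.exp 1 ^ 5 := by gcongr
        _ = _ := by rw [← Real.exp_nat_mul]; norm_num
    have h4 : (4 : ℝ) ≤ Real.exp 5 := by linarith
    have h3 : (U : ℝ) ≤ Real.exp U := by linarith [Real.add_one_le_exp (U : ℝ)]
    calc (U : ℝ) ^ 72 * (4 * (100 ^ (J * n * (2000 * U * (J + 1) + 1))) ^ 2)
        ≤ Real.exp U ^ 72 * (Real.exp 5 *
          (Real.exp 5 ^ (J * n * (2000 * U * (J + 1) + 1))) ^ 2) := by gcongr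
      _ = Real.exp (72 * U + 5 + 10 * (J * n * (2000 * U * (J + 1) + 1))) := by
        rw [← Real.exp_nat_mul, ← Real.exp_nat_mul, ← Real.exp_nat_mul, ← Real.exp_add,
          ← Real.exp_add]
        congr 1; push_cast; ring
      _ ≤ _ := by
        refine Real.exp_le_exp.2 ?_
        have i1 : (U : ℝ) ≤ U ^ 36 := le_self_pow₀ hU' (by norm_num)
        have i2 : (1 : ℝ) ≤ U ^ 36 := hU1 36
        have i3 : 2000 * (U : ℝ) * (J + 1) + 1 ≤ 10 ^ 7 * U ^ 2 := by
          rw [hJ']; nlinarith only [hU']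
        have i4 : (J : ℝ) * n * (2000 * U * (J + 1) + 1) ≤ J * n * (10 ^ 7 * U ^ 2) := by gcongr
        have i5 : (J : ℝ) * n * (10 ^ 7 * U ^ 2) = (4800 * 432 * 4 * 10 ^ 18) * U ^ 36 := by
          rw [hJ', hn', hk']; ring
        rw [i5] at i4
        linarith only [i1, i2, i4]
  have hX0 : (0 : ℝ) ≤ Xc e A := by positivity
  calc (Fintype.card G : ℝ) ^ 2 = 1 * (Fintype.card G : ℝ) ^ 2 := by ring
    _ ≤ (U ^ 72 * α ^ 3) * (Fintype.card G : ℝ) ^ 2 := by gcongr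
    _ = U ^ 72 * (α ^ 3 * (Fintype.card G : ℝ) ^ 2) := by ring
    _ ≤ U ^ 72 * (4 * (100 ^ (J * n * (2000 * U * (J + 1) + 1))) ^ 2 * Xc e A) := by gcongr
    _ = (U ^ 72 * (4 * (100 ^ (J * n * (2000 * U * (J + 1) + 1))) ^ 2)) * Xc e A := by ring
    _ ≤ _ := by gcongr

theorem roth (e : G ≃+ G) (he : ∀ x, e x = x + x) (A : Finset G) {α : ℝ}
    (hα : 0 < α) (hα1 : α ≤ 1) (hA : α * Fintype.card G ≤ A.card) :
    (Fintype.card G : ℝ) ^ 2 ≤ Real.exp (10 ^ 30 * 2 ^ 36 * α ^ (-(3 : ℝ) / 2)) * Xc e A := by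
  obtain ⟨u, hu⟩ : ∃ u : ℝ, u = α ^ (-(1 : ℝ) / 24) := ⟨_, rfl⟩
  have hu0 : 0 < u := by rw [hu]; positivity
  have hu1 : 1 ≤ u := by
    rw [hu]; exact Real.one_le_rpow_of_pos_of_le_one_of_nonpos hα hα1 (by norm_num)
  have hu24 : u ^ 24 * α = 1 := by
    rw [hu, ← Real.rpow_natCast, ← Real.rpow_mul hα.le]
    norm_num
    rw [Real.rpow_neg_one]; field_simp
  have hu36 : u ^ 36 = α ^ (-(3 : ℝ) / 2) := by
    rw [hu, ← Real.rpow_natCast, ← Real.rpow_mul hα.le]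
    norm_num
  have hc1 : u ≤ ⌈u⌉₊ := Nat.le_ceil u
  have hc2 : (⌈u⌉₊ : ℝ) ≤ 2 * u := by linarith [Nat.ceil_lt_add_one hu0.le]
  have hU : 1 ≤ ⌈u⌉₊ := by
    have : (1 : ℝ) ≤ ⌈u⌉₊ := by linarith
    exact_mod_cast this
  have h := roth_U e he A hU hα hα1 (hu24.symm.le.trans (by gcongr)) hA
  refine h.trans ?_
  have h36 : (⌈u⌉₊ : ℝ) ^ 36 ≤ 2 ^ 36 * u ^ 36 := by
    rw [← mul_pow]; exact pow_le_pow_left₀ (by positivity) hc2 36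
  have h37 : (10 : ℝ) ^ 30 * (⌈u⌉₊ : ℝ) ^ 36 ≤ 10 ^ 30 * 2 ^ 36 * u ^ 36 := by linarith only [h36]
  rw [← hu36]
  exact mul_le_mul_of_nonneg_right (Real.exp_le_exp.2 h37) (by positivity)

end RB


set_option linter.unusedSectionVars false
set_option linter.unusedVariables false

namespace RB

section minim

variable {p : ℕ} [Fact p.Prime]

/-- Unnormalised count. -/
noncomputable def T (f : ZMod p → ℝ) : ℝ := ∑ n, ∑ d, f n * f (n + d) * f (n + 2 * d)

lemma pair_sum (u v : ZMod p → ℝ) {x y : ZMod p} (h : x ≠ y) :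
    ∑ r, ∑ s, u (r * x + s) * v (r * y + s) = (∑ t, u t) * ∑ t, v t := by
  have h1 : ∀ r, ∑ s, u (r * x + s) * v (r * y + s) = ∑ t, u t * v (t + r * (y - x)) := by
    intro r
    refine Fintype.sum_equiv (Equiv.addLeft (r * x)) _ _ fun s => ?_
    simp only [Equiv.coe_addLeft]
    congr 2; ring
  simp only [h1]
  rw [Finset.sum_comm, Finset.sum_mul]
  refine Finset.sum_congr rfl fun t _ => ?_
  rw [← Finset.mul_sum]
  congr 1
  exact Fintype.sum_equiv ((Equiv.mulRight₀ (y - x) (sub_ne_zero.2 h.symm)).trans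
    (Equiv.addLeft t)) _ _ fun r => by simp

lemma lin_sum (u : ZMod p → ℝ) (x : ZMod p) :
    ∑ r, ∑ s, u (r * x + s) = p * ∑ t, u t := by
  have h1 : ∀ r, ∑ s, u (r * x + s) = ∑ t, u t := by
    intro r
    exact Fintype.sum_equiv (Equiv.addLeft (r * x)) _ _ fun s => rfl
  simp [h1]

lemma cube_sum (u : ZMod p → ℝ) (n : ZMod p) {d : ZMod p} (hd : d ≠ 0) :
    ∑ r, ∑ s, u (r * n + s) * u (r * (n + d) + s) * u (r * (n + 2 * d) + s) = T u := by
  have h1 : ∀ r, ∑ s, u (r * n + s) * u (r * (n + d) + s) * u (r * (n + 2 * d) + s) =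
      ∑ t, u t * u (t + r * d) * u (t + 2 * (r * d)) := by
    intro r
    refine Fintype.sum_equiv (Equiv.addLeft (r * n)) _ _ fun s => ?_
    simp only [Equiv.coe_addLeft]
    congr 2
    · congr 1; ring
    · ring
  simp only [h1]
  rw [T, Finset.sum_comm]
  refine Finset.sum_congr rfl fun t _ => ?_
  exact Fintype.sum_equiv (Equiv.mulRight₀ d hd) _ _ fun r => by simp

lemma two_ne (hp : Odd p) : (2 : ZMod p) ≠ 0 := by
  intro h
  have h2 : ((2 : ℕ) : ZMod p) = 0 := by exact_mod_cast h
  rw [ZMod.natCast_eq_zero_iff] at h2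
  have := (Nat.prime_dvd_prime_iff_eq (Fact.out : p.Prime) Nat.prime_two).1 h2
  subst this
  exact absurd hp (by decide)

/-- perturbed function -/
noncomputable def pert (f w ψ : ZMod p → ℝ) (r s : ZMod p) (x : ZMod p) : ℝ :=
  f x + w x * ψ (r * x + s)

lemma pert_term (hp : Odd p) (f w ψ : ZMod p → ℝ) (hψ : ∑ t, ψ t = 0) (n : ZMod p) {d : ZMod p}
    (hd : d ≠ 0) :
    ∑ r, ∑ s, pert f w ψ r s n * pert f w ψ r s (n + d) * pert f w ψ r s (n + 2 * d) =
      p ^ 2 * (f n * f (n + d) * f (n + 2 * d)) + w n * w (n + d) * w (n + 2 * d) * T ψ := by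
  have h2 := two_ne hp
  have d1 : n ≠ n + d := by simpa using hd
  have d2 : n ≠ n + 2 * d := by simpa using ⟨h2, hd⟩
  have d3 : n + d ≠ n + 2 * d := by
    intro h
    apply hd
    have := add_left_cancel h
    have h3 : d + d = d + 0 := by rw [add_zero, ← two_mul]; exact this.symm
    exact add_left_cancel h3
  have q1 := pair_sum ψ ψ d1
  have q2 := pair_sum ψ ψ d2
  have q3 := pair_sum ψ ψ d3
  have l1 := lin_sum ψ n
  have l2 := lin_sum ψ (n + d)
  have l3 := lin_sum ψ (n + 2 * d)
  have c := cube_sum ψ n hd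
  rw [hψ] at q1 q2 q3 l1 l2 l3
  rw [mul_zero] at q1 q2 q3 l1 l2 l3
  have key : ∀ r s, pert f w ψ r s n * pert f w ψ r s (n + d) * pert f w ψ r s (n + 2 * d) =
      f n * f (n + d) * f (n + 2 * d) + (w n * f (n + d) * f (n + 2 * d)) * ψ (r * n + s)
      + (f n * w (n + d) * f (n + 2 * d)) * ψ (r * (n + d) + s)
      + (f n * f (n + d) * w (n + 2 * d)) * ψ (r * (n + 2 * d) + s)
      + (w n * w (n + d) * f (n + 2 * d)) * (ψ (r * n + s) * ψ (r * (n + d) + s))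
      + (w n * f (n + d) * w (n + 2 * d)) * (ψ (r * n + s) * ψ (r * (n + 2 * d) + s))
      + (f n * w (n + d) * w (n + 2 * d)) * (ψ (r * (n + d) + s) * ψ (r * (n + 2 * d) + s))
      + (w n * w (n + d) * w (n + 2 * d)) *
        (ψ (r * n + s) * ψ (r * (n + d) + s) * ψ (r * (n + 2 * d) + s)) := by
    intro r s; simp only [pert]; ring
  simp only [key, Finset.sum_add_distrib, ← Finset.mul_sum]
  rw [q1, q2, q3, l1, l2, l3, c]
  simp
  ring

lemma sum_rs_T (hp : Odd p) (f w ψ : ZMod p → ℝ) (hψ : ∑ t, ψ t = 0)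
    (hf : ∀ x, 0 ≤ f x) (hw : ∀ x, 0 ≤ w x ∧ w x ≤ 1) (hT : T ψ ≤ 0) (hT2 : -(p : ℝ) ^ 2 ≤ T ψ)
    (hg : ∀ r s x, 0 ≤ pert f w ψ r s x ∧ pert f w ψ r s x ≤ 1) :
    ∑ r, ∑ s, T (pert f w ψ r s) ≤ p ^ 2 * T f + T ψ * T w + 2 * p ^ 3 := by
  have e1 : ∑ r, ∑ s, T (pert f w ψ r s) = ∑ n, ∑ d, ∑ r, ∑ s,
      pert f w ψ r s n * pert f w ψ r s (n + d) * pert f w ψ r s (n + 2 * d) := by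
    simp only [T]
    calc _ = ∑ r, ∑ n, ∑ s, ∑ d,
          pert f w ψ r s n * pert f w ψ r s (n + d) * pert f w ψ r s (n + 2 * d) :=
        Finset.sum_congr rfl fun r _ => Finset.sum_comm
      _ = ∑ r, ∑ n, ∑ d, ∑ s,
          pert f w ψ r s n * pert f w ψ r s (n + d) * pert f w ψ r s (n + 2 * d) :=
        Finset.sum_congr rfl fun r _ => Finset.sum_congr rfl fun n _ => Finset.sum_comm
      _ = ∑ n, ∑ r, ∑ d, ∑ s,
          pert f w ψ r s n * pert f w ψ r s (n + d) * pert f w ψ r s (n + 2 * d) :=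
        Finset.sum_comm
      _ = _ := Finset.sum_congr rfl fun n _ => Finset.sum_comm
  rw [e1]
  have hp0 : (0 : ℝ) ≤ p := by positivity
  have e2 : ∀ n d, ∑ r, ∑ s,
      pert f w ψ r s n * pert f w ψ r s (n + d) * pert f w ψ r s (n + 2 * d) ≤
      p ^ 2 * (f n * f (n + d) * f (n + 2 * d)) + w n * w (n + d) * w (n + 2 * d) * T ψ +
        if d = 0 then 2 * (p : ℝ) ^ 2 else 0 := by
    intro n d
    by_cases hd : d = 0
    · have h1 : ∀ r s, pert f w ψ r s n * pert f w ψ r s (n + d) * pert f w ψ r s (n + 2 * d) ≤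
          1 := by
        intro r s
        have a1 := hg r s n
        have a2 := hg r s (n + d)
        have a3 := hg r s (n + 2 * d)
        exact mul_le_one₀ (mul_le_one₀ a1.2 a2.1 a2.2) a3.1 a3.2
      have h2 : ∑ r, ∑ s,
          pert f w ψ r s n * pert f w ψ r s (n + d) * pert f w ψ r s (n + 2 * d) ≤
          ∑ r : ZMod p, ∑ s : ZMod p, (1 : ℝ) :=
        Finset.sum_le_sum fun r _ => Finset.sum_le_sum fun s _ => h1 r s
      have h3 : ∑ r : ZMod p, ∑ s : ZMod p, (1 : ℝ) = (p : ℝ) ^ 2 := by simp [sq]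
      rw [h3] at h2
      have h4 : 0 ≤ (p : ℝ) ^ 2 * (f n * f (n + d) * f (n + 2 * d)) :=
        mul_nonneg (by positivity) (mul_nonneg (mul_nonneg (hf _) (hf _)) (hf _))
      have h5 : w n * w (n + d) * w (n + 2 * d) ≤ 1 :=
        mul_le_one₀ (mul_le_one₀ (hw _).2 (hw _).1 (hw _).2) (hw _).1 (hw _).2
      have h6 : 0 ≤ w n * w (n + d) * w (n + 2 * d) :=
        mul_nonneg (mul_nonneg (hw _).1 (hw _).1) (hw _).1
      have h7 : -(p : ℝ) ^ 2 ≤ w n * w (n + d) * w (n + 2 * d) * T ψ := by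
        nlinarith only [h5, h6, hT, hT2]
      rw [if_pos hd]
      linarith
    · rw [if_neg hd, add_zero]
      exact (pert_term hp f w ψ hψ n hd).le
  refine (Finset.sum_le_sum fun n _ => Finset.sum_le_sum fun d _ => e2 n d).trans (le_of_eq ?_)
  simp only [Finset.sum_add_distrib, ← Finset.mul_sum, ← Finset.sum_mul]
  rw [← T, ← T]
  simp
  ring

lemma sum_dev (hp : Odd p) (w ψ : ZMod p → ℝ) (hψ : ∑ t, ψ t = 0) (hψ1 : ∀ t, |ψ t| ≤ 1)
    (hw : ∀ x, 0 ≤ w x ∧ w x ≤ 1) :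
    ∑ r, ∑ s, (∑ x, w x * ψ (r * x + s)) ^ 2 ≤ (p : ℝ) ^ 3 := by
  have e1 : ∑ r, ∑ s, (∑ x, w x * ψ (r * x + s)) ^ 2 =
      ∑ x, ∑ y, w x * w y * ∑ r, ∑ s, ψ (r * x + s) * ψ (r * y + s) := by
    simp only [sq, Finset.sum_mul_sum]
    simp only [Finset.mul_sum]
    calc _ = ∑ r, ∑ x, ∑ s, ∑ y, w x * ψ (r * x + s) * (w y * ψ (r * y + s)) :=
        Finset.sum_congr rfl fun r _ => Finset.sum_comm
      _ = ∑ r, ∑ x, ∑ y, ∑ s, w x * ψ (r * x + s) * (w y * ψ (r * y + s)) :=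
        Finset.sum_congr rfl fun r _ => Finset.sum_congr rfl fun n _ => Finset.sum_comm
      _ = ∑ x, ∑ r, ∑ y, ∑ s, w x * ψ (r * x + s) * (w y * ψ (r * y + s)) :=
        Finset.sum_comm
      _ = ∑ x, ∑ y, ∑ r, ∑ s, w x * ψ (r * x + s) * (w y * ψ (r * y + s)) :=
        Finset.sum_congr rfl fun n _ => Finset.sum_comm
      _ = _ := by
        refine Finset.sum_congr rfl fun x _ => Finset.sum_congr rfl fun y _ =>
          Finset.sum_congr rfl fun r _ => Finset.sum_congr rfl fun s _ => ?_
        ring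
  rw [e1]
  have e2 : ∀ x y, w x * w y * ∑ r, ∑ s, ψ (r * x + s) * ψ (r * y + s) ≤
      if x = y then (p : ℝ) ^ 2 else 0 := by
    intro x y
    by_cases h : x = y
    · rw [if_pos h]
      have h1 : ∑ r, ∑ s, ψ (r * x + s) * ψ (r * y + s) ≤ ∑ r : ZMod p, ∑ s : ZMod p, (1 : ℝ) := by
        refine Finset.sum_le_sum fun r _ => Finset.sum_le_sum fun s _ => ?_
        rw [h]
        have := hψ1 (r * y + s)
        rw [abs_le] at this
        nlinarith
      have h3 : ∑ r : ZMod p, ∑ s : ZMod p, (1 : ℝ) = (p : ℝ) ^ 2 := by simp [sq]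
      rw [h3] at h1
      have h5 : w x * w y ≤ 1 := mul_le_one₀ (hw _).2 (hw _).1 (hw _).2
      have h6 : 0 ≤ w x * w y := mul_nonneg (hw _).1 (hw _).1
      calc _ ≤ w x * w y * (p : ℝ) ^ 2 := by gcongr
        _ ≤ 1 * (p : ℝ) ^ 2 := by gcongr
        _ = _ := one_mul _
    · rw [if_neg h, pair_sum ψ ψ h, hψ]; simp
  refine (Finset.sum_le_sum fun n _ => Finset.sum_le_sum fun d _ => e2 n d).trans (le_of_eq ?_)
  simp
  ring

lemma sum_abs_dev (hp : Odd p) (w ψ : ZMod p → ℝ) (hψ : ∑ t, ψ t = 0) (hψ1 : ∀ t, |ψ t| ≤ 1)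
    (hw : ∀ x, 0 ≤ w x ∧ w x ≤ 1) :
    ∑ r, ∑ s, |∑ x, w x * ψ (r * x + s)| ≤ (p : ℝ) ^ 2 * Real.sqrt p := by
  have h := sum_dev hp w ψ hψ hψ1 hw
  have hp0 : (0 : ℝ) ≤ p := by positivity
  rw [← Finset.sum_product'] at h ⊢
  have hcs := sq_sum_le_card_mul_sum_sq (s := (Finset.univ ×ˢ Finset.univ : Finset (ZMod p × ZMod p)))
    (f := fun q => |∑ x, w x * ψ (q.1 * x + q.2)|)
  simp only [sq_abs] at hcs
  rw [Finset.card_product, Finset.card_univ, ZMod.card] at hcs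
  push_cast at hcs
  refine le_of_sq_le_sq ?_ (by positivity)
  calc _ ≤ _ := hcs
    _ ≤ (p : ℝ) * p * p ^ 3 := by gcongr
    _ = (p ^ 2 * Real.sqrt p) ^ 2 := by rw [mul_pow, Real.sq_sqrt hp0]; ring

lemma T_mono (g g' : ZMod p → ℝ) (h : ∀ x, g x ≤ g' x) (hg : ∀ x, 0 ≤ g x) (hg' : ∀ x, g' x ≤ 1) :
    T g' ≤ T g + 3 * p * (∑ x, g' x - ∑ x, g x) := by
  have h1 : ∀ n d, g' n * g' (n + d) * g' (n + 2 * d) ≤ g n * g (n + d) * g (n + 2 * d) +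
      ((g' n - g n) + (g' (n + d) - g (n + d)) + (g' (n + 2 * d) - g (n + 2 * d))) := by
    intro n d
    have a : ∀ x, 0 ≤ g' x - g x := fun x => by linarith [h x]
    have b1 : ∀ x, g x ≤ 1 := fun x => (h x).trans (hg' x)
    have b0 : ∀ x, 0 ≤ g' x := fun x => (hg x).trans (h x)
    have t1 : (g' n - g n) * (g' (n + d) * g' (n + 2 * d)) ≤ (g' n - g n) * 1 :=
      mul_le_mul_of_nonneg_left (mul_le_one₀ (hg' _) (b0 _) (hg' _)) (a _)
    have t2 : (g' (n + d) - g (n + d)) * (g n * g' (n + 2 * d)) ≤ (g' (n + d) - g (n + d)) * 1 :=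
      mul_le_mul_of_nonneg_left (mul_le_one₀ (b1 _) (b0 _) (hg' _)) (a _)
    have t3 : (g' (n + 2 * d) - g (n + 2 * d)) * (g n * g (n + d)) ≤
        (g' (n + 2 * d) - g (n + 2 * d)) * 1 :=
      mul_le_mul_of_nonneg_left (mul_le_one₀ (b1 _) (hg _) (b1 _)) (a _)
    linarith only [t1, t2, t3]
  have h2 := Finset.sum_le_sum fun n (_ : n ∈ (Finset.univ : Finset (ZMod p))) =>
    Finset.sum_le_sum fun d (_ : d ∈ (Finset.univ : Finset (ZMod p))) => h1 n d
  have sh : ∀ (c : ZMod p) (u : ZMod p → ℝ), ∑ n, ∑ d, u (n + c * d) = p * ∑ t, u t := by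
    intro c u
    rw [Finset.sum_comm]
    have : ∀ d : ZMod p, ∑ n, u (n + c * d) = ∑ t, u t := fun d =>
      Fintype.sum_equiv (Equiv.addRight (c * d)) _ _ fun s => rfl
    simp [this]
  have s1 := sh 1 (fun x => g' x - g x)
  have s2 := sh 2 (fun x => g' x - g x)
  have s0 := sh 0 (fun x => g' x - g x)
  simp only [one_mul, zero_mul, add_zero] at s1 s0
  rw [Finset.sum_sub_distrib] at s0 s1 s2
  simp only [Finset.sum_add_distrib (f := fun d => _ * _ * _), Finset.sum_add_distrib] at h2
  rw [← T, ← T, s0, s1, s2] at h2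
  linarith

lemma raise (f g : ZMod p → ℝ) (hf : ∀ x, f x ≤ 1) (hg : ∀ x, 0 ≤ g x ∧ g x ≤ 1) :
    ∃ g' : ZMod p → ℝ, (∀ x, 0 ≤ g' x ∧ g' x ≤ 1) ∧ ∑ x, f x ≤ ∑ x, g' x ∧
      T g' ≤ T g + 3 * p * |∑ x, g x - ∑ x, f x| := by
  by_cases h : ∑ x, f x ≤ ∑ x, g x
  · exact ⟨g, hg, h, by have : (0 : ℝ) ≤ 3 * p * |∑ x, g x - ∑ x, f x| := by positivity
                        linarith⟩
  · push Not at h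
    have hfp : ∑ x, f x ≤ p := by
      have := Finset.sum_le_sum fun x (_ : x ∈ (Finset.univ : Finset (ZMod p))) => hf x
      simpa using this
    obtain ⟨l, hl⟩ : ∃ l, l = (∑ x, f x - ∑ x, g x) / (p - ∑ x, g x) := ⟨_, rfl⟩
    have hd : 0 < p - ∑ x, g x := by linarith
    have hl0 : 0 ≤ l := by rw [hl]; exact div_nonneg (by linarith) hd.le
    have hl1 : l ≤ 1 := by rw [hl]; exact div_le_one_of_le₀ (by linarith) hd.le
    have hle : ∀ x, g x ≤ g x + (1 - g x) * l := fun x => by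
      have := mul_nonneg (sub_nonneg.2 (hg x).2) hl0
      linarith
    have hle1 : ∀ x, g x + (1 - g x) * l ≤ 1 := fun x => by
      have := mul_le_mul_of_nonneg_left hl1 (sub_nonneg.2 (hg x).2)
      linarith
    have hsum : ∑ x, (g x + (1 - g x) * l) = ∑ x, f x := by
      rw [Finset.sum_add_distrib, ← Finset.sum_mul, Finset.sum_sub_distrib]
      simp only [Finset.sum_const, Finset.card_univ, ZMod.card, nsmul_eq_mul, mul_one]
      rw [hl]; field_simp; ring
    refine ⟨fun x => g x + (1 - g x) * l, fun x => ⟨(hg x).1.trans (hle x), hle1 x⟩, hsum.ge, ?_⟩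
    have := T_mono g (fun x => g x + (1 - g x) * l) hle (fun x => (hg x).1) hle1
    rw [hsum] at this
    rw [abs_sub_comm, abs_of_pos (by linarith)]
    exact this

lemma min_bound (hp : Odd p) (f w ψ : ZMod p → ℝ) (hψ : ∑ t, ψ t = 0) (hψ1 : ∀ t, |ψ t| ≤ 1)
    (hf : ∀ x, 0 ≤ f x ∧ f x ≤ 1) (hw : ∀ x, 0 ≤ w x ∧ w x ≤ f x ∧ w x ≤ 1 - f x)
    (hT : T ψ ≤ 0) (hT2 : -(p : ℝ) ^ 2 ≤ T ψ)
    (hmin : ∀ g : ZMod p → ℝ, (∀ x, 0 ≤ g x ∧ g x ≤ 1) → ∑ x, f x ≤ ∑ x, g x → T f ≤ T g) :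
    -T ψ * T w ≤ 5 * (p : ℝ) ^ 3 * Real.sqrt p := by
  have hw1 : ∀ x, 0 ≤ w x ∧ w x ≤ 1 := fun x => ⟨(hw x).1, (hw x).2.1.trans (hf x).2⟩
  have hg : ∀ r s x, 0 ≤ pert f w ψ r s x ∧ pert f w ψ r s x ≤ 1 := by
    intro r s x
    have a := abs_le.1 (hψ1 (r * x + s))
    have b := hw x
    unfold pert
    constructor
    · nlinarith only [a.1, b.1, b.2.1]
    · nlinarith only [a.2, b.1, b.2.2]
  have h1 : ∀ r s, T f ≤ T (pert f w ψ r s) + 3 * p * |∑ x, w x * ψ (r * x + s)| := by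
    intro r s
    obtain ⟨g', a, b, c⟩ := raise f (pert f w ψ r s) (fun x => (hf x).2) (hg r s)
    have := hmin g' a b
    have e : ∑ x, pert f w ψ r s x - ∑ x, f x = ∑ x, w x * ψ (r * x + s) := by
      simp only [pert, Finset.sum_add_distrib]; ring
    rw [e] at c
    linarith
  have h2 := Finset.sum_le_sum fun n (_ : n ∈ (Finset.univ : Finset (ZMod p))) =>
    Finset.sum_le_sum fun d (_ : d ∈ (Finset.univ : Finset (ZMod p))) => h1 n d
  simp only [Finset.sum_add_distrib, ← Finset.mul_sum] at h2
  have h3 := sum_abs_dev hp w ψ hψ hψ1 hw1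
  have h4 := sum_rs_T hp f w ψ hψ (fun x => (hf x).1) hw1 hT hT2 hg
  have h5 : ∑ r : ZMod p, ∑ s : ZMod p, T f = p ^ 2 * T f := by simp; ring
  rw [h5] at h2
  have hp1 : (1 : ℝ) ≤ p := by exact_mod_cast (Fact.out : p.Prime).one_lt.le
  have h6 : 1 ≤ Real.sqrt p := Real.one_le_sqrt.2 hp1
  have h7 : 3 * (p : ℝ) * ∑ r, ∑ s, |∑ x, w x * ψ (r * x + s)| ≤
    3 * p * (p ^ 2 * Real.sqrt p) := by gcongr
  have h8 : (p : ℝ) ^ 3 * 1 ≤ p ^ 3 * Real.sqrt p := by gcongr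
  linarith

end minim

end RB


set_option linter.unusedSectionVars false
set_option linter.unusedVariables false

namespace RB

section final

variable {p : ℕ} [Fact p.Prime]

lemma T_const_sub (hp : Odd p) (u : ZMod p → ℝ) (c : ℝ) (hc : ∑ t, u t = c * p) :
    T (fun t => c - u t) = (p : ℝ) ^ 2 * c ^ 3 - T u := by
  have h2 := two_ne hp
  have l0 : ∑ n : ZMod p, ∑ d : ZMod p, u n = p * ∑ t, u t := by
    rw [Finset.sum_comm]; simp [Finset.mul_sum]
  have l1 : ∑ n : ZMod p, ∑ d : ZMod p, u (n + d) = p * ∑ t, u t := by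
    rw [Finset.sum_comm, ← lin_sum u 1]
    exact Finset.sum_congr rfl fun d _ => Finset.sum_congr rfl fun n _ => by congr 1; ring
  have l2 : ∑ n : ZMod p, ∑ d : ZMod p, u (n + 2 * d) = p * ∑ t, u t := by
    rw [Finset.sum_comm, ← lin_sum u 2]
    exact Finset.sum_congr rfl fun d _ => Finset.sum_congr rfl fun n _ => by congr 1; ring
  have q1 : ∑ n : ZMod p, ∑ d : ZMod p, u n * u (n + d) = (∑ t, u t) * ∑ t, u t := by
    rw [Finset.sum_comm, ← pair_sum u u (zero_ne_one (α := ZMod p))]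
    refine Finset.sum_congr rfl fun d _ => Finset.sum_congr rfl fun n _ => ?_
    congr 2 <;> ring
  have q2 : ∑ n : ZMod p, ∑ d : ZMod p, u n * u (n + 2 * d) = (∑ t, u t) * ∑ t, u t := by
    rw [Finset.sum_comm, ← pair_sum u u h2.symm]
    refine Finset.sum_congr rfl fun d _ => Finset.sum_congr rfl fun n _ => ?_
    congr 2 <;> ring
  have h12 : (1 : ZMod p) ≠ 2 := by
    intro h
    apply one_ne_zero (α := ZMod p)
    linear_combination -h
  have q3 : ∑ n : ZMod p, ∑ d : ZMod p, u (n + d) * u (n + 2 * d) = (∑ t, u t) * ∑ t, u t := by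
    rw [Finset.sum_comm, ← pair_sum u u h12]
    refine Finset.sum_congr rfl fun d _ => Finset.sum_congr rfl fun n _ => ?_
    congr 2 <;> ring
  have e : T (fun t => c - u t) = ∑ n : ZMod p, ∑ d : ZMod p, (c ^ 3 - c ^ 2 * u n
      - c ^ 2 * u (n + d) - c ^ 2 * u (n + 2 * d) + c * (u n * u (n + d))
      + c * (u n * u (n + 2 * d)) + c * (u (n + d) * u (n + 2 * d))
      - u n * u (n + d) * u (n + 2 * d)) := by
    rw [T]
    exact Finset.sum_congr rfl fun d _ => Finset.sum_congr rfl fun n _ => by ring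
  rw [e]
  simp only [Finset.sum_add_distrib, Finset.sum_sub_distrib, ← Finset.mul_sum]
  simp only [← Finset.mul_sum] at q1 q2
  rw [l0, l1, l2, q1, q2, q3, ← T, hc]
  simp only [Finset.sum_const, Finset.card_univ, ZMod.card, nsmul_eq_mul]
  ring

lemma psi_exists (hp : Odd p) (h64 : 64 ≤ p) : ∃ ψ : ZMod p → ℝ, ∑ t, ψ t = 0 ∧
    (∀ t, |ψ t| ≤ 1) ∧ T ψ ≤ -((p : ℝ) / 128) ^ 2 ∧ -(p : ℝ) ^ 2 ≤ T ψ := by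
  have hp0 : (0 : ℝ) < p := by exact_mod_cast (by omega : 0 < p)
  obtain ⟨M, hM⟩ : ∃ M, M = p / 64 := ⟨_, rfl⟩
  have hM1 : 64 * M ≤ p := by omega
  have hM2 : p ≤ 128 * M := by omega
  have inj : ∀ a b : ℕ, a < p → b < p → (a : ZMod p) = b → a = b := by
    intro a b ha hb h
    have := congrArg ZMod.val h
    rwa [ZMod.val_cast_of_lt ha, ZMod.val_cast_of_lt hb] at this
  obtain ⟨I, hI⟩ : ∃ I : Finset (ZMod p), I = (Finset.range (4 * M)).image (Nat.cast) := ⟨_, rfl⟩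
  have hIc : I.card = 4 * M := by
    rw [hI, Finset.card_image_of_injOn, Finset.card_range]
    intro a ha b hb h
    simp only [Finset.coe_range, Set.mem_Iio] at ha hb
    exact inj a b (by omega) (by omega) h
  have hmem : ∀ a : ℕ, a < 4 * M → (a : ZMod p) ∈ I := by
    intro a ha
    rw [hI]; exact Finset.mem_image_of_mem _ (Finset.mem_range.2 ha)
  obtain ⟨u, hu⟩ : ∃ u : ZMod p → ℝ, u = fun t => if t ∈ I then 1 else 0 := ⟨_, rfl⟩
  have hu01 : ∀ t, 0 ≤ u t ∧ u t ≤ 1 := by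
    intro t; rw [hu]; dsimp only; split_ifs <;> norm_num
  have hus : ∑ t, u t = 4 * M := by
    rw [hu]; simp [hIc]
  obtain ⟨c, hc⟩ : ∃ c : ℝ, c = 4 * M / p := ⟨_, rfl⟩
  have hcp : c * p = 4 * M := by rw [hc]; field_simp
  have hM1r : 64 * (M : ℝ) ≤ p := by exact_mod_cast hM1
  have hM2r : (p : ℝ) ≤ 128 * M := by exact_mod_cast hM2
  have hMnn : (0 : ℝ) ≤ M := Nat.cast_nonneg _
  have hc0 : 0 ≤ c := by rw [hc]; positivity
  have hc1 : c ≤ 1 / 16 := by rw [hc, div_le_iff₀ hp0]; linarith only [hM1r]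
  have hψ1 : ∀ t, |c - u t| ≤ 1 := by
    intro t
    have := hu01 t
    rw [abs_le]; constructor <;> linarith [this.1, this.2]
  have hTu : 2 * (M : ℝ) ^ 2 ≤ T u := by
    rw [T, ← Finset.sum_product' (s := Finset.univ) (t := Finset.univ)
      (f := fun n d => u n * u (n + d) * u (n + 2 * d))]
    obtain ⟨S, hS⟩ : ∃ S : Finset (ZMod p × ZMod p), S = (Finset.range (2 * M) ×ˢ Finset.range M).image
      (fun q => ((q.1 : ZMod p), (q.2 : ZMod p))) := ⟨_, rfl⟩
    have hSc : S.card = 2 * M * M := by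
      rw [hS, Finset.card_image_of_injOn, Finset.card_product, Finset.card_range, Finset.card_range]
      rintro ⟨a, b⟩ h1 ⟨a', b'⟩ h2 h
      simp only [Finset.coe_product, Finset.coe_range, Set.mem_prod, Set.mem_Iio] at h1 h2
      simp only [Prod.mk.injEq] at h ⊢
      exact ⟨inj _ _ (by omega) (by omega) h.1, inj _ _ (by omega) (by omega) h.2⟩
    have h1 : ∑ q ∈ S, u q.1 * u (q.1 + q.2) * u (q.1 + 2 * q.2) = 2 * (M : ℝ) ^ 2 := by
      rw [Finset.sum_congr rfl (g := fun _ => (1 : ℝ))]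
      · rw [Finset.sum_const, hSc]; simp; ring
      · intro q hq
        rw [hS, Finset.mem_image] at hq
        obtain ⟨⟨a, b⟩, hab, rfl⟩ := hq
        simp only [Finset.mem_product, Finset.mem_range] at hab
        have m1 := hmem a (by omega)
        have m2 := hmem (a + b) (by omega)
        have m3 := hmem (a + 2 * b) (by omega)
        push_cast at m2 m3
        rw [hu]; simp [m1, m2, m3]
    rw [← h1]
    refine Finset.sum_le_sum_of_subset_of_nonneg (fun q _ => by simp) fun q _ _ => ?_
    exact mul_nonneg (mul_nonneg (hu01 _).1 (hu01 _).1) (hu01 _).1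
  refine ⟨fun t => c - u t, ?_, hψ1, ?_, ?_⟩
  · rw [Finset.sum_sub_distrib, hus]; simp; rw [mul_comm, hcp]; ring
  · rw [T_const_sub hp u c (by rw [hus, hcp])]
    have : (p : ℝ) ^ 2 * c ^ 3 = (c * p) ^ 2 * c := by ring
    rw [this, hcp]
    have h3 : (4 * (M : ℝ)) ^ 2 * c ≤ (4 * (M : ℝ)) ^ 2 * (1 / 16) :=
      mul_le_mul_of_nonneg_left hc1 (by positivity)
    have h4 : ((p : ℝ) / 128) ^ 2 ≤ (M : ℝ) ^ 2 :=
      pow_le_pow_left₀ (by positivity) (by linarith only [hM2r]) 2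
    linarith only [h3, h4, hTu]
  · rw [T]
    have : -(p : ℝ) ^ 2 = ∑ n : ZMod p, ∑ d : ZMod p, (-1 : ℝ) := by simp; ring
    rw [this]
    refine Finset.sum_le_sum fun n _ => Finset.sum_le_sum fun d _ => ?_
    refine (abs_le.1 ?_).1
    rw [abs_mul, abs_mul]
    exact mul_le_one₀ (mul_le_one₀ (hψ1 _) (abs_nonneg _) (hψ1 _)) (abs_nonneg _) (hψ1 _)

/-- Doubling as an equivalence. -/
noncomputable def dbl (hp : Odd p) : ZMod p ≃+ ZMod p :=
  { Equiv.mulLeft₀ (2 : ZMod p) (two_ne hp) with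
    map_add' := fun x y => by simp [mul_add] }

lemma dbl_apply (hp : Odd p) (x : ZMod p) : dbl hp x = x + x := by
  change (2 : ZMod p) * x = x + x
  ring

lemma count_le (hp : Odd p) (w : ZMod p → ℝ) (hw : ∀ x, 0 ≤ w x) (α : ℝ) (hα : 0 ≤ α)
    (A : Finset (ZMod p)) (hA : ∀ x ∈ A, α ≤ w x) :
    α ^ 3 * (Xc (dbl hp) A : ℝ) ≤ T w := by
  have e1 : T w = ∑ q : ZMod p × ZMod p, w q.1 * w ((dbl hp).symm (q.1 + q.2)) * w q.2 := by
    rw [T, Fintype.sum_prod_type]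
    refine Finset.sum_congr rfl fun n _ => ?_
    refine Fintype.sum_equiv ((dbl hp).toEquiv.trans (Equiv.addLeft n)) _ _ fun d => ?_
    have h1 : (dbl hp).symm (n + (n + dbl hp d)) = n + d := by
      rw [AddEquiv.symm_apply_eq, dbl_apply, dbl_apply]; ring
    have h2 : n + dbl hp d = n + 2 * d := by rw [dbl_apply]; ring
    change _ = w n * w ((dbl hp).symm (n + (n + dbl hp d))) * w (n + dbl hp d)
    rw [h1, h2]
  rw [e1, Xc]
  have e2 : ∑ q ∈ (A ×ˢ A).filter (fun q => (dbl hp).symm (q.1 + q.2) ∈ A), α ^ 3 ≤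
      ∑ q ∈ (A ×ˢ A).filter (fun q => (dbl hp).symm (q.1 + q.2) ∈ A),
        w q.1 * w ((dbl hp).symm (q.1 + q.2)) * w q.2 := by
    refine Finset.sum_le_sum fun q hq => ?_
    simp only [Finset.mem_filter, Finset.mem_product] at hq
    have h1 := hA _ hq.1.1
    have h2 := hA _ hq.1.2
    have h3 := hA _ hq.2
    have : α ^ 3 = α * α * α := by ring
    rw [this]
    exact mul_le_mul (mul_le_mul h1 h3 hα (hw _)) h2 hα (mul_nonneg (hw _) (hw _))
  rw [Finset.sum_const, nsmul_eq_mul, mul_comm] at e2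
  refine e2.trans ?_
  refine Finset.sum_le_sum_of_subset_of_nonneg (fun q _ => by simp) fun q _ _ => ?_
  exact mul_nonneg (mul_nonneg (hw _) (hw _)) (hw _)

end final

end RB


set_option linter.unusedSectionVars false
set_option linter.unusedVariables false

namespace RB

lemma log_analytic {P α X C₀ D : ℝ} (hP : 0 < P) (hα : 0 < α) (hα1 : α ≤ 1) (hC : 0 ≤ C₀) (hD : 1 ≤ D)
    (h1 : P ^ 2 ≤ Real.exp (C₀ * α ^ (-(3 : ℝ) / 2)) * X)
    (h2 : α ^ 3 * X ≤ D * (P * Real.sqrt P)) :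
    α ^ ((3 : ℝ) / 2) * Real.log P ≤ 2 * (Real.log D + C₀ + 2) := by
  obtain ⟨a, ha⟩ : ∃ a, a = α ^ (-(3 : ℝ) / 2) := ⟨_, rfl⟩
  rw [← ha] at h1
  have ha0 : 0 < a := by rw [ha]; positivity
  have hinv : α ^ ((3 : ℝ) / 2) * a = 1 := by
    rw [ha, ← Real.rpow_add hα]; norm_num
  have ha1 : 1 ≤ a := by
    rw [ha]; exact Real.one_le_rpow_of_pos_of_le_one_of_nonpos hα hα1 (by norm_num)
  have hla : Real.log a = -(3 : ℝ) / 2 * Real.log α := by rw [ha, Real.log_rpow hα]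
  have hla2 : Real.log a ≤ a := (Real.log_le_sub_one_of_pos ha0).trans (by linarith only)
  obtain ⟨s, hs⟩ : ∃ s, s = Real.sqrt P := ⟨_, rfl⟩
  have hs0 : 0 < s := by rw [hs]; exact Real.sqrt_pos.2 hP
  have hss : s * s = P := by rw [hs]; exact Real.mul_self_sqrt hP.le
  rw [← hs] at h2
  have hE := Real.exp_pos (C₀ * a)
  have h3 : α ^ 3 * P ^ 2 ≤ Real.exp (C₀ * a) * (D * (P * s)) := by
    calc α ^ 3 * P ^ 2 ≤ α ^ 3 * (Real.exp (C₀ * a) * X) :=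
          mul_le_mul_of_nonneg_left h1 (by positivity)
      _ = Real.exp (C₀ * a) * (α ^ 3 * X) := by ring
      _ ≤ _ := mul_le_mul_of_nonneg_left h2 hE.le
  have h4 : α ^ 3 * s ≤ Real.exp (C₀ * a) * D := by
    have hPs : 0 < P * s := mul_pos hP hs0
    refine le_of_mul_le_mul_right ?_ hPs
    calc α ^ 3 * s * (P * s) = α ^ 3 * P ^ 2 := by rw [← hss]; ring
      _ ≤ _ := h3
      _ = _ := by ring
  have h5 := Real.log_le_log (by positivity) h4
  have hD0 : 0 < D := by linarith only [hD]
  rw [Real.log_mul (by positivity) hs0.ne', Real.log_mul hE.ne' hD0.ne', Real.log_exp, Real.log_pow,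
    hs, Real.log_sqrt hP.le] at h5
  have hlD : 0 ≤ Real.log D := Real.log_nonneg hD
  have h6 : Real.log P ≤ 2 * (Real.log D + C₀ + 2) * a := by
    have : Real.log D ≤ Real.log D * a := le_mul_of_one_le_right hlD ha1
    push_cast at h5
    linarith only [h5, this, hla, hla2]
  calc α ^ ((3 : ℝ) / 2) * Real.log P ≤ α ^ ((3 : ℝ) / 2) * (2 * (Real.log D + C₀ + 2) * a) :=
        mul_le_mul_of_nonneg_left h6 (by positivity)
    _ = 2 * (Real.log D + C₀ + 2) * (α ^ ((3 : ℝ) / 2) * a) := by ring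
    _ = _ := by rw [hinv, mul_one]

lemma finish {α L C : ℝ} (hα : 0 < α) (hL : 0 < L) (hC : 0 < C) (h : α ^ ((3 : ℝ) / 2) * L ≤ C) :
    α ≤ C ^ ((2 : ℝ) / 3) * L ^ (-(2 : ℝ) / 3) := by
  have h1 : α ^ ((3 : ℝ) / 2) ≤ C * L⁻¹ := by
    rw [← div_eq_mul_inv, le_div_iff₀ hL]; exact h
  have h2 := Real.rpow_le_rpow (by positivity) h1 (by norm_num : (0 : ℝ) ≤ 2 / 3)
  rw [← Real.rpow_mul hα.le, Real.mul_rpow hC.le (by positivity), Real.inv_rpow hL.le,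
    ← Real.rpow_neg hL.le] at h2
  norm_num at h2 ⊢
  exact h2

section main

variable {p : ℕ} [Fact p.Prime]

lemma key (hp : Odd p) (f : ZMod p → ℝ) (hf : ∀ x, 0 ≤ f x ∧ f x ≤ 1)
    (hmin : ∀ g : ZMod p → ℝ, (∀ x, 0 ≤ g x ∧ g x ≤ 1) → ∑ x, f x ≤ ∑ x, g x → T f ≤ T g)
    (w : ZMod p → ℝ) (hw : ∀ x, 0 ≤ w x ∧ w x ≤ f x ∧ w x ≤ 1 - f x) (α : ℝ) (hα : 0 < α)
    (hs : ∑ x, w x = 2 * α * p) :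
    α ^ ((3 : ℝ) / 2) * Real.log p ≤ 2 * (Real.log (5 * 128 ^ 2) + 10 ^ 30 * 2 ^ 36 + 2) := by
  have hp0 : (0 : ℝ) < p := by exact_mod_cast (Fact.out : p.Prime).pos
  have hα1 : α ≤ 1 := by
    have h1 : ∑ x, w x ≤ ∑ x : ZMod p, (1 : ℝ) :=
      Finset.sum_le_sum fun x _ => (hw x).2.1.trans (hf x).2
    rw [hs] at h1
    simp at h1
    have : 2 * α ≤ 1 := le_of_mul_le_mul_right (by linarith only [h1]) hp0
    linarith only [this, hα]
  have hlD : 0 ≤ Real.log (5 * 128 ^ 2) := Real.log_nonneg (by norm_num)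
  rcases lt_or_ge p 64 with h64 | h64
  · have h1 : α ^ ((3 : ℝ) / 2) ≤ 1 := Real.rpow_le_one hα.le hα1 (by norm_num)
    have h2 : Real.log p ≤ 64 := (Real.log_le_sub_one_of_pos hp0).trans (by
      have : (p : ℝ) < 64 := by exact_mod_cast h64
      linarith only [this])
    have h3 : 0 ≤ Real.log p := Real.log_natCast_nonneg p
    have h4 : α ^ ((3 : ℝ) / 2) * Real.log p ≤ 1 * 64 := mul_le_mul h1 h2 h3 (by norm_num)
    generalize Real.log (5 * 128 ^ 2) = z at hlD ⊢
    norm_num at h4 ⊢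
    linarith only [h4, hlD]
  · obtain ⟨ψ, hψ0, hψ1, hψ2, hψ3⟩ := psi_exists hp h64
    have hψneg : T ψ ≤ 0 := hψ2.trans (neg_nonpos.2 (by positivity))
    have hb := min_bound hp f w ψ hψ0 hψ1 hf hw hψneg hψ3 hmin
    obtain ⟨A, hA⟩ : ∃ A : Finset (ZMod p), A = Finset.univ.filter fun x => α ≤ w x := ⟨_, rfl⟩
    have hcount := count_le hp w (fun x => (hw x).1) α hα.le A (by
      intro x hx; rw [hA] at hx; exact (Finset.mem_filter.1 hx).2)
    have hcard : α * Fintype.card (ZMod p) ≤ A.card := by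
      have h1 : ∑ x, w x ≤ ∑ x : ZMod p, ((if x ∈ A then 1 else 0) + α) := by
        refine Finset.sum_le_sum fun x _ => ?_
        have h2 := hw x
        have h3 := hf x
        by_cases hx : x ∈ A
        · rw [if_pos hx]; linarith only [h2.2.1, h3.2, hα]
        · rw [if_neg hx]
          have : ¬ α ≤ w x := fun h => hx (by rw [hA]; exact Finset.mem_filter.2 ⟨Finset.mem_univ _, h⟩)
          linarith only [this, lt_of_not_ge this]
      rw [Finset.sum_add_distrib, hs] at h1
      simp at h1
      rw [ZMod.card]
      linarith only [h1]
    have hr := roth (dbl hp) (dbl_apply hp) A hα hα1 hcard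
    rw [ZMod.card] at hr
    refine log_analytic hp0 hα hα1 (by norm_num) (by norm_num) hr (hcount.trans ?_)
    have hTw : 0 ≤ T w := le_trans (by positivity) hcount
    have h5 : ((p : ℝ) / 128) ^ 2 * T w ≤ -T ψ * T w :=
      mul_le_mul_of_nonneg_right (by linarith only [hψ2]) hTw
    have hp2 : (0 : ℝ) < (p / 128) ^ 2 := by positivity
    refine le_of_mul_le_mul_left ((h5.trans hb).trans (le_of_eq ?_)) hp2
    ring

end main

end RB

theorem stmt_0 :
    ∃ K : ℝ, 0 < K ∧
      ∀ (p : ℕ) [Fact p.Prime], Odd p →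
        ∀ θ : ℝ, θ ∈ Set.Ioc (0 : ℝ) 1 →
          ∀ f : ZMod p → ℝ, (∀ n, f n ∈ Set.Icc (0 : ℝ) 1) →
            Ex p f ≥ θ →
            (∀ g : ZMod p → ℝ, (∀ n, g n ∈ Set.Icc (0 : ℝ) 1) → Ex p g ≥ θ →
              Lam p f ≤ Lam p g) →
            ∑ n : ZMod p, |f n - (if f n ≥ 1/2 then (1 : ℝ) else 0)| ≤
              K * p * (Real.log p) ^ (-(2 : ℝ)/3) := by
  obtain ⟨C, hC⟩ : ∃ C : ℝ, C = 2 * (Real.log (5 * 128 ^ 2) + 10 ^ 30 * 2 ^ 36 + 2) := ⟨_, rfl⟩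
  have hC0 : 0 < C := by
    have : 0 ≤ Real.log (5 * 128 ^ 2) := Real.log_nonneg (by norm_num)
    rw [hC]
    generalize Real.log (5 * 128 ^ 2) = z at this ⊢
    positivity
  refine ⟨2 * C ^ ((2 : ℝ) / 3), by positivity, ?_⟩
  intro p _ hp θ hθ f hf hE hmin
  have hp1 : 1 < p := (Fact.out : p.Prime).one_lt
  have hp0 : (0 : ℝ) < p := by exact_mod_cast (Fact.out : p.Prime).pos
  have hL : 0 < Real.log p := Real.log_pos (by exact_mod_cast hp1)
  have hmin' : ∀ g : ZMod p → ℝ, (∀ x, 0 ≤ g x ∧ g x ≤ 1) → ∑ x, f x ≤ ∑ x, g x →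
      RB.T f ≤ RB.T g := by
    intro g hg hs
    have h1 : Ex p g ≥ θ := by
      refine le_trans hE ?_
      rw [Ex, Ex]
      exact mul_le_mul_of_nonneg_left hs (by positivity)
    have h2 := hmin g (fun n => ⟨(hg n).1, (hg n).2⟩) h1
    rw [Lam, Lam] at h2
    exact le_of_mul_le_mul_left h2 (by positivity)
  obtain ⟨w, hw⟩ : ∃ w : ZMod p → ℝ, w = fun n => |f n - (if f n ≥ 1/2 then (1 : ℝ) else 0)| :=
    ⟨_, rfl⟩
  have hw1 : ∀ x, 0 ≤ w x ∧ w x ≤ f x ∧ w x ≤ 1 - f x := by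
    intro x
    have h := hf x
    rw [Set.mem_Icc] at h
    rw [hw]
    refine ⟨abs_nonneg _, ?_⟩
    dsimp only
    split_ifs with hx
    · rw [abs_of_nonpos (by linarith only [h.2])]
      constructor <;> linarith only [h.2, hx]
    · have hx' := lt_of_not_ge hx
      rw [abs_of_nonneg (by linarith only [h.1])]
      constructor <;> linarith only [h.1, hx']
  obtain ⟨α, hα⟩ : ∃ α : ℝ, α = (∑ x, w x) / (2 * p) := ⟨_, rfl⟩
  have hs : ∑ x, w x = 2 * α * p := by rw [hα]; field_simp
  have hα0 : 0 ≤ α := by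
    rw [hα]
    exact div_nonneg (Finset.sum_nonneg fun x _ => (hw1 x).1) (by positivity)
  have hgoal : ∑ n : ZMod p, |f n - (if f n ≥ 1/2 then (1 : ℝ) else 0)| = 2 * α * p := by
    rw [← hs, hw]
  rw [hgoal]
  rcases hα0.eq_or_lt with h0 | hpos
  · rw [← h0]
    have : 0 ≤ 2 * C ^ ((2 : ℝ) / 3) * p * Real.log p ^ (-(2 : ℝ) / 3) := by positivity
    linarith only [this]
  · have hk := RB.key hp f (fun x => ⟨(hf x).1, (hf x).2⟩) hmin' w hw1 α hpos hs
    rw [← hC] at hk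
    have h3 := RB.finish hpos hL hC0 hk
    calc 2 * α * p ≤ 2 * (C ^ ((2 : ℝ) / 3) * Real.log p ^ (-(2 : ℝ) / 3)) * p := by gcongr
      _ = _ := by ring
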